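/- Let X ⊂ P^{n+c} be a nondegenerate irreducible projective variety of dimension n, codimension c, and degree d, over an algebraically closed field of characteristic zero. Then the number of linearly independent quadrics containing X satisfies a₂(X) = h⁰(P^{n+c}, I_X(2)) ≤ C(c+1,2) − min{d−c−1, c}. -/

import Mathlib

/-!
Common framework: a projective variety `X ⊆ ℙ^N` over a field `k` is represented by its
affine cone `C ⊆ (ι → k)` (with `ι` the index type of homogeneous coordinates,
`Fintype.card ι = N + 1`).  All projective notions (vanishing ideal, `a₂`, Hilbert
function, dimension, degree, depth, base locus of quadrics, irreducible components,
scrolls and divisors on them, sectional genus, maximal sectional regularity) are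
defined concretely below.
-/

open MvPolynomial

noncomputable section

namespace PaperQuadrics

variable (k : Type) [Field k] (ι : Type) [Fintype ι] [DecidableEq ι]

/-- The vanishing ideal of a subset `C` of the affine cone `ι → k`. -/
def vanIdeal (C : Set (ι → k)) : Ideal (MvPolynomial ι k) :=
  ⨅ x ∈ C, RingHom.ker (MvPolynomial.eval x)

/-- The degree-`m` graded piece of an ideal of the polynomial ring. -/
def idealPiece (I : Ideal (MvPolynomial ι k)) (m : ℕ) : Submodule k (MvPolynomial ι k) :=
  Submodule.restrictScalars k I ⊓ homogeneousSubmodule ι k m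

/-- The space of quadrics vanishing on `C`, i.e. `H⁰(ℙ^N, I_C(2))`. -/
def quadrics (C : Set (ι → k)) : Submodule k (MvPolynomial ι k) :=
  idealPiece k ι (vanIdeal k ι C) 2

/-- `a₂(C) = h⁰(ℙ^N, I_C(2))`, the number of linearly independent quadrics through `C`. -/
def a2 (C : Set (ι → k)) : ℕ := Module.finrank k (quadrics k ι C)

/-- The Hilbert function of `R/I` in degree `m`. -/
def idealHilb (I : Ideal (MvPolynomial ι k)) (m : ℕ) : ℕ :=
  Module.finrank k (homogeneousSubmodule ι k m) - Module.finrank k (idealPiece k ι I m)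

/-- The Hilbert function of the homogeneous coordinate ring of `C`. -/
def hilb (C : Set (ι → k)) (m : ℕ) : ℕ := idealHilb k ι (vanIdeal k ι C) m

/-- `C ⊆ ι → k` is the affine cone of an irreducible projective variety:
it is a Zariski-closed cone whose vanishing ideal is prime. -/
structure IsProjVariety (C : Set (ι → k)) : Prop where
  zero_mem : (0 : ι → k) ∈ C
  smul_mem : ∀ x ∈ C, ∀ t : k, t • x ∈ C
  closed : C = {x | ∀ f ∈ vanIdeal k ι C, MvPolynomial.eval x f = 0}
  prime : (vanIdeal k ι C).IsPrime

/-- Nondegenerate: no nonzero linear form vanishes identically on `C`. -/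
def Nondeg (C : Set (ι → k)) : Prop :=
  ∀ f ∈ homogeneousSubmodule ι k 1, (∀ x ∈ C, MvPolynomial.eval x f = 0) → f = 0

/-- The projective variety with cone `C` has dimension `n`
(so the affine cone has Krull dimension `n + 1`). -/
def HasDim (C : Set (ι → k)) (n : ℕ) : Prop :=
  ringKrullDim (MvPolynomial ι k ⧸ vanIdeal k ι C) = (n + 1 : ℕ)

/-- `C` (of projective dimension `n`) has degree `d`:
the Hilbert function satisfies `hF(m) · n! / mⁿ → d`. -/
def HasDegree (C : Set (ι → k)) (n d : ℕ) : Prop :=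
  Filter.Tendsto (fun m : ℕ => (hilb k ι C m : ℝ) * (Nat.factorial n : ℝ) / (m : ℝ) ^ n)
    Filter.atTop (nhds (d : ℝ))

/-- `Q(C)`: the common zero set (base locus) of all quadrics through `C`. -/
def quadZero (C : Set (ι → k)) : Set (ι → k) :=
  {x | ∀ f ∈ quadrics k ι C, MvPolynomial.eval x f = 0}

/-- `fs` is a regular sequence on `R/I`. -/
def IsRegSeqOn (I : Ideal (MvPolynomial ι k)) (fs : List (MvPolynomial ι k)) : Prop :=
  (∀ i : Fin fs.length, ∀ g : MvPolynomial ι k,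
      fs.get i * g ∈ I ⊔ Ideal.span {h | ∃ j : Fin fs.length, j < i ∧ fs.get j = h} →
      g ∈ I ⊔ Ideal.span {h | ∃ j : Fin fs.length, j < i ∧ fs.get j = h}) ∧
  I ⊔ Ideal.span {h | ∃ j : Fin fs.length, fs.get j = h} ≠ ⊤

/-- Arithmetic depth of the homogeneous coordinate ring of `C`: the supremum of lengths of
regular sequences of elements of the irrelevant maximal ideal. -/
def arithDepth (C : Set (ι → k)) : ℕ :=
  sSup {l : ℕ | ∃ fs : List (MvPolynomial ι k), fs.length = l ∧
    (∀ f ∈ fs, MvPolynomial.coeff 0 f = 0) ∧ IsRegSeqOn k ι (vanIdeal k ι C) fs}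

/-- `Z` is an irreducible Zariski-closed cone. -/
def IsIrredClosed (Z : Set (ι → k)) : Prop :=
  Z = {x | ∀ f ∈ vanIdeal k ι Z, MvPolynomial.eval x f = 0} ∧ (vanIdeal k ι Z).IsPrime

/-- `Z` is an irreducible component of `Q`: an irreducible closed subset of `Q`, maximal
among the irreducible closed subsets of `Q`. -/
def IsComponentOf (Z Q : Set (ι → k)) : Prop :=
  IsIrredClosed k ι Z ∧ Z ⊆ Q ∧
    ∀ Z' : Set (ι → k), IsIrredClosed k ι Z' → Z ⊆ Z' → Z' ⊆ Q → Z' = Z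

/-- `C` is smooth away from the cone vertex, of codimension `c`: at each nonzero point the
Jacobian of the vanishing ideal has rank `c` (valid criterion in characteristic `0`). -/
def IsSmoothOfCodim (C : Set (ι → k)) (c : ℕ) : Prop :=
  ∀ x ∈ C, x ≠ (0 : ι → k) →
    Module.finrank k (Submodule.span k
      {v : ι → k | ∃ f ∈ vanIdeal k ι C,
        v = fun i => MvPolynomial.eval x (MvPolynomial.pderiv i f)}) = c

/-- The projective variety with affine cone `C` is a cone (in the projective sense):
there is a vertex point `[v]` such that `C` is stable under the join with `[v]`. -/
def IsConeVariety (C : Set (ι → k)) : Prop :=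
  ∃ v ∈ C, v ≠ 0 ∧ ∀ x ∈ C, ∀ s t : k, s • x + t • v ∈ C

/-- `C` (an `n`-dimensional variety of degree `d`) has sectional genus `g`: a general linear
curve section (cut by `n - 1` general hyperplanes) has Hilbert polynomial `d·m + 1 - g`. -/
def SectionalGenus (n : ℕ) (C : Set (ι → k)) (d g : ℕ) : Prop :=
  ∃ P : MvPolynomial (Fin (n - 1) × ι) k, P ≠ 0 ∧
    ∀ w : Fin (n - 1) → ι → k, MvPolynomial.eval (fun q => w q.1 q.2) P ≠ 0 →
      ∀ᶠ m in Filter.atTop,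
        (hilb k ι (C ∩ {x | ∀ j, ∑ i, w j i * x i = 0}) m : ℤ) = d * m + 1 - g

/-- `C` (an `n`-dimensional variety of degree `c + 3`) is a variety of maximal sectional
regularity: there is an `n`-dimensional linear subspace `F(X) = ℙ(L)` such that
`X ∩ F(X)` is (scheme-theoretically) a hypersurface of degree `4` in `F(X) ≅ ℙⁿ`,
detected by the Hilbert function of the ideal sum. -/
def IsVMSR (n : ℕ) (C : Set (ι → k)) : Prop :=
  ∃ L : Submodule k (ι → k), Module.finrank k L = n + 1 ∧
    ∀ᶠ m in Filter.atTop,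
      idealHilb k ι (vanIdeal k ι C ⊔ vanIdeal k ι (L : Set (ι → k))) m =
        Nat.choose (m + n) n - Nat.choose (m - 4 + n) n

end PaperQuadrics

namespace PaperQuadrics

variable {k : Type} [Field k]

/-- The parametrization of the rational normal scroll `S(a₀, …, aₙ)` (so the scroll has
dimension `n + 1`): homogeneous coordinates are indexed by `(i, j)`, `0 ≤ j ≤ aᵢ`,
and the point of parameters `(s : t) ∈ ℙ¹`, `λ` has coordinates `λᵢ sʲ t^{aᵢ - j}`. -/
def scrollParam (n : ℕ) (a : Fin (n + 1) → ℕ) (s t : k) (lam : Fin (n + 1) → k) :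
    ((i : Fin (n + 1)) × Fin (a i + 1)) → k :=
  fun x => lam x.1 * s ^ (x.2 : ℕ) * t ^ (a x.1 - (x.2 : ℕ))

/-- The affine cone of the scroll `S(a₀, …, aₙ) ⊆ ℙ^{n+1+c-1}`, `c = Σ aᵢ`. -/
def scrollCone (n : ℕ) (a : Fin (n + 1) → ℕ) :
    Set (((i : Fin (n + 1)) × Fin (a i + 1)) → k) :=
  {v | ∃ s t lam, v = scrollParam n a s t lam}

/-- Global sections of `O_Y(A·H + b·F)` on the scroll `Y = S(a₀, …, aₙ)`, realized as
bihomogeneous polynomials in `s, t` (the `ℙ¹`-coordinates) and `T₀, …, Tₙ` (the fiber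
coordinates): each monomial has total `T`-degree `A` and `(s,t)`-degree `b + Σ mᵢ aᵢ`. -/
def sectionSpace (k : Type) [Field k] (n : ℕ) (a : Fin (n + 1) → ℕ) (A b : ℤ) :
    Submodule k (MvPolynomial (Fin 2 ⊕ Fin (n + 1)) k) where
  carrier := {F | ∀ m ∈ F.support,
    ((∑ i, m (Sum.inr i) : ℕ) : ℤ) = A ∧
    ((m (Sum.inl 0) + m (Sum.inl 1) : ℕ) : ℤ)
      = b + ∑ i, (m (Sum.inr i) : ℤ) * (a i : ℤ)}
  add_mem' := by
    intro p q hp hq m hm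
    rcases Finset.mem_union.mp (MvPolynomial.support_add hm) with h | h
    · exact hp m h
    · exact hq m h
  zero_mem' := by
    intro m hm
    simp at hm
  smul_mem' := by
    intro c p hp m hm
    exact hp m (MvPolynomial.support_smul hm)

/-- The affine cone of the effective divisor `X ≡ A·H + b·F` on the scroll cut out by a
section `F`: the points of the scroll whose parameters are zeros of `F`. -/
def divisorCone (n : ℕ) (a : Fin (n + 1) → ℕ)
    (F : MvPolynomial (Fin 2 ⊕ Fin (n + 1)) k) :
    Set (((i : Fin (n + 1)) × Fin (a i + 1)) → k) :=
  {v | ∃ s t lam, v = scrollParam n a s t lam ∧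
     MvPolynomial.eval (Sum.elim (fun j : Fin 2 => if j = 0 then s else t) lam) F = 0}

end PaperQuadrics

open PaperQuadrics


namespace QuadricBound

open Module in
/-- A linear Cauchy--Davenport inequality for field extensions without intermediate fields. -/
theorem finrank_mul_of_forall_eq_bot_or_eq_top {K E : Type*} [Field K] [Field E] [Algebra K E]
    [FiniteDimensional K E] (hK : ∀ M : IntermediateField K E, M = ⊥ ∨ M = ⊤)
    (A B : Submodule K E) (hA : (1 : E) ∈ A) (hB : B ≠ ⊥) :
    A * B = ⊤ ∨ finrank K A + finrank K B ≤ finrank K ↥(A * B) + 1 := by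
  induction hm : finrank K A using Nat.strong_induction_on generalizing A B with
  | _ m ih =>
  subst hm
  have hBA : B ≤ A * B := fun b hb => by simpa using Submodule.mul_mem_mul hA hb
  by_cases hst : ∀ b ∈ B, ∀ x ∈ A, b * x ∈ B
  · by_cases hA1 : ∀ x ∈ A, x ∈ (⊥ : IntermediateField K E)
    · right
      have h1 : A ≤ Submodule.span K {(1 : E)} := by
        intro x hx
        obtain ⟨y, rfl⟩ := IntermediateField.mem_bot.1 (hA1 x hx)
        exact Submodule.mem_span_singleton.2 ⟨y, by rw [Algebra.smul_def, mul_one]⟩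
      have h2 := (Submodule.finrank_mono h1).trans (finrank_span_le_card ({(1 : E)} : Set E))
      have h3 := Submodule.finrank_mono hBA
      simp at h2
      omega
    · left
      push Not at hA1
      obtain ⟨x, hx, hxb⟩ := hA1
      let S : Subalgebra K E :=
        { carrier := {y | ∀ b ∈ B, b * y ∈ B}
          mul_mem' := fun {y z} hy hz b hb => by rw [← mul_assoc]; exact hz _ (hy b hb)
          add_mem' := fun {y z} hy hz b hb => by rw [mul_add]; exact add_mem (hy b hb) (hz b hb)
          algebraMap_mem' := fun r b hb => by
            rw [mul_comm, ← Algebra.smul_def]; exact B.smul_mem r hb }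
      have hxS : x ∈ S := fun b hb => hst b hb x hx
      have hadj : Algebra.adjoin K {x} ≤ S := Algebra.adjoin_le (by simpa using hxS)
      have htop : IntermediateField.adjoin K {x} = ⊤ := by
        rcases hK (IntermediateField.adjoin K {x}) with h | h
        · exact absurd (h ▸ IntermediateField.mem_adjoin_simple_self K x) hxb
        · exact h
      have hS : ∀ y : E, y ∈ S := fun y => by
        have hy : y ∈ (IntermediateField.adjoin K {x}).toSubalgebra := by
          rw [htop]; trivial
        rw [IntermediateField.adjoin_simple_toSubalgebra_of_isAlgebraic
          (Algebra.IsAlgebraic.isAlgebraic x)] at hy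
        exact hadj hy
      rw [eq_top_iff]
      refine le_trans ?_ hBA
      obtain ⟨b, hb, hb0⟩ := Submodule.exists_mem_ne_zero_of_ne_bot hB
      intro y _
      simpa [mul_inv_cancel_left₀ hb0] using hS (b⁻¹ * y) b hb
  · push Not at hst
    obtain ⟨b, hb, x, hx, hbx⟩ := hst
    have hb0 : b ≠ 0 := by rintro rfl; simp at hbx
    let μ : E →ₗ[K] E := LinearMap.mulLeft K b
    have hμ : Function.Injective μ := fun y z h => mul_left_cancel₀ hb0 h
    let A' := A ⊓ B.comap μ
    let B' := B ⊔ A.map μ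
    have hA' : (1 : E) ∈ A' := ⟨hA, by simpa [μ] using hb⟩
    have hlt : A' < A := lt_of_le_of_ne inf_le_left fun h => hbx <| by
      have : x ∈ A' := h ▸ hx
      exact this.2
    have hB' : B' ≠ ⊥ := fun h => hB (le_bot_iff.1 (h ▸ le_sup_left))
    have hmap : A'.map μ = B ⊓ A.map μ := by
      ext y
      simp only [A', Submodule.mem_map, Submodule.mem_inf, Submodule.mem_comap]
      constructor
      · rintro ⟨z, ⟨h1, h2⟩, rfl⟩; exact ⟨h2, z, h1, rfl⟩
      · rintro ⟨h1, z, h2, rfl⟩; exact ⟨z, ⟨h2, h1⟩, rfl⟩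
    have e1 := Submodule.finrank_sup_add_finrank_inf_eq B (A.map μ)
    have e2 : finrank K (A.map μ) = finrank K A := (Submodule.equivMapOfInjective μ hμ A).finrank_eq.symm
    have e3 : finrank K (A'.map μ) = finrank K A' := (Submodule.equivMapOfInjective μ hμ A').finrank_eq.symm
    have hle : A' * B' ≤ A * B := by
      rw [Submodule.mul_sup, sup_le_iff]
      refine ⟨mul_le_mul' inf_le_left le_rfl, ?_⟩
      rw [Submodule.mul_le]
      rintro y ⟨_, hy⟩ _ ⟨z, hz, rfl⟩
      have : y * μ z = z * μ y := by simp [μ]; ring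
      rw [this]
      exact Submodule.mul_mem_mul hz hy
    rw [← hmap, e3, e2] at e1
    rcases ih _ (Submodule.finrank_lt_finrank_of_lt hlt) A' B' hA' hB' rfl with h | h
    · left; exact top_le_iff.1 (h ▸ hle)
    · right
      have := Submodule.finrank_mono hle
      change finrank K B' + finrank K A' = _ at e1
      omega
end QuadricBound

namespace QuadricBound

open Module Polynomial

theorem finite_span_submodule {F E Ω : Type*} [Field F] [Field E] [Field Ω]
    [Algebra F E] [Algebra F Ω] [Algebra E Ω] [IsScalarTower F E Ω]
    (C : Submodule F Ω) [FiniteDimensional F C] :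
    FiniteDimensional E (Submodule.span E (C : Set Ω)) := by
  obtain ⟨s, hs⟩ := (Submodule.fg_iff_finiteDimensional C).2 inferInstance
  rw [← hs, Submodule.span_span_of_tower]
  infer_instance

theorem finrank_span_submodule_le {F E Ω : Type*} [Field F] [Field E] [Field Ω]
    [Algebra F E] [Algebra F Ω] [Algebra E Ω] [IsScalarTower F E Ω]
    (C : Submodule F Ω) [FiniteDimensional F C] :
    finrank E (Submodule.span E (C : Set Ω)) ≤ finrank F C := by
  let b := finBasis F C
  have h : (C : Set Ω) ⊆ Submodule.span E (Set.range fun i => (b i : Ω)) := by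
    intro c hc
    have : c = ∑ i, b.repr ⟨c, hc⟩ i • (b i : Ω) := by
      have := congrArg Subtype.val (b.sum_repr ⟨c, hc⟩)
      simp only [Submodule.coe_sum, Submodule.coe_smul] at this
      exact this.symm
    rw [this]
    refine Submodule.sum_mem _ fun i _ => ?_
    rw [← algebraMap_smul E (b.repr ⟨c, hc⟩ i)]
    exact Submodule.smul_mem _ _ (Submodule.subset_span ⟨i, rfl⟩)
  have : FiniteDimensional E (Submodule.span E (Set.range fun i => (b i : Ω))) :=
    FiniteDimensional.span_of_finite E (Set.finite_range _)
  refine (Submodule.finrank_mono (Submodule.span_le.2 h)).trans ?_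
  exact (finrank_range_le_card _).trans (by simp)

/-- Passing from `F` to a field containing a transcendental element of `W` drops the dimension
of `W * W` by at least `dim W`. -/
theorem finrank_span_mul_self_add_le {F E Ω : Type*} [Field F] [Field E] [Field Ω]
    [Algebra F E] [Algebra F Ω] [Algebra E Ω] [IsScalarTower F E Ω]
    (W : Submodule F Ω) [FiniteDimensional F W] (h1 : (1 : Ω) ∈ W) (x : E)
    (hx : algebraMap E Ω x ∈ W) (hxt : Transcendental F x) :
    finrank E (Submodule.span E ((W * W : Submodule F Ω) : Set Ω)) + finrank F W ≤
      finrank F ↥(W * W) := by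
  set y := algebraMap E Ω x with hy
  have hy0 : y ≠ 0 := fun h => hxt <| by
    rw [(map_eq_zero (algebraMap E Ω)).1 h]; exact isAlgebraic_zero
  have hfd : FiniteDimensional F ↥(W * W) :=
    (Submodule.fg_iff_finiteDimensional _).1 (Submodule.FG.mul
      ((Submodule.fg_iff_finiteDimensional W).2 inferInstance)
      ((Submodule.fg_iff_finiteDimensional W).2 inferInstance))
  let μ : Ω →ₗ[F] Ω := LinearMap.mulLeft F y
  have hμ : Function.Injective μ := fun y z h => mul_left_cancel₀ hy0 h
  have hWW : W ≤ W * W := fun w hw => by simpa using Submodule.mul_mem_mul h1 hw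
  have hyW : W.map μ ≤ W * W := by
    rintro _ ⟨w, hw, rfl⟩
    exact Submodule.mul_mem_mul hx hw
  obtain ⟨D, hD⟩ := Submodule.exists_isCompl (W.map μ)
  set C := D ⊓ (W * W) with hC
  have hCW : C ⊔ W.map μ = W * W := by
    rw [hC, inf_comm, inf_sup_assoc_of_le D hyW, sup_comm D, hD.sup_eq_top, inf_top_eq]
  have hCi : C ⊓ W.map μ = ⊥ := by
    rw [hC, inf_right_comm, inf_comm D, hD.inf_eq_bot, bot_inf_eq]
  have hCfd : FiniteDimensional F C :=
    Submodule.finiteDimensional_of_le (inf_le_right : C ≤ W * W)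
  have hdim := Submodule.finrank_sup_add_finrank_inf_eq C (W.map μ)
  rw [hCW, hCi, finrank_bot, add_zero, (Submodule.equivMapOfInjective μ hμ W).finrank_eq.symm]
    at hdim
  rw [hdim]
  gcongr
  refine le_trans ?_ (finrank_span_submodule_le (E := E) C)
  have := finite_span_submodule (E := E) C
  refine Submodule.finrank_mono (Submodule.span_le.2 ?_)
  set S := Submodule.span E (C : Set Ω) with hS
  have hdec : ∀ w : W, ∃ v : W, (w : Ω) - y * v ∈ C := by
    intro w
    have : (w : Ω) ∈ C ⊔ W.map μ := hCW ▸ hWW w.2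
    obtain ⟨c, hc, _, ⟨v, hv, rfl⟩, h⟩ := Submodule.mem_sup.1 this
    refine ⟨⟨v, hv⟩, ?_⟩
    rw [← h]; simpa [μ] using hc
  have huniq : ∀ v : W, y * (v : Ω) ∈ C → v = 0 := by
    intro v hv
    have : y * (v : Ω) ∈ C ⊓ W.map μ := ⟨hv, v, v.2, rfl⟩
    rw [hCi, Submodule.mem_bot] at this
    exact Subtype.ext ((mul_eq_zero.1 this).resolve_left hy0)
  choose ν hν using hdec
  let νl : W →ₗ[F] W :=
    { toFun := ν
      map_add' := fun a b => by
        rw [← sub_eq_zero]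
        apply huniq
        have := sub_mem (add_mem (hν a) (hν b)) (hν (a + b))
        convert this using 1
        push_cast; ring
      map_smul' := fun r a => by
        rw [← sub_eq_zero]
        apply huniq
        have := sub_mem (C.smul_mem r (hν a)) (hν (r • a))
        convert this using 1
        simp [Algebra.smul_def]; ring }
  have hX : ∀ w : W, (νl w : Ω) - algebraMap E Ω x⁻¹ * w ∈ S := by
    intro w
    have := S.smul_mem (-x⁻¹) (Submodule.subset_span (hν w))
    convert this using 1
    rw [Algebra.smul_def, map_neg, map_inv₀, ← hy]
    change (ν w : Ω) - _ = _
    field_simp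
    ring
  have hpow : ∀ (i : ℕ) (w : W), ((νl ^ i) w : Ω) - algebraMap E Ω (x⁻¹ ^ i) * w ∈ S := by
    intro i
    induction i with
    | zero => intro w; simp
    | succ i ih =>
      intro w
      have := add_mem (ih (νl w)) (S.smul_mem (x⁻¹ ^ i) (hX w))
      convert this using 1
      rw [pow_succ, Module.End.mul_apply, Algebra.smul_def, pow_succ, map_mul]
      ring
  have hpoly : ∀ (q : F[X]) (w : W),
      (aeval νl q w : Ω) - algebraMap E Ω (aeval x⁻¹ q) * w ∈ S := by
    intro q
    induction q using Polynomial.induction_on' with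
    | add p q hp hq =>
      intro w
      have := add_mem (hp w) (hq w)
      convert this using 1
      simp; ring
    | monomial i r =>
      intro w
      have := S.smul_mem (algebraMap F E r) (hpow i w)
      convert this using 1
      simp only [Polynomial.aeval_monomial, Module.End.mul_apply, Module.algebraMap_end_apply,
        Submodule.coe_smul, Algebra.smul_def, map_mul, ← IsScalarTower.algebraMap_apply]
      ring
  have hWS : (W : Set Ω) ⊆ S := by
    intro w hw
    have h := hpoly νl.charpoly ⟨w, hw⟩
    rw [LinearMap.aeval_self_charpoly] at h
    have hne : aeval x⁻¹ νl.charpoly ≠ 0 := by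
      have hxi : Transcendental F x⁻¹ := fun h => hxt (by simpa using h.inv)
      exact fun h0 => hxi ⟨_, νl.charpoly_monic.ne_zero, h0⟩
    have := S.smul_mem (-(aeval x⁻¹ νl.charpoly)⁻¹) h
    rw [Algebra.smul_def, map_neg, map_inv₀] at this
    have hne' : algebraMap E Ω (aeval x⁻¹ νl.charpoly) ≠ 0 := by simpa using hne
    convert this using 1
    rw [LinearMap.zero_apply, Submodule.coe_zero, zero_sub, neg_mul_neg,
      inv_mul_cancel_left₀ hne']
    exact Iff.rfl
  rw [← hCW]
  intro z hz
  obtain ⟨c, hc, _, ⟨w, hw, rfl⟩, rfl⟩ := Submodule.mem_sup.1 hz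
  refine add_mem (Submodule.subset_span hc) ?_
  have := S.smul_mem x (hWS hw)
  rwa [Algebra.smul_def] at this
end QuadricBound

namespace QuadricBound
open Set

section acl
variable (F : Type*) {Ω : Type*} [Field F] [Field Ω] [Algebra F Ω]

/-- The relative algebraic closure in `Ω` of the field generated by `s`. -/
def acl (s : Set Ω) : IntermediateField F Ω :=
  (algebraicClosure (IntermediateField.adjoin F s) Ω).restrictScalars F

variable {F}

theorem mem_acl {s : Set Ω} {x : Ω} : x ∈ acl F s ↔ IsAlgebraic (IntermediateField.adjoin F s) x :=
  mem_algebraicClosure_iff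

theorem coe_acl (s : Set Ω) :
    (acl F s : Set Ω) = (AlgebraicIndependent.matroid F Ω).closure s := by
  rw [AlgebraicIndependent.matroid_closure_eq]
  ext x
  have h := IntermediateField.transcendental_adjoin_iff (F := F) (s := s) (x := x)
  simp only [Transcendental, not_iff_not] at h
  exact mem_acl.trans h

theorem adjoin_le_acl (s : Set Ω) : IntermediateField.adjoin F s ≤ acl F s := fun x hx =>
  mem_acl.2 <| isAlgebraic_algebraMap (⟨x, hx⟩ : IntermediateField.adjoin F s)

theorem subset_acl (s : Set Ω) : s ⊆ acl F s :=
  (IntermediateField.subset_adjoin F s).trans (adjoin_le_acl s)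

theorem acl_le {s t : Set Ω} (h : s ⊆ acl F t) : acl F s ≤ acl F t := by
  rw [← SetLike.coe_subset_coe, coe_acl, coe_acl]
  rw [coe_acl] at h
  exact Matroid.closure_subset_closure_of_subset_closure h

theorem acl_mono {s t : Set Ω} (h : s ⊆ t) : acl F s ≤ acl F t :=
  acl_le (h.trans (subset_acl t))

theorem mem_acl_of_isAlgebraic {s : Set Ω} {x : Ω} (E : IntermediateField F Ω) (hE : E ≤ acl F s)
    (hx : IsAlgebraic E x) : x ∈ acl F s := by
  have h1 : x ∈ acl F (E : Set Ω) := by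
    rw [mem_acl, IntermediateField.adjoin_self]; exact hx
  exact acl_le hE h1

theorem encard_le_of_algebraicIndependent {α β : Type*} [Finite α] [Finite β] {x : α → Ω}
    {y : β → Ω}
    (hx : AlgebraicIndependent F x) (h : range x ⊆ acl F (range y)) : Nat.card α ≤ Nat.card β := by
  have h1 : (AlgebraicIndependent.matroid F Ω).Indep (range x) := hx.coe_range
  rw [coe_acl] at h
  have h2 := h1.encard_le_eRk_of_subset h
  rw [Matroid.eRk_closure_eq] at h2
  have h3 := h2.trans (Matroid.eRk_le_encard _ _)
  rw [← image_univ, hx.injective.encard_image, ← image_univ] at h3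
  have h4 := h3.trans (encard_image_le _ _)
  simpa [encard_univ, ENat.card_eq_coe_natCard] using h4

theorem algebraicIndependent_of_card_le {α β : Type*} [Finite α] [Finite β] {x : α → Ω} {y : β → Ω}
    (hx : AlgebraicIndependent F x) (h : range x ⊆ acl F (range y))
    (hc : Nat.card β ≤ Nat.card α) : AlgebraicIndependent F y := by
  have h1 : (AlgebraicIndependent.matroid F Ω).Indep (range x) := hx.coe_range
  rw [coe_acl] at h
  have h2 := h1.encard_le_eRk_of_subset h
  rw [Matroid.eRk_closure_eq] at h2
  have h5 : (range x).encard = Nat.card α := by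
    rw [← image_univ, hx.injective.encard_image, encard_univ, ENat.card_eq_coe_natCard]
  have h6 : (range y).encard ≤ Nat.card β := by
    rw [← image_univ]
    exact (encard_image_le _ _).trans (by rw [encard_univ, ENat.card_eq_coe_natCard])
  have h7 : (Nat.card β : ℕ∞) ≤ (Nat.card α : ℕ∞) := by exact_mod_cast hc
  rw [h5] at h2
  have h8 : (range y).encard ≤ (AlgebraicIndependent.matroid F Ω).eRk (range y) :=
    h6.trans (h7.trans h2)
  have h9 : (AlgebraicIndependent.matroid F Ω).Indep (range y) := by
    rw [Matroid.indep_iff_eRk_eq_encard_of_finite (finite_range y)]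
    exact le_antisymm (Matroid.eRk_le_encard _ _) h8
  have hinj : Function.Injective y := by
    have h10 : Nat.card β ≤ (range y).ncard := by
      have : (Nat.card β : ℕ∞) ≤ (range y).encard :=
        h7.trans (h2.trans (Matroid.eRk_le_encard _ _))
      rw [← (finite_range y).cast_ncard_eq] at this
      exact_mod_cast this
    rw [← Set.injOn_univ]
    apply Set.injOn_of_ncard_image_eq _ (finite_univ)
    rw [image_univ]
    refine le_antisymm ?_ (by rwa [ncard_univ])
    rw [← image_univ]
    exact ncard_image_le finite_univ
  exact (algebraicIndependent_subtype_range hinj).1 h9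

theorem notMem_acl_range {ι : Type*} {x : ι → Ω} (hx : AlgebraicIndependent F x) (a : Ω) :
    a ∉ acl F (range x) ↔ AlgebraicIndependent F (fun o : Option ι => o.elim a x) := by
  rw [hx.option_iff_transcendental, ← IntermediateField.transcendental_adjoin_iff, mem_acl]
  rfl

theorem exists_algebraicIndependent_comp {ι : Type*} [Finite ι] (w : ι → Ω) :
    ∃ s : Set ι, AlgebraicIndependent F (fun i : s => w i) ∧
      range w ⊆ acl F (range fun i : s => w i) := by
  obtain ⟨B, hB⟩ := (AlgebraicIndependent.matroid F Ω).exists_isBasis (range w)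
  obtain ⟨s, hsB, hinj⟩ : ∃ s, w '' s = B ∧ InjOn w s := by
    have h : SurjOn w (w ⁻¹' B) B := fun b hb => by
      obtain ⟨i, rfl⟩ := hB.subset hb
      exact ⟨i, hb, rfl⟩
    obtain ⟨s, -, hs⟩ := surjOn_iff_exists_bijOn_subset.1 h
    exact ⟨s, hs.image_eq, hs.injOn⟩
  refine ⟨s, ?_, ?_⟩
  · have h1 : AlgebraicIndependent F ((↑) : B → Ω) := hB.indep
    have hi : Function.Injective fun i : s => w i := injOn_iff_injective.1 hinj
    rw [← algebraicIndependent_subtype_range hi]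
    have : (range fun i : s => w i) = B := by rw [← hsB]; exact range_domRestrict w s
    rw [this]; exact h1
  · have : range (fun i : s => w i) = B := by rw [← hsB]; exact range_domRestrict w s
    rw [this, coe_acl, hB.closure_eq_closure]
    exact Matroid.subset_closure _ _ (by rw [AlgebraicIndependent.matroid_e]; exact subset_univ _)

end acl
end QuadricBound

namespace QuadricBound
open MvPolynomial Set

section LD
variable {F L Ω : Type*} [Field F] [Field L] [Field Ω] [Algebra F L] [Algebra L Ω] [Algebra F Ω]
  [IsScalarTower F L Ω]

theorem linearIndependent_algebraAdjoin {ι κ : Type*} {v : ι → L} (hv : LinearIndependent F v)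
    {a : κ → Ω} (ha : AlgebraicIndependent L a) :
    LinearIndependent (Algebra.adjoin F (range a)) (fun i => algebraMap L Ω (v i)) := by
  rw [linearIndependent_iff']
  intro s g hg i hi
  have h1 : ∀ j, ∃ p : MvPolynomial κ F, aeval a p = (g j : Ω) := fun j => by
    have h := SetLike.le_def.1 (Algebra.adjoin_range_eq_range_aeval F a).le (g j).2
    exact h
  choose p hp using h1
  have h2 : aeval a (∑ j ∈ s, C (v j) * map (algebraMap F L) (p j)) = 0 := by
    rw [← hg, map_sum]
    refine Finset.sum_congr rfl fun j _ => ?_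
    rw [map_mul, aeval_C, aeval_map_algebraMap, hp, Algebra.smul_def, mul_comm]
    rfl
  rw [← map_zero (aeval (R := L) a)] at h2
  have h3 := ha h2
  have h4 : ∀ m, coeff m (p i) = 0 := fun m => by
    have := congrArg (coeff m) h3
    simp only [coeff_sum, coeff_C_mul, coeff_map, coeff_zero] at this
    refine linearIndependent_iff'.1 hv s (fun j => coeff m (p j)) ?_ i hi
    rw [← this]
    exact Finset.sum_congr rfl fun j _ => by rw [Algebra.smul_def, mul_comm]
  have h5 : p i = 0 := by ext m; simp [h4 m]
  apply Subtype.ext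
  rw [← hp i, h5]; simp

open scoped IntermediateField.algebraAdjoinAdjoin in
/-- Linearly independent elements stay independent after adjoining independent
transcendentals to the base field. -/
theorem linearIndependent_adjoin {ι κ : Type*} {v : ι → L} (hv : LinearIndependent F v)
    {a : κ → Ω} (ha : AlgebraicIndependent L a) :
    LinearIndependent (IntermediateField.adjoin F (range a)) (fun i => algebraMap L Ω (v i)) :=
  (LinearIndependent.iff_fractionRing (Algebra.adjoin F (range a))
    (IntermediateField.adjoin F (range a))).1 (linearIndependent_algebraAdjoin hv ha)

end LD

section HasTr
variable (F : Type*) {Ω : Type*} [Field F] [Field Ω] [Algebra F Ω]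

/-- The family `w` generates a field of transcendence degree `n` over `F`. -/
def HasTr {ι : Type*} (w : ι → Ω) (n : ℕ) : Prop :=
  ∃ b : Fin n → ι, AlgebraicIndependent F (w ∘ b) ∧ range w ⊆ acl F (range (w ∘ b))

end HasTr
end QuadricBound

namespace QuadricBound
open MvPolynomial Set

section integralRelation
variable {K Ω : Type*} [Field K] [Field Ω] [Algebra K Ω]

/-- `x` is congruent to `γ v ^ d` modulo `Z * U ^ (d - 1)` (modulo `0` if `d = 0`). -/
def LeadsTo (Z U : Submodule K Ω) (v : Ω) (d : ℕ) (γ : K) (x : Ω) : Prop :=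
  ∃ s ∈ (if d = 0 then (⊥ : Submodule K Ω) else Z * U ^ (d - 1)), x = s + γ • v ^ d

variable {Z U : Submodule K Ω} {v : Ω}

theorem LeadsTo.one : LeadsTo Z U v 0 1 1 := ⟨0, by simp, by simp⟩

theorem ideal_le_pow (hZU : Z ≤ U) (d : ℕ) :
    (if d = 0 then (⊥ : Submodule K Ω) else Z * U ^ (d - 1)) ≤ U ^ d := by
  rcases d with _ | d
  · simp
  · simp only [Nat.add_eq_zero_iff, one_ne_zero, and_false, if_false, Nat.add_sub_cancel, pow_succ']
    exact mul_le_mul' hZU le_rfl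

theorem ideal_mul_pow_le (d d' : ℕ) :
    (if d = 0 then (⊥ : Submodule K Ω) else Z * U ^ (d - 1)) * U ^ d' ≤
      (if d + d' = 0 then (⊥ : Submodule K Ω) else Z * U ^ (d + d' - 1)) := by
  rcases d with _ | d
  · simp
  · have : d + 1 + d' - 1 = d + d' := by omega
    simp [mul_assoc, ← pow_add, this]

theorem LeadsTo.mul (hZU : Z ≤ U) (hv : v ∈ U) {d d' : ℕ} {γ γ' : K} {x x' : Ω}
    (h : LeadsTo Z U v d γ x) (h' : LeadsTo Z U v d' γ' x') :
    LeadsTo Z U v (d + d') (γ * γ') (x * x') := by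
  obtain ⟨s, hs, rfl⟩ := h
  obtain ⟨s', hs', rfl⟩ := h'
  refine ⟨s * (s' + γ' • v ^ d') + s' * (γ • v ^ d), add_mem ?_ ?_, ?_⟩
  · refine ideal_mul_pow_le d d' (Submodule.mul_mem_mul hs (add_mem (ideal_le_pow hZU _ hs') ?_))
    exact Submodule.smul_mem _ _ (Submodule.pow_mem_pow _ hv _)
  · rw [add_comm d]
    exact ideal_mul_pow_le d' d (Submodule.mul_mem_mul hs'
      (Submodule.smul_mem _ _ (Submodule.pow_mem_pow _ hv _)))
  · simp only [Algebra.smul_def, map_mul]; ring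

theorem LeadsTo.pow (hZU : Z ≤ U) (hv : v ∈ U) {d : ℕ} {γ : K} {x : Ω}
    (h : LeadsTo Z U v d γ x) (m : ℕ) : LeadsTo Z U v (m * d) (γ ^ m) (x ^ m) := by
  induction m with
  | zero => simpa using LeadsTo.one
  | succ m ih => rw [pow_succ, pow_succ, add_mul, one_mul]; exact ih.mul hZU hv h

theorem LeadsTo.prod (hZU : Z ≤ U) (hv : v ∈ U) {ι : Type*} (s : Finset ι) {d : ι → ℕ} {γ : ι → K}
    {x : ι → Ω} (h : ∀ i, LeadsTo Z U v (d i) (γ i) (x i)) :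
    LeadsTo Z U v (∑ i ∈ s, d i) (∏ i ∈ s, γ i) (∏ i ∈ s, x i) := by
  classical
  induction s using Finset.induction_on with
  | empty => simpa using LeadsTo.one
  | insert a s ha ih =>
    rw [Finset.sum_insert ha, Finset.prod_insert ha, Finset.prod_insert ha]
    exact (h a).mul hZU hv ih

/-- An element `v` algebraically dependent on `τ` satisfies an equation that is integral over
the generic linear combinations `τ j - c j * v`, homogeneous with respect to the filtration. -/
theorem exists_pow_mem_mul_pow {A : Type*} [CommRing A] [Algebra A Ω] {n : ℕ} (τ : Fin n → Ω)
    (c : Fin n → K) (v : Ω) (hna : ¬ AlgebraicIndependent A (fun o : Option (Fin n) => o.elim v τ))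
    (hc : AlgebraicIndependent A fun j => algebraMap K Ω (c j))
    (hA : ∀ x : A, ∃ y : K, algebraMap K Ω y = algebraMap A Ω x) :
    ∃ D : ℕ, v ^ (D + 1) ∈
      Submodule.span K (insert 1 (range fun j => τ j - c j • v)) *
      (Submodule.span K (insert 1 (range fun j => τ j - c j • v)) ⊔ Submodule.span K {v}) ^ D := by
  set Z := Submodule.span K (insert 1 (range fun j => τ j - c j • v)) with hZ
  set U := Z ⊔ Submodule.span K {v} with hU
  have hZU : Z ≤ U := le_sup_left
  have hv : v ∈ U := (le_sup_right : _ ≤ U) (Submodule.mem_span_singleton_self v)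
  have h1Z : (1 : Ω) ∈ Z := Submodule.subset_span (mem_insert _ _)
  choose l hl using hA
  rw [algebraicIndependent_iff] at hna
  push Not at hna
  obtain ⟨P, hP, hP0⟩ := hna
  set D := P.totalDegree with hD
  have hlead : ∀ m : Option (Fin n) →₀ ℕ, LeadsTo Z U v (∑ o, m o)
      (∏ o : Option (Fin n), (o.elim 1 c) ^ m o) (∏ o : Option (Fin n), (o.elim v τ) ^ m o) := by
    intro m
    refine LeadsTo.prod hZU hv _ fun o => ?_
    have : LeadsTo Z U v 1 (o.elim 1 c) (o.elim v τ) := by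
      rcases o with _ | j
      · exact ⟨0, by simp, by simp⟩
      · exact ⟨τ j - c j • v, by
          simpa using Submodule.subset_span (mem_insert_of_mem _ (mem_range_self j)), by simp⟩
    simpa using this.pow hZU hv (m o)
  have hmono : ∀ m : Option (Fin n) →₀ ℕ, (m.sum fun _ e => e) = ∑ o, m o := fun m =>
    Finsupp.sum_fintype _ _ fun _ => rfl
  have hDpos : D ≠ 0 := by
    intro h0
    rw [hD, totalDegree_eq_zero_iff_eq_C] at h0
    rw [h0, aeval_C] at hP
    have : coeff 0 P = 0 := hc.algebraMap_injective (by rw [hP, map_zero])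
    rw [this, C_0] at h0
    exact hP0 h0
  obtain ⟨D', hD'⟩ := Nat.exists_eq_succ_of_ne_zero hDpos
  refine ⟨D', ?_⟩
  set G := ∑ m ∈ P.support with ∑ o, m o = D,
    l (coeff m P) * ∏ o : Option (Fin n), (o.elim 1 c) ^ m o with hG
  have hG0 : G ≠ 0 := by
    obtain ⟨m0, hm0, hm0D⟩ := P.support.exists_mem_eq_sup (by simpa using hP0)
      (fun m => m.sum fun _ e => e)
    rw [hmono] at hm0D
    change P.totalDegree = _ at hm0D
    intro h0
    have h1 : aeval (fun j => algebraMap K Ω (c j))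
        (∑ m ∈ P.support with ∑ o, m o = D, monomial m.some (coeff m P)) = 0 := by
      rw [← map_zero (algebraMap K Ω), ← h0, hG, map_sum, map_sum]
      refine Finset.sum_congr rfl fun m _ => ?_
      rw [aeval_monomial, map_mul, hl, map_prod, Fintype.prod_option, Finsupp.prod_fintype _ _
        (by simp)]
      simp
    have h2 := hc (h1.trans (map_zero _).symm)
    have h3 := congrArg (coeff m0.some) h2
    rw [coeff_sum, Finset.sum_eq_single m0] at h3
    · simp only [coeff_monomial, if_true, coeff_zero] at h3
      exact (mem_support_iff.1 hm0) h3
    · intro m hm hne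
      rw [coeff_monomial, if_neg]
      intro hs
      apply hne
      have h4 : ∀ j, m (some j) = m0 (some j) := fun j => by
        simpa using DFunLike.congr_fun hs j
      have h5 := (Finset.mem_filter.1 hm).2
      rw [hD, hm0D, Fintype.sum_option, Fintype.sum_option, Finset.sum_congr rfl
        fun j _ => h4 j] at h5
      ext o
      rcases o with _ | j
      · omega
      · exact h4 j
    · intro hm
      exact absurd (Finset.mem_filter.2 ⟨hm0, hm0D.symm⟩) hm
  have hU1 : (1 : Submodule K Ω) ≤ U := by
    rw [Submodule.one_le]; exact hZU h1Z
  have key : ∀ m ∈ P.support, algebraMap A Ω (coeff m P) * ∏ o : Option (Fin n), (o.elim v τ) ^ m o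
      - (if ∑ o, m o = D then (l (coeff m P) * ∏ o : Option (Fin n), (o.elim 1 c) ^ m o) else 0) •
        v ^ D ∈ Z * U ^ D' := by
    intro m hm
    have hle : ∑ o, m o ≤ D := by rw [← hmono]; exact le_totalDegree hm
    obtain ⟨s, hs, hx⟩ := hlead m
    rw [← hl, ← Algebra.smul_def]
    split_ifs with hmD
    · rw [hmD, if_neg hDpos, hD', Nat.succ_sub_one] at hs
      rw [hx, hmD, mul_smul, smul_add, add_sub_cancel_right]
      exact Submodule.smul_mem _ _ hs
    · rw [zero_smul, sub_zero]
      refine Submodule.smul_mem _ _ ?_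
      have h6 : ∏ o : Option (Fin n), (o.elim v τ) ^ m o ∈ U ^ (∑ o, m o) := by
        rw [hx]
        exact add_mem (ideal_le_pow hZU _ hs) (Submodule.smul_mem _ _ (Submodule.pow_mem_pow _ hv _))
      have h7 : U ^ (∑ o, m o) ≤ U ^ D' := pow_le_pow_right' hU1 (by omega)
      rw [← one_mul (∏ o, _)]
      exact Submodule.mul_mem_mul h1Z (h7 h6)
  have hsum := Submodule.sum_mem _ key
  rw [Finset.sum_sub_distrib, ← Finset.sum_smul, ← Finset.sum_filter, ← hG] at hsum
  have hP' : ∑ m ∈ P.support, algebraMap A Ω (coeff m P) *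
      ∏ o : Option (Fin n), (o.elim v τ) ^ m o = 0 := by
    rw [← hP, aeval_def, eval₂_eq']
  rw [hP', zero_sub, Submodule.neg_mem_iff] at hsum
  rw [hD'] at hsum
  exact (Submodule.smul_mem_iff _ hG0).1 hsum

end integralRelation
end QuadricBound

namespace QuadricBound
open MvPolynomial Set

section generic
variable {K Ω : Type*} [Field K] [Field Ω] [Algebra K Ω]

theorem isAlgebraic_of_pow_mem {Z : Submodule K Ω} (E : IntermediateField K Ω)
    (hZ : (Z : Set Ω) ⊆ E) {v : Ω} {D : ℕ}
    (h : v ^ (D + 1) ∈ Z * (Z ⊔ Submodule.span K {v}) ^ D) : IsAlgebraic E v := by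
  set T : ℕ → Submodule K Ω := fun d =>
    ((Polynomial.degreeLE E d).map (Polynomial.aeval v).toLinearMap).restrictScalars K with hT
  have hmem : ∀ d x, x ∈ T d ↔ ∃ p : Polynomial E, p.natDegree ≤ d ∧ Polynomial.aeval v p = x := by
    intro d x
    simp only [hT, Submodule.restrictScalars_mem, Submodule.mem_map, Polynomial.mem_degreeLE,
      ← Polynomial.natDegree_le_iff_degree_le]
    rfl
  have hmul : ∀ d d', T d * T d' ≤ T (d + d') := by
    intro d d'
    rw [Submodule.mul_le]
    intro x hx y hy
    obtain ⟨p, hp, rfl⟩ := (hmem _ _).1 hx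
    obtain ⟨q, hq, rfl⟩ := (hmem _ _).1 hy
    exact (hmem _ _).2 ⟨p * q, Polynomial.natDegree_mul_le_of_le hp hq, map_mul _ _ _⟩
  have hZ0 : ∀ d, Z ≤ T d := fun d z hz =>
    (hmem _ _).2 ⟨Polynomial.C ⟨z, hZ hz⟩, by simp, by simp⟩
  have hv1 : Submodule.span K {v} ≤ T 1 := by
    rw [Submodule.span_singleton_le_iff_mem]
    exact (hmem _ _).2 ⟨Polynomial.X, Polynomial.natDegree_X_le, by simp⟩
  have hU : ∀ d, (Z ⊔ Submodule.span K {v}) ^ d ≤ T d := by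
    intro d
    induction d with
    | zero =>
      rw [pow_zero, Submodule.one_le]
      exact (hmem _ _).2 ⟨1, by simp, by simp⟩
    | succ d ih =>
      rw [pow_succ]
      exact (mul_le_mul' ih (sup_le (hZ0 1) hv1)).trans (hmul _ _)
  have h2 := (mul_le_mul' (hZ0 0) (hU D)).trans (hmul _ _) h
  obtain ⟨p, hp, hpv⟩ := (hmem _ _).1 h2
  rw [zero_add] at hp
  refine ⟨Polynomial.X ^ (D + 1) - p, ?_, by simp [hpv]⟩
  intro h0
  have := congrArg (fun q => Polynomial.coeff q (D + 1)) h0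
  simp only [Polynomial.coeff_sub, Polynomial.coeff_X_pow, if_true, Polynomial.coeff_zero] at this
  rw [Polynomial.coeff_eq_zero_of_natDegree_lt (by omega)] at this
  simp at this

end generic

section map
variable {F F' L Ω : Type*} [Field F] [Field F'] [Field L] [Field Ω] [Algebra F L] [Algebra F' Ω]

theorem map_mem_acl (g : L →+* Ω) {s : Set L} {s' : Set Ω}
    (h : ∀ c : F, g (algebraMap F L c) ∈ IntermediateField.adjoin F' s')
    (hs : ∀ x ∈ s, g x ∈ IntermediateField.adjoin F' s') {x : L} (hx : x ∈ acl F s) :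
    g x ∈ acl F' s' := by
  have hg : ∀ y ∈ IntermediateField.adjoin F s, g y ∈ IntermediateField.adjoin F' s' := by
    intro y hy
    induction hy using IntermediateField.adjoin_induction with
    | mem x hx => exact hs x hx
    | algebraMap c => exact h c
    | add x y _ _ hx hy => rw [map_add]; exact add_mem hx hy
    | inv x _ hx => rw [map_inv₀]; exact inv_mem hx
    | mul x y _ _ hx hy => rw [map_mul]; exact mul_mem hx hy
  rw [mem_acl] at hx ⊢
  let f : IntermediateField.adjoin F s →+* IntermediateField.adjoin F' s' :=
    (g.comp (algebraMap (IntermediateField.adjoin F s) L)).codRestrict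
      (IntermediateField.adjoin F' s') fun y => hg _ y.2
  exact hx.ringHom_of_comp_eq f g f.injective (by ext y; rfl)

end map

section genLin
variable {R S : Type*} [CommRing R] [CommRing S] {n N : ℕ}

/-- The `j`-th generic linear combination of the coordinates `w`. -/
def genLin (a : Fin n × Fin N → R) (w : Fin (N + 1) → R) (j : Fin n) : R :=
  -∑ i, a (j, i) * w i.succ

/-- All coefficients of the `n` generic linear forms which vanish at `w`. -/
def genCoeff (a : Fin n × Fin N → R) (w : Fin (N + 1) → R) (p : Fin n × Fin (N + 1)) : R :=
  Fin.cases (genLin a w p.1) (fun i => a (p.1, i)) p.2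

theorem range_genCoeff (a : Fin n × Fin N → R) (w : Fin (N + 1) → R) :
    range (genCoeff a w) = range a ∪ range (genLin a w) := by
  ext x
  constructor
  · rintro ⟨⟨j, i⟩, rfl⟩
    refine Fin.cases ?_ (fun i => ?_) i
    · exact Or.inr ⟨j, rfl⟩
    · exact Or.inl ⟨(j, i), rfl⟩
  · rintro (⟨⟨j, i⟩, rfl⟩ | ⟨j, rfl⟩)
    · exact ⟨(j, i.succ), rfl⟩
    · exact ⟨(j, 0), rfl⟩

theorem map_genCoeff (f : R →+* S) (a : Fin n × Fin N → R) (w : Fin (N + 1) → R)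
    (p : Fin n × Fin (N + 1)) : f (genCoeff a w p) = genCoeff (f ∘ a) (f ∘ w) p := by
  obtain ⟨j, i⟩ := p
  refine Fin.cases ?_ (fun i => rfl) i
  simp [genCoeff, genLin]

end genLin

section projection
variable {M L Ω : Type*} [Field M] [Field L] [Field Ω] [Algebra M L] [Algebra L Ω] [Algebra M Ω]
  [IsScalarTower M L Ω] {n N : ℕ}

theorem HasTr.map {ι : Type*} {w : ι → L} {n : ℕ} (h : HasTr M w n) :
    HasTr M (fun i => algebraMap L Ω (w i)) n := by
  obtain ⟨b, hb, hw⟩ := h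
  refine ⟨b, hb.map' (f := IsScalarTower.toAlgHom M L Ω) (algebraMap L Ω).injective, ?_⟩
  rintro _ ⟨i, rfl⟩
  refine map_mem_acl (F := M) (s := range (w ∘ b)) (algebraMap L Ω) (fun c => ?_) ?_
    (hw (mem_range_self i))
  · rw [← IsScalarTower.algebraMap_apply]; exact IntermediateField.algebraMap_mem _ c
  · rintro _ ⟨j, rfl⟩
    exact IntermediateField.subset_adjoin _ _ ⟨j, rfl⟩

theorem exists_pow_mem_genLin {w : Fin (N + 1) → L} (hw : HasTr M w n)
    {a : Fin n × Fin N → Ω} (ha : AlgebraicIndependent L a) (i₀ : Fin N) :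
    ∃ D : ℕ, (algebraMap L Ω (w i₀.succ)) ^ (D + 1) ∈
      Submodule.span (IntermediateField.adjoin M (range a))
        (insert 1 (range (genLin a (algebraMap L Ω ∘ w)))) *
      (Submodule.span (IntermediateField.adjoin M (range a))
        (insert 1 (range (genLin a (algebraMap L Ω ∘ w)))) ⊔
        Submodule.span _ {algebraMap L Ω (w i₀.succ)}) ^ D := by
  classical
  set K := IntermediateField.adjoin M (range a) with hK
  set v := algebraMap L Ω (w i₀.succ) with hv
  let σ := {p : Fin n × Fin N // p.2 ≠ i₀}
  let a' : σ → Ω := fun p => a p.1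
  let c : Fin n → K := fun j => ⟨a (j, i₀), IntermediateField.subset_adjoin _ _ ⟨_, rfl⟩⟩
  let τ : Fin n → Ω := fun j => -∑ i ∈ Finset.univ.erase i₀, a (j, i) * algebraMap L Ω (w i.succ)
  have ht : (fun j => τ j - c j • v) = genLin a (algebraMap L Ω ∘ w) := by
    funext j
    simp only [genLin, τ, Function.comp_apply]
    rw [← Finset.add_sum_erase _ _ (Finset.mem_univ i₀), neg_add, Algebra.smul_def, sub_eq_neg_add]
    rfl
  have haM : AlgebraicIndependent M a := ha.restrictScalars (algebraMap M L).injective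
  have hsum : AlgebraicIndependent M (Sum.elim (fun j => a (j, i₀)) a') := by
    let e : Fin n ⊕ σ → Fin n × Fin N := Sum.elim (fun j => (j, i₀)) Subtype.val
    have he : Function.Injective e := by
      rintro (x | x) (y | y) h
      · simpa [e] using h
      · exact absurd (congrArg Prod.snd h).symm y.2
      · exact absurd (congrArg Prod.snd h) x.2
      · simpa [e] using Subtype.ext h
    convert haM.comp e he using 1
    funext x; rcases x with x | x <;> rfl
  rw [AlgebraicIndependent.sumElim_iff] at hsum
  have hc : AlgebraicIndependent (Algebra.adjoin M (range a')) fun j => algebraMap K Ω (c j) :=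
    hsum.2
  obtain ⟨b, -, hwb⟩ := hw.map (Ω := Ω)
  have hna : ¬ AlgebraicIndependent (Algebra.adjoin M (range a'))
      (fun o : Option (Fin n) => o.elim v τ) := by
    intro hai
    have h1 := AlgebraicIndependent.sumElim_iff.2 ⟨hsum.1, hai⟩
    set S := range (Sum.elim ((fun i => algebraMap L Ω (w i)) ∘ b) a') with hS
    have hwS : ∀ i, algebraMap L Ω (w i) ∈ acl M S := fun i => by
      refine acl_mono ?_ (hwb (mem_range_self i))
      rintro _ ⟨j, rfl⟩
      exact ⟨Sum.inl j, rfl⟩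
    have haS : ∀ p : σ, a p.1 ∈ acl M S := fun p => subset_acl _ ⟨Sum.inr p, rfl⟩
    have h2 := encard_le_of_algebraicIndependent h1
      (y := Sum.elim ((fun i => algebraMap L Ω (w i)) ∘ b) a') (by
        rintro _ ⟨o, rfl⟩
        rcases o with (_ | j) | p
        · exact hwS _
        · refine neg_mem (sum_mem fun i hi => mul_mem (haS ⟨(j, i), ?_⟩) (hwS _))
          exact Finset.ne_of_mem_erase hi
        · exact haS p)
    simp at h2
  have hA : ∀ x : Algebra.adjoin M (range a'), ∃ y : K, algebraMap K Ω y =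
      algebraMap (Algebra.adjoin M (range a')) Ω x := by
    intro x
    refine ⟨⟨x.1, ?_⟩, rfl⟩
    have h3 : Algebra.adjoin M (range a') ≤ K.toSubalgebra := by
      rw [Algebra.adjoin_le_iff]
      rintro _ ⟨p, rfl⟩
      exact IntermediateField.subset_adjoin _ _ ⟨p.1, rfl⟩
    exact h3 x.2
  obtain ⟨D, hD⟩ := exists_pow_mem_mul_pow τ c v hna hc hA
  rw [ht] at hD
  exact ⟨D, hD⟩

theorem mem_acl_genCoeff {w : Fin (N + 1) → L} (hw : HasTr M w n) (h0 : w 0 = 1)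
    {a : Fin n × Fin N → Ω} (ha : AlgebraicIndependent L a) (i : Fin (N + 1)) :
    algebraMap L Ω (w i) ∈ acl M (range (genCoeff a (algebraMap L Ω ∘ w))) := by
  refine Fin.cases (by rw [h0, map_one]; exact one_mem _) (fun i => ?_) i
  obtain ⟨D, hD⟩ := exists_pow_mem_genLin hw ha i
  set E := IntermediateField.adjoin (IntermediateField.adjoin M (range a))
    (range (genLin a (algebraMap L Ω ∘ w)))
  have h := isAlgebraic_of_pow_mem E (by
    intro x hx
    induction hx using Submodule.span_induction with
    | mem x hx =>
      rcases hx with rfl | hx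
      · exact one_mem _
      · exact IntermediateField.subset_adjoin _ _ hx
    | zero => exact zero_mem _
    | add x y _ _ hx hy => exact add_mem hx hy
    | smul c x _ hx => exact E.smul_mem hx) hD
  refine mem_acl_of_isAlgebraic (E.restrictScalars M) ?_ h
  rw [IntermediateField.adjoin_adjoin_left, ← range_genCoeff]
  exact adjoin_le_acl _

theorem algebraicIndependent_genCoeff {w : Fin (N + 1) → L} (hw : HasTr M w n) (h0 : w 0 = 1)
    {a : Fin n × Fin N → Ω} (ha : AlgebraicIndependent L a) :
    AlgebraicIndependent M (genCoeff a (algebraMap L Ω ∘ w)) := by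
  obtain ⟨b, hb, -⟩ := id hw
  refine algebraicIndependent_of_card_le (hb.sumElim_comp ha) ?_ ?_
  · rintro _ ⟨x | x, rfl⟩
    · exact subset_acl _ ⟨(x.1, x.2.succ), rfl⟩
    · exact mem_acl_genCoeff hw h0 ha _
  · simp; ring_nf; rfl

end projection
end QuadricBound

namespace QuadricBound
open TensorProduct

/-- On a reduced algebra of finite type over an algebraically closed field, rational points
separate elements from zero. -/
theorem exists_algHom_apply_ne_zero {M B : Type*} [Field M] [IsAlgClosed M] [CommRing B]
    [Algebra M B] [Algebra.FiniteType M B] [IsReduced B] {b : B} (hb : b ≠ 0) :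
    ∃ φ : B →ₐ[M] M, φ b ≠ 0 := by
  have : IsJacobsonRing B := isJacobsonRing_of_finiteType (A := M)
  have hj : (⊥ : Ideal B).jacobson = ⊥ := by
    refine IsJacobsonRing.out' _ ?_
    rw [← Ideal.zero_eq_bot, ← nilradical_eq_zero B]
    exact Ideal.radical_isRadical _
  have hb' : b ∉ (⊥ : Ideal B).jacobson := by rwa [hj, Ideal.mem_bot]
  rw [Ideal.jacobson, Ideal.mem_sInf] at hb'
  push Not at hb'
  obtain ⟨m, ⟨-, hm⟩, hbm⟩ := hb'
  let _ : Field (B ⧸ m) := Ideal.Quotient.field m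
  have : Module.Finite M (B ⧸ m) := finite_of_finite_type_of_isJacobsonRing M (B ⧸ m)
  let e : M ≃ₐ[M] (B ⧸ m) := AlgEquiv.ofBijective (Algebra.ofId M (B ⧸ m))
    (IsAlgClosed.algebraMap_bijective_of_isIntegral (k := M) (K := B ⧸ m))
  refine ⟨e.symm.toAlgHom.comp (Ideal.Quotient.mkₐ M m), fun h => hbm ?_⟩
  have hmb : e.symm (Ideal.Quotient.mkₐ M m b) = 0 := h
  rw [map_eq_zero] at hmb
  exact Ideal.Quotient.eq_zero_iff_mem.1 hmb

/-- The tensor product of a domain of finite type over an algebraically closed field with any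
domain is a domain. -/
theorem isDomain_tensorProduct {M B A : Type*} [Field M] [IsAlgClosed M] [CommRing B] [IsDomain B]
    [Algebra M B] [Algebra.FiniteType M B] [CommRing A] [IsDomain A] [Algebra M A] :
    IsDomain (B ⊗[M] A) := by
  classical
  let a := Module.Basis.ofVectorSpace M A
  let β := Algebra.TensorProduct.basis B a
  have : Nontrivial (B ⊗[M] A) := inferInstance
  have : NoZeroDivisors (B ⊗[M] A) := by
    refine ⟨fun {f g} hfg => ?_⟩
    have key : ∀ i j, β.repr f i * β.repr g j = 0 := by
      intro i j
      by_contra h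
      obtain ⟨φ, hφ⟩ := exists_algHom_apply_ne_zero (M := M) h
      let Φ : B ⊗[M] A →ₐ[M] A :=
        Algebra.TensorProduct.lift ((Algebra.ofId M A).comp φ) (AlgHom.id M A)
          (fun _ _ => Commute.all _ _)
      have hΦ : ∀ x : B ⊗[M] A, ∀ i, a.repr (Φ x) i = φ (β.repr x i) := by
        intro x i
        induction x with
        | zero => simp
        | add x y hx hy => simp [hx, hy]
        | tmul b y =>
          simp only [Φ, β, Algebra.TensorProduct.lift_tmul, AlgHom.comp_apply, Algebra.ofId_apply,
            AlgHom.id_apply, Algebra.TensorProduct.basis_repr_tmul, Finsupp.smul_apply,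
            Finsupp.mapRange_apply, ← Algebra.smul_def, map_smul, smul_eq_mul, map_mul]
          simp
      have := congrArg Φ hfg
      rw [map_mul, map_zero, mul_eq_zero] at this
      rw [map_mul, ← hΦ, ← hΦ] at hφ
      rcases this with h | h <;> simp [h] at hφ
    by_contra! h
    obtain ⟨i, hi⟩ : ∃ i, β.repr f i ≠ 0 := by
      by_contra! h'
      exact h.1 (β.repr.map_eq_zero_iff.1 (Finsupp.ext h'))
    obtain ⟨j, hj⟩ : ∃ j, β.repr g j ≠ 0 := by
      by_contra! h'
      exact h.2 (β.repr.map_eq_zero_iff.1 (Finsupp.ext h'))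
    exact mul_ne_zero hi hj (key i j)
  exact NoZeroDivisors.to_isDomain _

theorem algebraicIndependent_iff_linearIndependent {R A ι : Type*} [CommRing R] [CommRing A]
    [Algebra R A] {x : ι → A} : AlgebraicIndependent R x ↔
      LinearIndependent R fun m : ι →₀ ℕ => MvPolynomial.aeval x (MvPolynomial.monomial m (1 : R)) := by
  constructor
  · intro h
    have := (MvPolynomial.basisMonomials ι R).linearIndependent.map'
      (MvPolynomial.aeval x).toLinearMap (LinearMap.ker_eq_bot.2 h)
    simpa [Function.comp_def] using this
  · intro h
    rw [algebraicIndependent_iff]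
    intro p hp
    rw [linearIndependent_iff'] at h
    have := h p.support (fun m => p.coeff m) (by
      rw [← hp]
      conv_rhs => rw [p.as_sum, map_sum]
      refine Finset.sum_congr rfl fun m _ => ?_
      rw [← map_smul, MvPolynomial.smul_monomial, smul_eq_mul, mul_one])
    ext m
    by_cases hm : m ∈ p.support
    · simpa using this m hm
    · simpa using hm

/-- Every finitely generated domain over an algebraically closed field `M` admits a copy
which is generic over a given extension of `M`. -/
theorem exists_generic_copy {M Ω B : Type} [Field M] [IsAlgClosed M] [Field Ω] [Algebra M Ω]
    [CommRing B] [IsDomain B] [Algebra M B] [Algebra.FiniteType M B] :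
    ∃ (Ω' : Type) (_ : Field Ω') (_ : IsAlgClosed Ω') (_ : Algebra Ω Ω') (_ : Algebra M Ω')
      (_ : IsScalarTower M Ω Ω') (φ : B →ₐ[M] Ω'),
      ∀ {ι : Type} (v : ι → B), LinearIndependent M v → LinearIndependent Ω (φ ∘ v) := by
  have h := isDomain_tensorProduct (M := M) (B := B) (A := Ω)
  have : IsDomain (Ω ⊗[M] B) := (Algebra.TensorProduct.comm M B Ω).symm.toMulEquiv.isDomain
  obtain ⟨E, _, _, _⟩ : ∃ (E : Type) (_ : Field E) (_ : Algebra (Ω ⊗[M] B) E),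
      IsFractionRing (Ω ⊗[M] B) E := ⟨FractionRing (Ω ⊗[M] B), inferInstance, inferInstance,
        inferInstance⟩
  let _ : Algebra M E := ((algebraMap (Ω ⊗[M] B) E).comp (algebraMap M _)).toAlgebra
  have : IsScalarTower M (Ω ⊗[M] B) E := IsScalarTower.of_algebraMap_eq fun _ => rfl
  let _ : Algebra Ω E := ((algebraMap (Ω ⊗[M] B) E).comp (algebraMap Ω _)).toAlgebra
  have : IsScalarTower Ω (Ω ⊗[M] B) E := IsScalarTower.of_algebraMap_eq fun _ => rfl
  have : IsScalarTower M Ω E := IsScalarTower.of_algebraMap_eq fun m => by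
    rw [IsScalarTower.algebraMap_apply Ω (Ω ⊗[M] B) E, ← IsScalarTower.algebraMap_apply M Ω (Ω ⊗[M] B)]
    rfl
  have : IsScalarTower M Ω (AlgebraicClosure E) := IsScalarTower.of_algebraMap_eq fun m => by
    rw [IsScalarTower.algebraMap_apply Ω E, ← IsScalarTower.algebraMap_apply M Ω E]
    rfl
  refine ⟨AlgebraicClosure E, inferInstance, inferInstance, inferInstance, inferInstance, this,
    (IsScalarTower.toAlgHom M E (AlgebraicClosure E)).comp
      ((IsScalarTower.toAlgHom M (Ω ⊗[M] B) E).comp Algebra.TensorProduct.includeRight), ?_⟩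
  intro ι v hv
  have h1 : LinearIndependent Ω fun i => (1 : Ω) ⊗ₜ[M] v i := Module.Flat.linearIndependent_one_tmul hv
  have h2 := h1.map' (IsScalarTower.toAlgHom Ω (Ω ⊗[M] B) E).toLinearMap
    (LinearMap.ker_eq_bot.2 (IsFractionRing.injective (Ω ⊗[M] B) E))
  exact h2.map' (IsScalarTower.toAlgHom Ω E (AlgebraicClosure E)).toLinearMap
    (LinearMap.ker_eq_bot.2 (algebraMap E (AlgebraicClosure E)).injective)
end QuadricBound

namespace QuadricBound
open MvPolynomial Set

section pderivStable
variable {M Ω : Type*} [Field M] [CharZero M] [CommRing Ω] [Nontrivial Ω] [Algebra M Ω]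

/-- In characteristic zero, a proper ideal of relations which is stable under all partial
derivatives is zero. -/
theorem algebraicIndependent_of_pderiv {σ : Type*} {P : σ → Ω}
    (h : ∀ f : MvPolynomial σ M, aeval P f = 0 → ∀ i, aeval P (pderiv i f) = 0) :
    AlgebraicIndependent M P := by
  rw [algebraicIndependent_iff]
  have key : ∀ d, ∀ f : MvPolynomial σ M, f.totalDegree ≤ d → aeval P f = 0 → f = 0 := by
    intro d
    induction d with
    | zero =>
      intro f hd hf
      rw [Nat.le_zero, totalDegree_eq_zero_iff_eq_C] at hd
      rw [hd, aeval_C, map_eq_zero_iff _ (algebraMap M Ω).injective] at hf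
      rw [hd, hf, C_0]
    | succ d ih =>
      intro f hd hf
      refine ih f ?_ hf
      refine Finset.sup_le fun m hm => ?_
      rcases eq_or_ne m 0 with rfl | hm0
      · simp
      · exfalso
        obtain ⟨i, hi⟩ := Finsupp.ne_iff.1 hm0
        have h0 : pderiv i f = 0 := by
          refine ih _ ?_ (h f hf i)
          refine Finset.sup_le fun m' hm' => ?_
          have hc := mem_support_iff.1 hm'
          rw [coeff_pderiv] at hc
          have h1 := (le_totalDegree (mem_support_iff.2 (left_ne_zero_of_mul hc))).trans hd
          rw [Finsupp.sum_add_index' (by simp) (by simp)] at h1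
          simpa using h1
        have h1 : m - Finsupp.single i 1 + Finsupp.single i 1 = m := by
          ext j
          rcases eq_or_ne j i with rfl | hj
          · simpa using Nat.sub_add_cancel (Nat.one_le_iff_ne_zero.2 hi)
          · simp [Finsupp.single_eq_of_ne hj]
        have h2 := coeff_pderiv (i := i) f (m - Finsupp.single i 1)
        rw [h0, h1, coeff_zero, eq_comm, mul_eq_zero] at h2
        rcases h2 with h2 | h2
        · exact mem_support_iff.1 hm h2
        · norm_cast at h2
  exact fun f hf => key _ f le_rfl hf

theorem derivative_aeval_line {M Ω : Type*} [Field M] [CommRing Ω] [Algebra M Ω]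
    {σ : Type*} [Fintype σ] (P v : σ → Ω)
    (f : MvPolynomial σ M) :
    (Polynomial.derivative (aeval (fun i => Polynomial.C (P i) + Polynomial.C (v i) * Polynomial.X)
      f)).eval 0 = ∑ i, aeval P (pderiv i f) * v i := by
  classical
  have h0 : ∀ p : MvPolynomial σ M, (aeval (fun i => Polynomial.C (P i) +
      Polynomial.C (v i) * Polynomial.X) p).eval 0 = aeval P p := by
    intro p
    induction p using MvPolynomial.induction_on with
    | C a => simp [IsScalarTower.algebraMap_apply M Ω (Polynomial Ω)]
    | add p q hp hq => simp [hp, hq]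
    | mul_X p i hp => simp [hp]
  induction f using MvPolynomial.induction_on with
  | C a => simp [IsScalarTower.algebraMap_apply M Ω (Polynomial Ω)]
  | add p q hp hq => simp only [map_add, Polynomial.eval_add, hp, hq, add_mul, Finset.sum_add_distrib]
  | mul_X p j hp =>
    rw [map_mul, Polynomial.derivative_mul, Polynomial.eval_add, Polynomial.eval_mul,
      Polynomial.eval_mul, hp, h0]
    have h1 : ∀ i, aeval P (pderiv i (p * X j)) * v i =
        aeval P (pderiv i p) * v i * P j + if i = j then aeval P p * v i else 0 := by
      intro i
      rw [pderiv_mul, pderiv_X, map_add, map_mul, map_mul, aeval_X]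
      rcases eq_or_ne i j with rfl | hij
      · simp; ring
      · simp [hij]; ring
    simp only [h1, Finset.sum_add_distrib, Finset.sum_ite_eq', Finset.mem_univ, if_true]
    simp [Finset.sum_mul, h0]

end pderivStable

section projection
variable {M Ω Ω' : Type*} [Field M] [CharZero M] [Field Ω] [Field Ω'] [Algebra M Ω] [Algebra Ω Ω']
  [Algebra M Ω'] [IsScalarTower M Ω Ω'] {n N : ℕ}

/-- The projection of the point `Q` from the point `P`, in affine coordinates. -/
def projPt (P : Fin (N + 2) → Ω) (Q : Fin (N + 2) → Ω') (i : Fin (N + 1)) : Ω' :=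
  (Q i.succ - algebraMap Ω Ω' (P i.succ)) / (Q 1 - algebraMap Ω Ω' (P 1))

variable {P : Fin (N + 2) → Ω} {Q : Fin (N + 2) → Ω'}

theorem projPt_denom_ne_zero (hQ0 : Q 0 = 1) (hQ : LinearIndependent Ω Q) :
    Q 1 - algebraMap Ω Ω' (P 1) ≠ 0 := by
  intro h
  rw [Fintype.linearIndependent_iff] at hQ
  have := hQ (Fin.cons (-P 1) (Fin.cons 1 0)) (by
    rw [Fin.sum_univ_succ, Fin.sum_univ_succ]
    simp [hQ0, Algebra.smul_def]
    rw [← sub_eq_neg_add]; exact h) 1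
  simp at this

theorem linearIndependent_projPt (hQ0 : Q 0 = 1) (hQ : LinearIndependent Ω Q) :
    LinearIndependent Ω (projPt P Q) := by
  have hne := projPt_denom_ne_zero (P := P) hQ0 hQ
  rw [Fintype.linearIndependent_iff] at hQ ⊢
  intro g hg i
  have := hQ (Fin.cons (-∑ i, g i * P i.succ) g) (by
    rw [Fin.sum_univ_succ]
    simp only [Fin.cons_zero, Fin.cons_succ, hQ0, Algebra.smul_def, map_neg, map_sum, map_mul,
      mul_one] at hg ⊢
    have h1 : (∑ i, algebraMap Ω Ω' (g i) * projPt P Q i) * (Q 1 - algebraMap Ω Ω' (P 1)) = 0 := by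
      rw [hg, zero_mul]
    rw [Finset.sum_mul] at h1
    rw [neg_add_eq_sub, ← Finset.sum_sub_distrib, ← h1]
    refine Finset.sum_congr rfl fun i _ => ?_
    rw [projPt, mul_assoc, div_mul_cancel₀ _ hne, mul_sub]) i.succ
  simpa using this

theorem hasTr_projPt (hnN : n < N + 1) (hP : HasTr M P n) (hQ : LinearIndependent Ω Q)
    (hQtr : HasTr Ω Q n) (hQ0 : Q 0 = 1)
    (hPQ : ∀ f : MvPolynomial (Fin (N + 2)) M, aeval P f = 0 → aeval Q f = 0) :
    HasTr Ω (projPt P Q) n := by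
  have hne := projPt_denom_ne_zero (P := P) hQ0 hQ
  set w' := projPt P Q with hw'
  set μ := Q 1 - algebraMap Ω Ω' (P 1) with hμ
  have hQw : ∀ i, Q (Fin.succ i) = algebraMap Ω Ω' (P i.succ) + w' i * μ := fun i => by
    rw [hw', projPt, div_mul_cancel₀ _ hne, add_sub_cancel]
  obtain ⟨s, hs, hsw⟩ := exists_algebraicIndependent_comp (F := Ω) w'
  obtain ⟨bQ, hbQ, hbQw⟩ := hQtr
  have hcard : Nat.card s ≤ n := by
    have := encard_le_of_algebraicIndependent hs (y := Q ∘ bQ) (by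
      rintro _ ⟨i, rfl⟩
      refine div_mem (sub_mem (hbQw ⟨_, rfl⟩) (algebraMap_mem _ _))
        (sub_mem (hbQw ⟨_, rfl⟩) (algebraMap_mem _ _)))
    simpa using this
  rcases hcard.eq_or_lt with heq | hlt
  · have e : Fin n ≃ s := (finCongr heq.symm).trans (Finite.equivFin s).symm
    refine ⟨fun j => (e j : Fin (N + 1)), hs.comp e e.injective, ?_⟩
    have : range (w' ∘ fun j => (e j : Fin (N + 1))) = range fun i : s => w' i :=
      e.surjective.range_comp (fun i : s => w' i)
    rw [this]; exact hsw
  · exfalso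
    have hμt : μ ∉ acl Ω (range w') := by
      have h1 : μ ∉ acl Ω (range fun i : s => w' i) := by
        rw [notMem_acl_range hs]
        refine algebraicIndependent_of_card_le hbQ ?_ (by
          rw [Finite.card_option, Nat.card_eq_fintype_card (α := Fin n), Fintype.card_fin]; omega)
        have hsub : range (fun i : s => w' i) ⊆
            range fun o : Option s => o.elim μ fun i : s => w' i := by
          rintro _ ⟨i, rfl⟩; exact ⟨some i, rfl⟩
        have hall : ∀ i, Q i ∈ acl Ω (range fun o : Option s => o.elim μ fun i : s => w' i) := by
          intro i
          refine Fin.cases ?_ (fun i => ?_) i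
          · rw [hQ0]; exact one_mem _
          · rw [hQw]
            exact add_mem (algebraMap_mem _ _) (mul_mem (acl_mono hsub (hsw ⟨i, rfl⟩))
              (subset_acl _ ⟨none, rfl⟩))
        rintro _ ⟨j, rfl⟩
        exact hall _
      exact fun h => h1 (acl_le hsw h)
    set E := IntermediateField.adjoin Ω (range w') with hE
    have hμE : Transcendental E μ := fun h => hμt (mem_acl.2 h)
    let wE : Fin (N + 1) → E := fun i => ⟨w' i, IntermediateField.subset_adjoin _ _ ⟨i, rfl⟩⟩
    let P' : Fin (N + 1) → Ω := fun i => P i.succ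
    have hw'LI := linearIndependent_projPt (P := P) hQ0 hQ
    have hline : ∀ f : MvPolynomial (Fin (N + 1)) M, aeval P' f = 0 →
        aeval (fun i => Polynomial.C (algebraMap Ω E (P' i)) + Polynomial.C (wE i) * Polynomial.X)
          f = 0 := by
      intro f hf
      have h1 : aeval Q (rename Fin.succ f) = 0 := hPQ _ (by rw [aeval_rename]; exact hf)
      rw [aeval_rename] at h1
      by_contra hne0
      refine hμE ⟨_, hne0, ?_⟩
      have : IsScalarTower M E Ω' := .of_algebraMap_eq fun x => by
        rw [IsScalarTower.algebraMap_apply M Ω E, ← IsScalarTower.algebraMap_apply Ω E Ω',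
          ← IsScalarTower.algebraMap_apply M Ω Ω']
      rw [← h1, ← AlgHom.restrictScalars_apply M, ← AlgHom.comp_apply, comp_aeval]
      congr 1
      congr 1
      funext i
      simp only [map_add, map_mul, AlgHom.restrictScalars_apply, Polynomial.aeval_C,
        Polynomial.aeval_X, Function.comp_apply, hQw]
      rfl
    have hAI : AlgebraicIndependent M P' := by
      refine algebraicIndependent_of_pderiv fun f hf i => ?_
      have h1 := derivative_aeval_line (M := M) (fun i => algebraMap Ω E (P' i)) wE f
      rw [hline f hf] at h1
      simp only [Polynomial.derivative_zero, Polynomial.eval_zero] at h1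
      rw [Fintype.linearIndependent_iff] at hw'LI
      refine hw'LI (fun i => aeval P' (pderiv i f)) ?_ i
      have h2 := congrArg (algebraMap E Ω') h1
      rw [map_zero, map_sum] at h2
      rw [h2]
      refine Finset.sum_congr rfl fun j _ => ?_
      rw [Algebra.smul_def, map_mul, IsScalarTower.algebraMap_apply Ω E Ω']
      congr 2
      exact (aeval_algebraMap_apply (A := Ω) (B := E) P' (pderiv j f)).symm
    obtain ⟨b, -, hb⟩ := hP
    have := encard_le_of_algebraicIndependent hAI (y := P ∘ b) (by
      rintro _ ⟨i, rfl⟩; exact hb ⟨_, rfl⟩)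
    simp at this
    omega

end projection
end QuadricBound

namespace QuadricBound
open MvPolynomial Set

theorem hasTr_of_linearIndependent {M Ω Ω' ι : Type} [Field M] [Field Ω]
    [Algebra M Ω] [Field Ω'] [Algebra Ω Ω'] [Algebra M Ω'] [IsScalarTower M Ω Ω']
    {w : ι → Ω} {Q : ι → Ω'} {n : ℕ} (htr : HasTr M w n)
    (hQ : ∀ {κ : Type} (v : κ → MvPolynomial ι M), LinearIndependent M (fun i => aeval w (v i)) →
      LinearIndependent Ω (fun i => aeval Q (v i)))
    (hfQ : ∀ f : MvPolynomial ι M, aeval w f = 0 → aeval Q f = 0) : HasTr Ω Q n := by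
  obtain ⟨b, hb, hwb⟩ := htr
  have hAI : AlgebraicIndependent Ω (Q ∘ b) := by
    rw [algebraicIndependent_iff_linearIndependent] at hb ⊢
    have h1 := hQ (fun m : Fin n →₀ ℕ => rename b (monomial m 1)) (by
      simpa only [aeval_rename] using hb)
    have h2 : (fun m : Fin n →₀ ℕ => aeval (Q ∘ b) (monomial m (1 : Ω))) =
        fun m => aeval Q (rename b (monomial m (1 : M))) := by
      funext m
      rw [aeval_rename, aeval_monomial, aeval_monomial, map_one, map_one]
    rw [h2]
    exact h1
  refine ⟨b, hAI, ?_⟩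
  rintro _ ⟨i, rfl⟩
  by_contra hn
  have hn : AlgebraicIndependent Ω (fun o : Option (Fin n) => o.elim (Q i) (Q ∘ b)) :=
    (notMem_acl_range hAI _).1 hn
  have hM : AlgebraicIndependent M (fun o : Option (Fin n) => o.elim (w i) (w ∘ b)) := by
    have h1 := hn.restrictScalars (R := M) (algebraMap M Ω).injective
    rw [algebraicIndependent_iff] at h1 ⊢
    intro f hf
    refine h1 f ?_
    have e1 : (fun o : Option (Fin n) => o.elim (w i) (w ∘ b)) = w ∘ (fun o => o.elim i b) := by
      funext o; rcases o with _ | j <;> rfl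
    have e2 : (fun o : Option (Fin n) => o.elim (Q i) (Q ∘ b)) =
        Q ∘ (fun o => o.elim i b) := by
      funext o; rcases o with _ | j <;> rfl
    rw [e2, ← aeval_rename]
    refine hfQ _ ?_
    rw [aeval_rename, ← e1, hf]
  exact (notMem_acl_range hb _).2 hM (hwb ⟨i, rfl⟩)

theorem exists_generic_point_of_adjoin {M Ω B ι : Type} [Field M] [IsAlgClosed M] [Field Ω]
    [Algebra M Ω] [CommRing B] [IsDomain B] [Algebra M B] [Algebra.FiniteType M B]
    (g : B →ₐ[M] Ω) (hg : Function.Injective g) (wB : ι → B)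
    (hw : LinearIndependent M (g ∘ wB)) {n : ℕ} (htr : HasTr M (g ∘ wB) n) :
    ∃ (Ω' : Type) (_ : Field Ω') (_ : IsAlgClosed Ω') (_ : Algebra Ω Ω') (_ : Algebra M Ω')
      (_ : IsScalarTower M Ω Ω') (Q : ι → Ω'), LinearIndependent Ω Q ∧ HasTr Ω Q n ∧
      (∀ f : MvPolynomial ι M, aeval (g ∘ wB) f = 0 → aeval Q f = 0) ∧
      (∀ i, g (wB i) = 1 → Q i = 1) := by
  obtain ⟨Ω', i1, i2, i3, i4, i5, φ, hφ⟩ := exists_generic_copy (M := M) (Ω := Ω) (B := B)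
  have hwB : ∀ f : MvPolynomial ι M, g (aeval wB f) = aeval (g ∘ wB) f := fun f => by
    rw [← AlgHom.comp_apply, comp_aeval]; rfl
  have hφB : ∀ f : MvPolynomial ι M, φ (aeval wB f) = aeval (φ ∘ wB) f := fun f => by
    rw [← AlgHom.comp_apply, comp_aeval]; rfl
  have hfQ : ∀ f : MvPolynomial ι M, aeval (g ∘ wB) f = 0 → aeval (φ ∘ wB) f = 0 := by
    intro f hf
    have h1 : aeval wB f = 0 := hg (by rw [hwB, hf, map_zero])
    rw [← hφB, h1, map_zero]
  have hLI : ∀ {κ : Type} (v : κ → MvPolynomial ι M),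
      LinearIndependent M (fun i => aeval (g ∘ wB) (v i)) →
      LinearIndependent Ω (fun i => aeval (φ ∘ wB) (v i)) := by
    intro κ v hv
    have h1 : LinearIndependent M (fun i => aeval wB (v i)) := by
      refine LinearIndependent.of_comp g.toLinearMap ?_
      simpa [Function.comp_def, hwB] using hv
    simpa only [Function.comp_def, hφB] using hφ _ h1
  refine ⟨Ω', i1, i2, i3, i4, i5, φ ∘ wB, ?_, ?_, hfQ, ?_⟩
  · exact hφ wB (LinearIndependent.of_comp g.toLinearMap hw)
  · exact hasTr_of_linearIndependent htr hLI hfQ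
  · intro i hi
    have : wB i = 1 := hg (by rw [hi, map_one])
    simp [this]

/-- The generic point of a variety over a field extension of its field of definition. -/
theorem exists_generic_point {M Ω ι : Type} [Finite ι] [Field M] [IsAlgClosed M] [Field Ω]
    [Algebra M Ω] (w : ι → Ω) (hw : LinearIndependent M w) {n : ℕ} (htr : HasTr M w n) :
    ∃ (Ω' : Type) (_ : Field Ω') (_ : IsAlgClosed Ω') (_ : Algebra Ω Ω') (_ : Algebra M Ω')
      (_ : IsScalarTower M Ω Ω') (Q : ι → Ω'), LinearIndependent Ω Q ∧ HasTr Ω Q n ∧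
      (∀ f : MvPolynomial ι M, aeval w f = 0 → aeval Q f = 0) ∧ (∀ i, w i = 1 → Q i = 1) := by
  have : Algebra.FiniteType M (Algebra.adjoin M (range w)) := .adjoin_of_finite (finite_range w)
  exact exists_generic_point_of_adjoin (Algebra.adjoin M (range w)).val Subtype.val_injective
    (fun i => ⟨w i, Algebra.subset_adjoin ⟨i, rfl⟩⟩) hw htr

theorem algebraicIndependent_genCoeff_X {M L : Type*} [Field M] [Field L] [Algebra M L] {n N : ℕ}
    {w : Fin (N + 1) → L} (hw : HasTr M w n) (h0 : w 0 = 1) :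
    AlgebraicIndependent M (genCoeff (X : Fin n × Fin N → MvPolynomial (Fin n × Fin N) L)
      (fun i => C (w i))) := by
  obtain ⟨E, _, _, _⟩ : ∃ (E : Type _) (_ : Field E) (_ : Algebra (MvPolynomial (Fin n × Fin N) L) E),
      IsFractionRing (MvPolynomial (Fin n × Fin N) L) E :=
    ⟨FractionRing (MvPolynomial (Fin n × Fin N) L), inferInstance, inferInstance, inferInstance⟩
  let _ : Algebra L E := ((algebraMap (MvPolynomial (Fin n × Fin N) L) E).comp C).toAlgebra
  have : IsScalarTower L (MvPolynomial (Fin n × Fin N) L) E := .of_algebraMap_eq fun _ => rfl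
  let _ : Algebra M E := ((algebraMap L E).comp (algebraMap M L)).toAlgebra
  have : IsScalarTower M L E := .of_algebraMap_eq fun _ => rfl
  have : IsScalarTower M (MvPolynomial (Fin n × Fin N) L) E := .of_algebraMap_eq fun _ => rfl
  have hX : AlgebraicIndependent L
      (fun p : Fin n × Fin N => algebraMap (MvPolynomial (Fin n × Fin N) L) E (X p)) :=
    (algebraicIndependent_X (Fin n × Fin N) L).map'
      (f := IsScalarTower.toAlgHom L (MvPolynomial (Fin n × Fin N) L) E)
      (IsFractionRing.injective (MvPolynomial (Fin n × Fin N) L) E)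
  have h1 := algebraicIndependent_genCoeff hw h0 hX
  refine AlgebraicIndependent.of_comp (IsScalarTower.toAlgHom M (MvPolynomial (Fin n × Fin N) L) E) ?_
  convert h1 using 1
  funext p
  exact map_genCoeff (algebraMap (MvPolynomial (Fin n × Fin N) L) E) _ _ p

theorem not_linearIndependent_of_mulVec_eq_zero {R ι : Type*} [CommRing R] [IsDomain R] [Fintype ι]
    [DecidableEq ι] (A : Matrix ι ι R) (v : ι → R) (hv : v ≠ 0) (h : A.mulVec v = 0) :
    ¬ LinearIndependent R (fun i => A i) := by
  intro hli
  have h1 : A.det = 0 := Matrix.exists_mulVec_eq_zero_iff.1 ⟨v, hv, h⟩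
  obtain ⟨u, hu, hu0⟩ := Matrix.exists_vecMul_eq_zero_iff.2 h1
  rw [Fintype.linearIndependent_iff] at hli
  refine hu (funext (hli u ?_))
  rw [← hu0]
  ext j
  simp [Matrix.vecMul, dotProduct]

end QuadricBound

namespace QuadricBound
open MvPolynomial Set

theorem map_aeval_genCoeff {M A B : Type*} [CommRing M] [CommRing A] [CommRing B] [Algebra M A]
    [Algebra M B] (φ : A →ₐ[M] B) {n N : ℕ} (x : Fin n × Fin N → A) (y : Fin (N + 1) → A)
    (f : MvPolynomial (Fin n × Fin (N + 1)) M) :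
    φ (aeval (genCoeff x y) f) = aeval (genCoeff (fun p => φ (x p)) (fun i => φ (y i))) f := by
  rw [← AlgHom.comp_apply, comp_aeval]
  congr 2
  funext p
  exact map_genCoeff φ.toRingHom _ _ p

theorem relation_transfer {M E₁ E₂ : Type*} [Field M] [CommRing E₁] [CommRing E₂] [Algebra M E₁]
    [Algebra M E₂] {n N : ℕ} {P : Fin (N + 1) → E₁} {Q : Fin (N + 1) → E₂}
    (hPQ : ∀ f : MvPolynomial (Fin (N + 1)) M, aeval P f = 0 → aeval Q f = 0)
    (h : Fin (N + 1) → MvPolynomial (Fin n × Fin (N + 1)) M)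
    (hP : ∑ i, aeval (genCoeff (X : Fin n × Fin N → MvPolynomial _ E₁) (fun i => C (P i))) (h i) *
      C (P i) = 0) :
    ∑ i, aeval (genCoeff (X : Fin n × Fin N → MvPolynomial _ E₂) (fun i => C (Q i))) (h i) *
      C (Q i) = 0 := by
  set F : MvPolynomial (Fin n × Fin N) (MvPolynomial (Fin (N + 1)) M) :=
    ∑ i, aeval (genCoeff (X : Fin n × Fin N → MvPolynomial _ (MvPolynomial (Fin (N + 1)) M))
      (fun i => C (X i))) (h i) * C (X i) with hF
  have hmap : ∀ {E : Type _} [CommRing E] [Algebra M E] (v : Fin (N + 1) → E),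
      mapAlgHom (aeval v : MvPolynomial (Fin (N + 1)) M →ₐ[M] E) F =
      ∑ i, aeval (genCoeff (X : Fin n × Fin N → MvPolynomial _ E) (fun i => C (v i))) (h i) *
        C (v i) := by
    intro E _ _ v
    rw [hF, map_sum]
    refine Finset.sum_congr rfl fun i _ => ?_
    rw [map_mul, map_aeval_genCoeff]
    simp
  have hmap2 : mapAlgHom (aeval Q : MvPolynomial (Fin (N + 1)) M →ₐ[M] E₂) F =
      ∑ i, aeval (genCoeff (X : Fin n × Fin N → MvPolynomial _ E₂) (fun i => C (Q i))) (h i) *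
        C (Q i) := by
    rw [hF, map_sum]
    refine Finset.sum_congr rfl fun i _ => ?_
    rw [map_mul, map_aeval_genCoeff]
    simp
  have h1 : mapAlgHom (aeval P : MvPolynomial (Fin (N + 1)) M →ₐ[M] E₁) F = 0 := (hmap P).trans hP
  rw [← hmap2]
  ext m
  have h2 := congrArg (coeff m) h1
  simp only [mapAlgHom_apply, coeff_map, coeff_zero] at h2 ⊢
  exact hPQ _ h2

theorem linearIndependent_of_sum_mul_eq_zero {A ι : Type*} [CommRing A] [Fintype ι] {N : ℕ}
    (H : ι → Fin (N + 1) → A) (w : Fin (N + 1) → A) (h0 : w 0 = 1)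
    (hrel : ∀ l, ∑ i, H l i * w i = 0) (hH : LinearIndependent A H) :
    LinearIndependent A (fun l (i : Fin N) => H l i.succ) := by
  rw [Fintype.linearIndependent_iff] at hH ⊢
  intro r hr
  refine hH r ?_
  have hs : ∀ i : Fin N, ∑ l, r l * H l i.succ = 0 := fun i => by
    have := congrFun hr i
    simpa using this
  have h3 : ∀ l, H l 0 = -∑ i : Fin N, H l i.succ * w i.succ := by
    intro l
    have := hrel l
    rw [Fin.sum_univ_succ, h0, mul_one] at this
    exact eq_neg_of_add_eq_zero_left this
  have h4 : ∑ l, r l * H l 0 = 0 := by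
    simp only [h3, mul_neg, Finset.sum_neg_distrib, neg_eq_zero, Finset.mul_sum]
    rw [Finset.sum_comm]
    refine Finset.sum_eq_zero fun i _ => ?_
    simp only [← mul_assoc]
    rw [← Finset.sum_mul, hs, zero_mul]
  funext i
  rw [Finset.sum_apply]
  refine Fin.cases ?_ (fun i => ?_) i
  · simpa using h4
  · simpa using hs i

theorem genCoeff_eq_of_sub_eq_mul {A : Type*} [CommRing A] {n N : ℕ} (g : Fin n × Fin N → A)
    (y z : Fin (N + 1) → A) (w : Fin N → A) (e : A) (hg : ∀ j, ∑ i, g (j, i) * w i = 0)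
    (h : ∀ i : Fin N, y i.succ - z i.succ = w i * e) : genCoeff g y = genCoeff g z := by
  funext p
  obtain ⟨j, i⟩ := p
  refine Fin.cases ?_ (fun i => rfl) i
  simp only [genCoeff, genLin, Fin.cases_zero]
  rw [neg_inj, ← sub_eq_zero, ← Finset.sum_sub_distrib]
  simp only [← mul_sub, h, ← mul_assoc]
  rw [← Finset.sum_mul, hg, zero_mul]

theorem sum_genCoeff_mul {A : Type*} [CommRing A] {n N : ℕ} (x : Fin n × Fin N → A)
    (w : Fin (N + 1) → A) (h0 : w 0 = 1) (j : Fin n) : ∑ i, genCoeff x w (j, i) * w i = 0 := by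
  rw [Fin.sum_univ_succ, h0, mul_one]
  simp [genCoeff, genLin]

/-- Substituting for the generic coefficients those of the forms vanishing at both the point `w`
and a second point `Q` does not distinguish `w` from `Q`. -/
theorem genCoeff_genCoeff_projPt {Ω Ω' : Type*} [Field Ω] [Field Ω'] [Algebra Ω Ω'] {n N : ℕ}
    (P : Fin (N + 2) → Ω) (Q : Fin (N + 2) → Ω') (hne : Q 1 - algebraMap Ω Ω' (P 1) ≠ 0)
    (g : Fin n × Fin (N + 1) → MvPolynomial (Fin n × Fin N) Ω')
    (hg : g = genCoeff X (fun i => C (projPt P Q i))) :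
    genCoeff g (fun i => C (algebraMap Ω Ω' (P i))) = genCoeff g (fun i => C (Q i)) := by
  have hw0 : projPt P Q 0 = 1 := div_self hne
  refine genCoeff_eq_of_sub_eq_mul g _ _ (fun i => C (projPt P Q i))
    (C (-(Q 1 - algebraMap Ω Ω' (P 1)))) ?_ ?_
  · rw [hg]
    exact sum_genCoeff_mul _ _ (by rw [hw0, C_1])
  · intro i
    rw [← C_mul, ← C_sub, projPt, mul_neg, div_mul_cancel₀ _ hne, neg_sub]

theorem relation_projPt {M Ω Ω' : Type*} [Field M] [Field Ω] [Field Ω'] [Algebra M Ω]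
    [Algebra Ω Ω'] [Algebra M Ω'] [IsScalarTower M Ω Ω'] {n N : ℕ}
    (w : Fin (N + 2) → Ω) (Q : Fin (N + 2) → Ω') (hne : Q 1 - algebraMap Ω Ω' (w 1) ≠ 0)
    (h0 : w 0 = 1) (hQ0 : Q 0 = 1)
    (hPQ : ∀ f : MvPolynomial (Fin (N + 2)) M, aeval w f = 0 → aeval Q f = 0)
    (h : Fin (N + 2) → MvPolynomial (Fin n × Fin (N + 2)) M)
    (hrel : ∑ i, aeval (genCoeff (X : Fin n × Fin (N + 1) → MvPolynomial _ Ω)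
      (fun i => C (w i))) (h i) * C (w i) = 0) :
    ∑ i : Fin (N + 1), aeval (genCoeff (X : Fin n × Fin N → MvPolynomial _ Ω')
      (fun i => C (projPt w Q i))) (aeval (genCoeff (X : Fin n × Fin (N + 1) → MvPolynomial _ Ω)
      (fun i => C (w i))) (h i.succ)) * C (projPt w Q i) = 0 := by
  set g : Fin n × Fin (N + 1) → MvPolynomial (Fin n × Fin N) Ω' :=
    genCoeff X (fun i => C (projPt w Q i)) with hg
  have hcomp : ∀ f : MvPolynomial (Fin n × Fin (N + 2)) M,
      aeval g (aeval (genCoeff (X : Fin n × Fin (N + 1) → MvPolynomial _ Ω)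
        (fun i => C (w i))) f) = aeval (genCoeff g (fun i => C (Q i))) f := by
    intro f
    rw [← genCoeff_genCoeff_projPt w Q hne g hg]
    have := map_aeval_genCoeff ((aeval (R := Ω) g).restrictScalars M)
      (X : Fin n × Fin (N + 1) → MvPolynomial _ Ω) (fun i => C (w i)) f
    refine this.trans ?_
    congr 3
    · funext p; simp
    · funext i
      simp [algebraMap_eq, IsScalarTower.algebraMap_apply Ω Ω' (MvPolynomial _ Ω')]
  have hcomp' : ∀ f : MvPolynomial (Fin n × Fin (N + 2)) M,
      aeval g (aeval (genCoeff (X : Fin n × Fin (N + 1) → MvPolynomial _ Ω')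
        (fun i => C (Q i))) f) = aeval (genCoeff g (fun i => C (Q i))) f := by
    intro f
    have := map_aeval_genCoeff ((aeval (R := Ω') g).restrictScalars M)
      (X : Fin n × Fin (N + 1) → MvPolynomial _ Ω') (fun i => C (Q i)) f
    refine this.trans ?_
    congr 3
    · funext p; simp
    · funext i
      simp [algebraMap_eq]
  have hrelP : ∑ i, aeval (genCoeff g (fun i => C (Q i))) (h i) * C (algebraMap Ω Ω' (w i)) = 0 := by
    have := congrArg (aeval (R := Ω) g) hrel
    rw [map_zero, map_sum] at this
    rw [← this]
    refine Finset.sum_congr rfl fun i _ => ?_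
    rw [map_mul, hcomp]
    simp [IsScalarTower.algebraMap_apply Ω Ω' (MvPolynomial _ Ω'), algebraMap_eq]
  have hrelQ : ∑ i, aeval (genCoeff g (fun i => C (Q i))) (h i) * C (Q i) = 0 := by
    have := congrArg (aeval (R := Ω') g) (relation_transfer hPQ h hrel)
    rw [map_zero, map_sum] at this
    rw [← this]
    refine Finset.sum_congr rfl fun i _ => ?_
    rw [map_mul, hcomp']
    simp [algebraMap_eq]
  simp only [hcomp]
  have h1 : ∑ i, aeval (genCoeff g (fun i => C (Q i))) (h i) * C (Q i) -
      ∑ i, aeval (genCoeff g (fun i => C (Q i))) (h i) * C (algebraMap Ω Ω' (w i)) = 0 := by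
    rw [hrelP, hrelQ, sub_zero]
  rw [← Finset.sum_sub_distrib, Fin.sum_univ_succ, hQ0, h0, map_one, map_one, map_one,
    sub_self, zero_add] at h1
  have h2 : (∑ i : Fin (N + 1), aeval (genCoeff g (fun i => C (Q i))) (h i.succ) *
      C (projPt w Q i)) * C (Q 1 - algebraMap Ω Ω' (w 1)) = 0 := by
    rw [Finset.sum_mul, ← h1]
    refine Finset.sum_congr rfl fun i _ => ?_
    rw [mul_assoc, ← C_mul, ← mul_sub, ← C_sub, projPt, div_mul_cancel₀ _ hne]
  refine (mul_eq_zero.1 h2).resolve_right fun h3 => hne ?_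
  rwa [C_eq_zero] at h3

/-- Among the vector relations between the coordinates of `w` whose coefficients are
polynomials in the generic linear forms vanishing at `w`, at most `n` are independent. -/
theorem not_linearIndependent_relations (n N : ℕ) (hnN : n ≤ N) :
    ∀ {M Ω : Type} [Field M] [IsAlgClosed M] [CharZero M] [Field Ω] [IsAlgClosed Ω] [Algebra M Ω]
      (w : Fin (N + 1) → Ω) (_ : w 0 = 1) (_ : LinearIndependent M w) (_ : HasTr M w n)
      (h : Fin (n + 1) → Fin (N + 1) → MvPolynomial (Fin n × Fin (N + 1)) M)
      (_ : ∀ l, ∑ i, aeval (genCoeff (X : Fin n × Fin N → MvPolynomial _ Ω) (fun i => C (w i)))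
        (h l i) * C (w i) = 0),
      ¬ LinearIndependent (MvPolynomial (Fin n × Fin N) Ω)
        (fun l i => aeval (genCoeff (X : Fin n × Fin N → MvPolynomial _ Ω) (fun i => C (w i)))
          (h l i)) := by
  induction N, hnN using Nat.le_induction with
  | base =>
    intro M Ω _ _ _ _ _ _ w h0 _ _ h hrel
    refine not_linearIndependent_of_mulVec_eq_zero
      (Matrix.of fun l i => aeval (genCoeff (X : Fin n × Fin n → MvPolynomial _ Ω)
        (fun i => C (w i))) (h l i)) (fun i => C (w i)) ?_ ?_
    · intro hz
      have := congrFun hz 0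
      simp [h0] at this
    · funext l
      exact hrel l
  | succ N hnN ih =>
    intro M Ω _ _ _ _ _ _ w h0 hli htr h hrel hcon
    obtain ⟨Ω', _, _, _, _, _, Q, hQli, hQtr, hPQ, hQ1⟩ := exists_generic_point w hli htr
    have hQ0 := hQ1 0 h0
    have : CharZero Ω := charZero_of_injective_algebraMap (algebraMap M Ω).injective
    have hne := projPt_denom_ne_zero (P := w) hQ0 hQli
    have hw'0 : projPt w Q 0 = 1 := div_self hne
    have hw'li : LinearIndependent Ω (projPt w Q) := linearIndependent_projPt hQ0 hQli
    have hw'tr : HasTr Ω (projPt w Q) n := hasTr_projPt (by omega) htr hQli hQtr hQ0 hPQ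
    refine ih (projPt w Q) hw'0 hw'li hw'tr
      (fun l i => aeval (genCoeff (X : Fin n × Fin (N + 1) → MvPolynomial _ Ω)
        (fun i => C (w i))) (h l i.succ))
      (fun l => relation_projPt w Q hne h0 hQ0 hPQ (h l) (hrel l)) ?_
    have hli' := linearIndependent_of_sum_mul_eq_zero
      (fun l i => aeval (genCoeff (X : Fin n × Fin (N + 1) → MvPolynomial _ Ω)
        (fun i => C (w i))) (h l i)) (fun i => C (w i)) (by rw [h0, C_1]) hrel hcon
    have hinj := algebraicIndependent_genCoeff_X hw'tr hw'0
    let _ : Algebra (MvPolynomial (Fin n × Fin (N + 1)) Ω) (MvPolynomial (Fin n × Fin N) Ω') :=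
      (aeval (genCoeff (X : Fin n × Fin N → MvPolynomial _ Ω')
        (fun i => C (projPt w Q i)))).toRingHom.toAlgebra
    have : FaithfulSMul (MvPolynomial (Fin n × Fin (N + 1)) Ω)
        (MvPolynomial (Fin n × Fin N) Ω') := (faithfulSMul_iff_algebraMap_injective _ _).2 hinj
    exact linearIndependent_algebraMap_comp_iff.2 hli'
end QuadricBound

namespace QuadricBound
open MvPolynomial Set

theorem exists_common_denom {k F σ ι : Type*} [Field k] [Field F] [Algebra k F] [Fintype ι]
    (τ : σ → F) (u : ι → F) (hu : ∀ i, u i ∈ IntermediateField.adjoin k (range τ)) :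
    ∃ (D : MvPolynomial σ k) (h : ι → MvPolynomial σ k), aeval τ D ≠ 0 ∧
      ∀ i, aeval τ (h i) = aeval τ D * u i := by
  classical
  have h1 : ∀ i, ∃ r s : MvPolynomial σ k, aeval τ s ≠ 0 ∧ u i = aeval τ r / aeval τ s := by
    intro i
    obtain ⟨r, s, h⟩ := (IntermediateField.mem_adjoin_range_iff k τ (u i)).1 (hu i)
    by_cases hs : aeval τ s = 0
    · exact ⟨0, 1, by simp, by rw [h, hs]; simp⟩
    · exact ⟨r, s, hs, h⟩
  choose r s hs hrs using h1
  refine ⟨∏ i, s i, fun i => r i * ∏ j ∈ Finset.univ.erase i, s j, ?_, fun i => ?_⟩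
  · rw [map_prod]
    exact Finset.prod_ne_zero_iff.2 fun i _ => hs i
  · rw [← Finset.mul_prod_erase Finset.univ s (Finset.mem_univ i), map_mul, map_mul, hrs]
    field_simp [hs i]

theorem le_finrank_span_adjoin {k L L' : Type} [Field k] [IsAlgClosed k] [CharZero k] [Field L]
    [Field L'] [Algebra k L] [Algebra L L'] [Algebra k L'] [IsScalarTower k L L'] {n N : ℕ}
    (hnN : n ≤ N) {w : Fin (N + 1) → L} (h0 : w 0 = 1) (hw : LinearIndependent k w)
    (htr : HasTr k w n) {a : Fin n × Fin N → L'} (ha : AlgebraicIndependent L a)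
    (K : IntermediateField k L')
    (hK : K = IntermediateField.adjoin k (range (genCoeff a (algebraMap L L' ∘ w)))) :
    N + 1 ≤ Module.finrank K (Submodule.span K (range (algebraMap L L' ∘ w))) + n := by
  classical
  by_contra! hlt
  set τ := genCoeff a (algebraMap L L' ∘ w) with hτ
  have hτAI : AlgebraicIndependent k τ := algebraicIndependent_genCoeff htr h0 ha
  let φ := Fintype.linearCombination K (algebraMap L L' ∘ w)
  have hrange : Submodule.span K (range (algebraMap L L' ∘ w)) = LinearMap.range φ :=
    (Fintype.range_linearCombination K _).symm
  have hrn := φ.finrank_range_add_finrank_ker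
  rw [Module.finrank_fin_fun, ← hrange] at hrn
  have hker : n + 1 ≤ Module.finrank K (LinearMap.ker φ) := by omega
  obtain ⟨u, hu⟩ := exists_linearIndependent_of_le_finrank hker
  have hu' : LinearIndependent K fun l => ((u l : LinearMap.ker φ) : Fin (N + 1) → K) :=
    hu.map' (LinearMap.ker φ).subtype (Submodule.ker_subtype _)
  have hrel : ∀ l, ∑ i, (((u l : Fin (N + 1) → K) i : K) : L') * algebraMap L L' (w i) = 0 := by
    intro l
    have h1 : φ (u l) = 0 := (u l).2
    rw [Fintype.linearCombination_apply] at h1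
    rw [← h1]
    rfl
  have hden : ∀ l, ∃ (D : MvPolynomial (Fin n × Fin (N + 1)) k)
      (h : Fin (N + 1) → MvPolynomial (Fin n × Fin (N + 1)) k), aeval τ D ≠ 0 ∧
      ∀ i, aeval τ (h i) = aeval τ D * (((u l : Fin (N + 1) → K) i : K) : L') := fun l =>
    exists_common_denom τ _ fun i => hK ▸ ((u l : Fin (N + 1) → K) i).2
  choose D h hD hh using hden
  have hmem : ∀ f : MvPolynomial (Fin n × Fin (N + 1)) k, aeval τ f ∈ K := by
    intro f
    rw [hK]
    exact IntermediateField.algebra_adjoin_le_adjoin k _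
      (Algebra.adjoin_range_eq_range_aeval k τ ▸ ⟨f, rfl⟩)
  have hli : LinearIndependent (MvPolynomial (Fin n × Fin (N + 1)) k) h := by
    rw [Fintype.linearIndependent_iff] at hu' ⊢
    intro r hr l
    have h1 := hu' (fun l => ⟨aeval τ (r l * D l), hmem _⟩) ?_ l
    · have h2 : aeval τ (r l * D l) = 0 := congrArg Subtype.val h1
      rw [map_mul] at h2
      exact (map_eq_zero_iff _ hτAI).1 ((mul_eq_zero.1 h2).resolve_right (hD l))
    · funext i
      apply Subtype.ext
      have h3 := congrArg (aeval τ) (congrFun hr i)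
      simp only [Finset.sum_apply, Pi.smul_apply, smul_eq_mul, map_sum, map_mul, hh] at h3
      simp only [Finset.sum_apply, Pi.smul_apply, smul_eq_mul, Pi.zero_apply,
        ZeroMemClass.coe_zero, map_mul]
      rw [Pi.zero_apply, map_zero] at h3
      rw [← h3]
      push_cast
      refine Finset.sum_congr rfl fun l _ => ?_
      simp [mul_assoc]
  obtain ⟨Ω, _, _, _, _, _⟩ : ∃ (Ω : Type) (_ : Field Ω) (_ : IsAlgClosed Ω) (_ : Algebra L Ω)
      (_ : Algebra k Ω), IsScalarTower k L Ω :=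
    ⟨AlgebraicClosure L, inferInstance, inferInstance, inferInstance, inferInstance, inferInstance⟩
  have hrelX : ∀ l, ∑ i, aeval (genCoeff (X : Fin n × Fin N → MvPolynomial _ L)
      (fun i => C (w i))) (h l i) * C (w i) = 0 := by
    intro l
    have hinj : Function.Injective (aeval (R := L) a) := ha
    apply hinj
    rw [map_zero, map_sum]
    have h1 : ∀ i, aeval (R := L) a (aeval (genCoeff (X : Fin n × Fin N → MvPolynomial _ L)
      (fun i => C (w i))) (h l i) * C (w i)) =
        aeval τ (D l) * ((((u l : Fin (N + 1) → K) i : K) : L') * algebraMap L L' (w i)) := by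
      intro i
      have h2 := map_aeval_genCoeff ((aeval (R := L) a).restrictScalars k)
        (X : Fin n × Fin N → MvPolynomial _ L) (fun i => C (w i)) (h l i)
      simp only [AlgHom.restrictScalars_apply, aeval_X, aeval_C] at h2
      rw [map_mul, aeval_C, h2, ← mul_assoc, ← hh]
      rfl
    rw [Finset.sum_congr rfl fun i _ => h1 i, ← Finset.mul_sum, hrel, mul_zero]
  have hwΩ : LinearIndependent k (fun i => algebraMap L Ω (w i)) :=
    hw.map' (IsScalarTower.toAlgHom k L Ω).toLinearMap
      (LinearMap.ker_eq_bot.2 (algebraMap L Ω).injective)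
  have hwtr : HasTr k (fun i => algebraMap L Ω (w i)) n := htr.map
  refine not_linearIndependent_relations n N hnN (fun i => algebraMap L Ω (w i)) (by simp [h0])
    hwΩ hwtr h (fun l => relation_transfer ?_ (h l) (hrelX l)) ?_
  · intro f hf
    have : aeval (fun i => algebraMap L Ω (w i)) f = algebraMap L Ω (aeval w f) :=
      aeval_algebraMap_apply Ω w f
    rw [this, hf, map_zero]
  · have hinj := algebraicIndependent_genCoeff_X (M := k) hwtr (by simp [h0])
    let _ : Algebra (MvPolynomial (Fin n × Fin (N + 1)) k) (MvPolynomial (Fin n × Fin N) Ω) :=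
      (aeval (genCoeff (X : Fin n × Fin N → MvPolynomial _ Ω)
        (fun i => C (algebraMap L Ω (w i))))).toRingHom.toAlgebra
    have : FaithfulSMul (MvPolynomial (Fin n × Fin (N + 1)) k)
        (MvPolynomial (Fin n × Fin N) Ω) := (faithfulSMul_iff_algebraMap_injective _ _).2 hinj
    exact linearIndependent_algebraMap_comp_iff.2 hli
end QuadricBound

namespace QuadricBound
open Module Set
open scoped Pointwise

theorem linearIndependent_of_linearIndependent_basis {F E Ω ι : Type*} [Field F] [Field E] [Field Ω]
    [Algebra F E] [Algebra F Ω] [Algebra E Ω] [IsScalarTower F E Ω] (W : Submodule F Ω)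
    (b : Basis ι F W) (hb : LinearIndependent E fun i => (b i : Ω)) {x : E} {y : Ω} (hy : y ∈ W)
    (hy0 : y ≠ 0) (hxy : x • y ∈ W) : x ∈ (algebraMap F E).range := by
  obtain ⟨i, hi⟩ : ∃ i, b.repr ⟨y, hy⟩ i ≠ 0 := by
    by_contra! h
    have h1 : b.repr ⟨y, hy⟩ = 0 := Finsupp.ext h
    rw [LinearEquiv.map_eq_zero_iff] at h1
    exact hy0 (congrArg Subtype.val h1)
  have key : ∀ z : W, (z : Ω) = Finsupp.linearCombination E (fun i => (b i : Ω))
      ((b.repr z).mapRange (algebraMap F E) (map_zero _)) := by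
    intro z
    have h1 := congrArg Subtype.val (b.linearCombination_repr z).symm
    rw [h1, Finsupp.linearCombination_apply, Finsupp.linearCombination_apply,
      Finsupp.sum_mapRange_index (by simp), Finsupp.sum, Finsupp.sum]
    push_cast
    refine Finset.sum_congr rfl fun i _ => ?_
    rw [algebraMap_smul]
  have h2 : Finsupp.linearCombination E (fun i => (b i : Ω))
      (x • (b.repr ⟨y, hy⟩).mapRange (algebraMap F E) (map_zero _)) =
      Finsupp.linearCombination E (fun i => (b i : Ω))
      ((b.repr ⟨x • y, hxy⟩).mapRange (algebraMap F E) (map_zero _)) := by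
    rw [map_smul, ← key, ← key]
  have h3 := DFunLike.congr_fun (hb h2) i
  simp only [Finsupp.smul_apply, Finsupp.mapRange_apply, smul_eq_mul] at h3
  refine ⟨b.repr ⟨x • y, hxy⟩ i / b.repr ⟨y, hy⟩ i, ?_⟩
  rw [map_div₀, ← h3, mul_div_cancel_right₀]
  simpa using hi

theorem finrank_span_submodule_lt {F E Ω : Type*} [Field F] [Field E] [Field Ω]
    [Algebra F E] [Algebra F Ω] [Algebra E Ω] [IsScalarTower F E Ω]
    (W : Submodule F Ω) [FiniteDimensional F W] (h1 : (1 : Ω) ∈ W) (x : E)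
    (hx : algebraMap E Ω x ∈ W) (hxt : Transcendental F x) :
    finrank E (Submodule.span E (W : Set Ω)) + 1 ≤ finrank F W := by
  by_contra! hlt
  let b := finBasis F W
  have hspan : Submodule.span E (W : Set Ω) = Submodule.span E (range fun i => (b i : Ω)) := by
    have h2 : W = Submodule.span F (range fun i => (b i : Ω)) := by
      have := congrArg (Submodule.map W.subtype) b.span_eq
      rw [Submodule.map_span, Submodule.map_top, Submodule.range_subtype, ← range_comp] at this
      exact this.symm
    conv_lhs => rw [h2]
    exact Submodule.span_span_of_tower F E _
  have hb : LinearIndependent E fun i => (b i : Ω) := by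
    rw [linearIndependent_iff_card_le_finrank_span, Fintype.card_fin]
    have := Nat.lt_succ_iff.1 hlt
    rwa [hspan] at this
  obtain ⟨y, hy⟩ := linearIndependent_of_linearIndependent_basis W b hb (x := x) h1 one_ne_zero
    (by rwa [Algebra.smul_def, mul_one])
  exact hxt (hy ▸ isAlgebraic_algebraMap y)

theorem finrank_span_range_step {k Ω : Type*} [Field k] [Field Ω] [Algebra k Ω] {N : ℕ}
    {w : Fin (N + 1) → Ω} (h0 : w 0 = 1) {F E : IntermediateField k Ω} (hFE : F ≤ E) {t : Ω}
    (htE : t ∈ E) (htF : Transcendental F t) (ht : t ∈ Submodule.span F (range w)) :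
    finrank E ↥(Submodule.span E (range w) * Submodule.span E (range w)) +
      finrank F (Submodule.span F (range w)) ≤
        finrank F ↥(Submodule.span F (range w) * Submodule.span F (range w)) ∧
    finrank E (Submodule.span E (range w)) + 1 ≤ finrank F (Submodule.span F (range w)) := by
  let _ : Algebra F E := (IntermediateField.inclusion hFE).toRingHom.toAlgebra
  have : IsScalarTower F E Ω := .of_algebraMap_eq fun _ => rfl
  have : FiniteDimensional F (Submodule.span F (range w)) :=
    FiniteDimensional.span_of_finite F (finite_range w)
  have h1 : (1 : Ω) ∈ Submodule.span F (range w) := Submodule.subset_span ⟨0, h0⟩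
  have hxt : Transcendental F (⟨t, htE⟩ : E) := fun h => htF (h.algebraMap (A := Ω))
  have e1 := finrank_span_mul_self_add_le (E := E) _ h1 ⟨t, htE⟩ ht hxt
  have e2 := finrank_span_submodule_lt (E := E) _ h1 ⟨t, htE⟩ ht hxt
  rw [Submodule.span_mul_span, Submodule.span_span_of_tower, ← Submodule.span_mul_span] at e1
  rw [Submodule.span_span_of_tower] at e2
  rw [Submodule.span_mul_span F] 
  exact ⟨e1, e2⟩

theorem finrank_span_adjoin {k L Ω κ : Type*} [Field k] [Field L] [Field Ω] [Algebra k L]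
    [Algebra L Ω] [Algebra k Ω] [IsScalarTower k L Ω] {a : κ → Ω} (ha : AlgebraicIndependent L a)
    (S : Submodule k L) [FiniteDimensional k S] :
    finrank (IntermediateField.adjoin k (range a))
      (Submodule.span (IntermediateField.adjoin k (range a)) (algebraMap L Ω '' S)) =
      finrank k S := by
  let b := finBasis k S
  have hb : LinearIndependent k fun i => (b i : L) :=
    b.linearIndependent.map' S.subtype (Submodule.ker_subtype _)
  have h1 := linearIndependent_adjoin hb ha
  have h2 : S = Submodule.span k (range fun i => (b i : L)) := by
    have := congrArg (Submodule.map S.subtype) b.span_eq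
    rw [Submodule.map_span, Submodule.map_top, Submodule.range_subtype, ← range_comp] at this
    exact this.symm
  have h3 : Submodule.span (IntermediateField.adjoin k (range a)) (algebraMap L Ω '' S) =
      Submodule.span (IntermediateField.adjoin k (range a))
        (range fun i => algebraMap L Ω (b i)) := by
    conv_lhs => rw [h2]
    have h4 : algebraMap L Ω '' (Submodule.span k (range fun i => (b i : L)) : Set L) =
        (Submodule.span k (range fun i => algebraMap L Ω (b i)) : Set Ω) := by
      have := Submodule.map_span (IsScalarTower.toAlgHom k L Ω).toLinearMap
        (range fun i => (b i : L))
      have := congrArg (fun T : Submodule k Ω => (T : Set Ω)) this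
      rw [← range_comp] at this
      exact this
    rw [h4, Submodule.span_span_of_tower]
  rw [h3, finrank_span_eq_card h1, Fintype.card_fin]

theorem add_sum_le_of_step (D d : ℕ → ℕ) (n : ℕ) (h : ∀ j < n, D (j + 1) + d j ≤ D j ∧
    d (j + 1) + 1 ≤ d j) : D n + ∑ j ∈ Finset.range n, (d n + (n - j)) ≤ D 0 := by
  have h1 : ∀ i ≤ n, d n + i ≤ d (n - i) := by
    intro i
    induction i with
    | zero => intro _; simp
    | succ i ih =>
      intro hi
      have h2 := (h (n - (i + 1)) (by omega)).2
      rw [show n - (i + 1) + 1 = n - i by omega] at h2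
      have := ih (by omega)
      omega
  have h2 : ∀ i ≤ n, D i + ∑ j ∈ Finset.range i, (d n + (n - j)) ≤ D 0 := by
    intro i
    induction i with
    | zero => intro _; simp
    | succ i ih =>
      intro hi
      rw [Finset.sum_range_succ]
      have h3 := (h i (by omega)).1
      have h4 := h1 (n - i) (by omega)
      rw [show n - (n - i) = i by omega] at h4
      have := ih (by omega)
      omega
  exact h2 n le_rfl

theorem finrank_mul_self_adjoin_add_sum_le {k L Ω : Type*} [Field k] [Field L] [Field Ω]
    [Algebra k L] [Algebra L Ω] [Algebra k Ω] [IsScalarTower k L Ω] {n N : ℕ}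
    {w : Fin (N + 1) → L} (h0 : w 0 = 1) (htr : HasTr k w n) {a : Fin n × Fin N → Ω}
    (ha : AlgebraicIndependent L a) (K : IntermediateField k Ω)
    (hK : K = IntermediateField.adjoin k (range (genCoeff a (algebraMap L Ω ∘ w)))) :
    finrank K ↥(Submodule.span K (range (algebraMap L Ω ∘ w)) *
      Submodule.span K (range (algebraMap L Ω ∘ w))) +
      ∑ j ∈ Finset.range n, (finrank K (Submodule.span K (range (algebraMap L Ω ∘ w))) + (n - j)) ≤
      finrank k ↥(Submodule.span k (range w) * Submodule.span k (range w)) := by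
  set τ := genCoeff a (algebraMap L Ω ∘ w) with hτ
  have hτAI : AlgebraicIndependent k τ := algebraicIndependent_genCoeff htr h0 ha
  have hτ0 : ∀ j, τ (j, 0) = genLin a (algebraMap L Ω ∘ w) j := fun j => rfl
  have hτs : ∀ i l, τ (i, Fin.succ l) = a (i, l) := fun i l => rfl
  clear_value τ
  obtain ⟨F, hF⟩ : ∃ F : ℕ → IntermediateField k Ω, ∀ j, F j =
    IntermediateField.adjoin k (τ '' {p | p.2 ≠ 0 ∨ p.1.1 < j}) := ⟨_, fun _ => rfl⟩
  have hFa : ∀ j i l, a (i, l) ∈ F j := fun j i l => hF j ▸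
    IntermediateField.subset_adjoin _ _ ⟨(i, l.succ), Or.inl (Fin.succ_ne_zero _), hτs i l⟩
  have hFn : F n = K := by
    rw [hK, ← image_univ, hF]
    congr 2
    ext p
    simp
  have hF0 : F 0 = IntermediateField.adjoin k (range a) := by
    rw [hF]
    congr 1
    ext x
    constructor
    · rintro ⟨⟨i, l⟩, hp, rfl⟩
      rcases Fin.exists_succ_eq.2 (hp.resolve_right (by simp)) with ⟨l, rfl⟩
      exact ⟨(i, l), (hτs i l).symm⟩
    · rintro ⟨⟨i, l⟩, rfl⟩
      exact ⟨(i, l.succ), Or.inl (Fin.succ_ne_zero _), hτs i l⟩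
  have hstep := add_sum_le_of_step
    (fun j => finrank (F j) ↥(Submodule.span (F j) (range (algebraMap L Ω ∘ w)) *
      Submodule.span (F j) (range (algebraMap L Ω ∘ w))))
    (fun j => finrank (F j) (Submodule.span (F j) (range (algebraMap L Ω ∘ w)))) n (by
      intro j hj
      refine finrank_span_range_step (t := genLin a (algebraMap L Ω ∘ w) ⟨j, hj⟩) (by simp [h0])
        (hF j ▸ hF (j + 1) ▸ IntermediateField.adjoin.mono _ _ _ (image_mono ?_)) ?_ ?_ ?_
      · intro p hp
        rcases hp with hp | hp
        · exact Or.inl hp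
        · exact Or.inr (by omega)
      · rw [hF]
        exact IntermediateField.subset_adjoin _ _ ⟨(⟨j, hj⟩, 0), Or.inr (by simp), hτ0 _⟩
      · rw [hF, ← hτ0]
        refine IntermediateField.transcendental_adjoin_iff.2 ?_
        exact hτAI.transcendental_adjoin (i := (⟨j, hj⟩, 0)) (by simp)
      · refine neg_mem (sum_mem fun i _ => ?_)
        exact Submodule.smul_mem _ (⟨a (⟨j, hj⟩, i), hFa _ _ _⟩ : F j)
          (Submodule.subset_span ⟨i.succ, rfl⟩))
  rw [hFn, hF0] at hstep
  refine hstep.trans (le_of_eq ?_)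
  have : FiniteDimensional k ↥(Submodule.span k (range w) * Submodule.span k (range w)) := by
    rw [Submodule.span_mul_span]
    exact FiniteDimensional.span_of_finite k ((finite_range w).mul (finite_range w))
  rw [← finrank_span_adjoin ha, Submodule.span_mul_span, Submodule.span_mul_span]
  have h4 : algebraMap L Ω '' (Submodule.span k (range w * range w) : Set L) =
      (Submodule.span k (range (algebraMap L Ω ∘ w) * range (algebraMap L Ω ∘ w)) : Set Ω) := by
    have := Submodule.map_span (IsScalarTower.toAlgHom k L Ω).toLinearMap (range w * range w)
    have := congrArg (fun T : Submodule k Ω => (T : Set Ω)) this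
    refine this.trans ?_
    congr 2
    rw [range_comp]
    exact image_mul (algebraMap L Ω)
  rw [h4, Submodule.span_span_of_tower]
end QuadricBound

namespace QuadricBound
open MvPolynomial Set TensorProduct

section acl
variable {L Ω : Type*} [Field L] [Field Ω] [Algebra L Ω]

theorem algebraicIndependent_acl {ι κ : Type*} {y : ι → Ω} {x : κ → Ω}
    (h : AlgebraicIndependent L (Sum.elim y x)) : AlgebraicIndependent (acl L (range x)) y := by
  have h1 := (AlgebraicIndependent.sumElim_iff.1 h).2
  rw [← IntermediateField.algebraicIndependent_adjoin_iff] at h1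
  exact h1.extendScalars (algebraicClosure (IntermediateField.adjoin L (range x)) Ω)

theorem sum_mul_sub_eq_zero {n N : ℕ} {a : Fin n × Fin N → Ω} {Q w : Fin (N + 1) → Ω} {j : Fin n}
    (h : genLin a Q j = genLin a w j) {i₀ : Fin N} (hne : Q i₀.succ ≠ w i₀.succ) :
    a (j, i₀) = ∑ i : {i // i ≠ i₀},
      -((Q i.1.succ - w i.1.succ) / (Q i₀.succ - w i₀.succ)) * a (j, i) := by
  have h1 : ∑ i, a (j, i) * (Q i.succ - w i.succ) = 0 := by
    have := neg_injective h
    simp only [mul_sub, Finset.sum_sub_distrib, this, sub_self]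
  rw [Fintype.sum_eq_add_sum_subtype_ne _ i₀] at h1
  have h2 : Q i₀.succ - w i₀.succ ≠ 0 := sub_ne_zero.2 hne
  rw [← mul_left_inj' h2, eq_neg_of_add_eq_zero_left h1, Finset.sum_mul, ← Finset.sum_neg_distrib]
  refine Finset.sum_congr rfl fun i _ => ?_
  field_simp

theorem algebraicIndependent_sumElim_of_genLin_eq {n N : ℕ} {a : Fin n × Fin N → Ω}
    (ha : AlgebraicIndependent L a) (w : Fin (N + 1) → L) {Q : Fin (N + 1) → Ω}
    {b : Fin n → Fin (N + 1)} (hQ : range Q ⊆ acl L (range (Q ∘ b)))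
    (hlin : ∀ j, genLin a Q j = genLin a (algebraMap L Ω ∘ w) j) {i₀ : Fin N}
    (hne : Q i₀.succ ≠ algebraMap L Ω (w i₀.succ)) :
    AlgebraicIndependent L (Sum.elim (fun p : Fin n × {i // i ≠ i₀} => a (p.1, p.2)) (Q ∘ b)) := by
  classical
  refine algebraicIndependent_of_card_le ha ?_ ?_
  · set s := range (Sum.elim (fun p : Fin n × {i // i ≠ i₀} => a (p.1, p.2)) (Q ∘ b)) with hs
    have ha' : ∀ j (i : {i // i ≠ i₀}), a (j, i) ∈ acl L s := fun j i =>
      subset_acl _ ⟨Sum.inl (j, i), rfl⟩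
    have hQ' : ∀ i, Q i ∈ acl L s := fun i =>
      acl_mono (by rintro _ ⟨l, rfl⟩; exact ⟨Sum.inr l, rfl⟩) (hQ (mem_range_self i))
    rintro _ ⟨⟨j, i⟩, rfl⟩
    by_cases hi : i = i₀
    · rw [hi, sum_mul_sub_eq_zero (hlin j) hne]
      refine sum_mem fun i _ => mul_mem (neg_mem (div_mem ?_ ?_)) (ha' j i)
      · exact sub_mem (hQ' _) (IntermediateField.algebraMap_mem _ _)
      · exact sub_mem (hQ' _) (IntermediateField.algebraMap_mem _ _)
    · exact ha' j ⟨i, hi⟩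
  · obtain ⟨N, rfl⟩ : ∃ M, N = M + 1 := ⟨N - 1, by have := i₀.2; omega⟩
    simp only [Nat.card_eq_fintype_card, Fintype.card_sum, Fintype.card_prod, Fintype.card_fin,
      Fintype.card_subtype_compl, Fintype.card_subtype_eq, ne_eq]
    simp [mul_add]

end acl

theorem injective_of_algebraicIndependent {L T Ω κ : Type*} [Field L] [CommRing T] [IsDomain T]
    [Algebra L T] [Field Ω] [Algebra L Ω] (x : κ → T) {s : Set T} (hs : Algebra.adjoin L s = ⊤)
    (halg : ∀ y ∈ s, ¬ AlgebraicIndependent L fun o : Option κ => o.elim y x) (π : T →ₐ[L] Ω)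
    (h : AlgebraicIndependent L (π ∘ x)) : Function.Injective π := by
  have hx : AlgebraicIndependent L x := AlgebraicIndependent.of_comp π h
  have hle : ∀ t : T, IsAlgebraic (Algebra.adjoin L (range x)) t := by
    intro t
    have ht : t ∈ Algebra.adjoin L s := hs ▸ Algebra.mem_top
    induction ht using Algebra.adjoin_induction with
    | mem y hy =>
      have := halg y hy
      rwa [hx.option_iff_transcendental, Transcendental, not_not] at this
    | algebraMap c =>
      exact isAlgebraic_algebraMap (algebraMap L (Algebra.adjoin L (range x)) c)
    | add _ _ _ _ h1 h2 => exact h1.add h2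
    | mul _ _ _ _ h1 h2 => exact h1.mul h2
  rw [injective_iff_map_eq_zero]
  intro t ht
  by_contra h0
  obtain ⟨p, hp, hpt⟩ := (hle t).exists_nonzero_coeff_and_aeval_eq_zero
    (mem_nonZeroDivisors_of_ne_zero h0)
  have h1 : π (Polynomial.aeval t p) = π (algebraMap _ T (p.coeff 0)) := by
    rw [Polynomial.aeval_eq_sum_range, map_sum, Finset.sum_range_succ']
    simp [Algebra.smul_def, ht]
  rw [hpt, map_zero] at h1
  obtain ⟨f, hf⟩ := SetLike.le_def.1 (Algebra.adjoin_range_eq_range_aeval L x).le (p.coeff 0).2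
  have hf' : aeval x f = algebraMap _ T (p.coeff 0) := hf
  rw [← hf'] at h1
  have h3 : π (aeval x f) = aeval (π ∘ x) f := comp_aeval_apply x π f
  have h2 : f = 0 := h ((h1.trans h3).symm.trans (map_zero _).symm)
  apply hp
  apply Subtype.ext
  rw [← hf, h2]; simp

theorem exists_lift_generic {k L Ω : Type} [Field k] [IsAlgClosed k] [Field L] [Field Ω]
    [Algebra k L] [Algebra L Ω] [Algebra k Ω] [IsScalarTower k L Ω] {ι : Type} [Finite ι] {n : ℕ}
    {w : ι → L} {b : Fin n → ι} (hw : range w ⊆ acl k (range (w ∘ b)))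
    (hb : AlgebraicIndependent k (w ∘ b)) :
    ∃ (E : Type) (_ : Field E) (_ : Algebra L E) (W : ι → E),
      IntermediateField.adjoin L (range W) = ⊤ ∧
      ∀ σ : L →ₐ[k] Ω, AlgebraicIndependent L (σ ∘ w ∘ b) →
        ∃ α : E →ₐ[L] Ω, ∀ i, α (W i) = σ (w i) := by
  have hft : Algebra.FiniteType k (Algebra.adjoin k (range w)) :=
    Algebra.FiniteType.adjoin_of_finite (finite_range w)
  have h := isDomain_tensorProduct (M := k) (B := Algebra.adjoin k (range w)) (A := L)
  have hdom : IsDomain (L ⊗[k] Algebra.adjoin k (range w)) :=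
    (Algebra.TensorProduct.comm k (Algebra.adjoin k (range w)) L).symm.toMulEquiv.isDomain
  let wB : ι → Algebra.adjoin k (range w) := fun i => ⟨w i, Algebra.subset_adjoin ⟨i, rfl⟩⟩
  have hgen : Algebra.adjoin L (range fun i => (1 : L) ⊗ₜ[k] wB i) = ⊤ := by
    rw [eq_top_iff]
    rintro t -
    induction t with
    | zero => exact zero_mem _
    | add x y hx hy => exact add_mem hx hy
    | tmul l y =>
      have h1 : l ⊗ₜ[k] y = l • ((1 : L) ⊗ₜ[k] y) := by
        rw [TensorProduct.smul_tmul', smul_eq_mul, mul_one]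
      rw [h1]
      refine Subalgebra.smul_mem _ ?_ l
      clear h1
      obtain ⟨y, hy⟩ := y
      induction hy using Algebra.adjoin_induction with
      | mem x hx =>
        obtain ⟨i, rfl⟩ := hx
        exact Algebra.subset_adjoin ⟨i, rfl⟩
      | algebraMap c =>
        have : (1 : L) ⊗ₜ[k] (⟨algebraMap k L c, Subalgebra.algebraMap_mem _ c⟩ :
            Algebra.adjoin k (range w)) = algebraMap L _ (algebraMap k L c) := by
          rw [← IsScalarTower.algebraMap_apply, Algebra.TensorProduct.algebraMap_apply']
          rfl
        rw [this]
        exact Subalgebra.algebraMap_mem _ _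
      | add x y hx hy h1 h2 =>
        have := add_mem h1 h2
        rwa [← TensorProduct.tmul_add] at this
      | mul x y hx hy h1 h2 =>
        have := mul_mem h1 h2
        rwa [Algebra.TensorProduct.tmul_mul_tmul, one_mul] at this
  have hdep : ∀ y ∈ range (fun i => (1 : L) ⊗ₜ[k] wB i), ¬ AlgebraicIndependent L
      fun o : Option (Fin n) => o.elim y (fun l => (1 : L) ⊗ₜ[k] wB (b l)) := by
    rintro _ ⟨i, rfl⟩ hAI
    have h1 := hAI.restrictScalars (R := k) (algebraMap k L).injective
    have h2 : AlgebraicIndependent k fun o : Option (Fin n) => o.elim (wB i) (wB ∘ b) := by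
      apply AlgebraicIndependent.of_comp
        (Algebra.TensorProduct.includeRight : Algebra.adjoin k (range w) →ₐ[k] L ⊗[k] _)
      convert h1 using 1
      ext o
      cases o <;> rfl
    have h3 := h2.map' (f := (Algebra.adjoin k (range w)).val) Subtype.val_injective
    refine (notMem_acl_range hb (w i)).2 ?_ (hw (mem_range_self i))
    convert h3 using 1
    ext o
    cases o <;> rfl
  obtain ⟨E, i1, i2, i3⟩ : ∃ (E : Type) (_ : Field E)
      (_ : Algebra (L ⊗[k] Algebra.adjoin k (range w)) E),
      IsFractionRing (L ⊗[k] Algebra.adjoin k (range w)) E :=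
    ⟨FractionRing (L ⊗[k] Algebra.adjoin k (range w)), inferInstance, inferInstance, inferInstance⟩
  let i4 : Algebra L E :=
    ((algebraMap (L ⊗[k] Algebra.adjoin k (range w)) E).comp (algebraMap L _)).toAlgebra
  have i5 : IsScalarTower L (L ⊗[k] Algebra.adjoin k (range w)) E :=
    IsScalarTower.of_algebraMap_eq (R := L) (S := L ⊗[k] Algebra.adjoin k (range w)) (A := E)
      fun _ => rfl
  refine ⟨E, i1, i4, fun i => algebraMap _ E ((1 : L) ⊗ₜ[k] wB i), ?_, fun σ hσ => ?_⟩
  · rw [eq_top_iff]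
    have key : ∀ t, algebraMap (L ⊗[k] Algebra.adjoin k (range w)) E t ∈
        IntermediateField.adjoin L (range fun i => algebraMap _ E ((1 : L) ⊗ₜ[k] wB i)) := by
      intro t
      have ht : t ∈ Algebra.adjoin L (range fun i => (1 : L) ⊗ₜ[k] wB i) := hgen ▸ Algebra.mem_top
      induction ht using Algebra.adjoin_induction with
      | mem y hy =>
        obtain ⟨i, rfl⟩ := hy
        exact IntermediateField.subset_adjoin _ _ ⟨i, rfl⟩
      | algebraMap c =>
        rw [← IsScalarTower.algebraMap_apply]
        exact IntermediateField.algebraMap_mem _ _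
      | add _ _ _ _ h1 h2 => rw [map_add]; exact add_mem h1 h2
      | mul _ _ _ _ h1 h2 => rw [map_mul]; exact mul_mem h1 h2
    rintro x -
    obtain ⟨t, s, -, rfl⟩ := IsFractionRing.div_surjective
      (A := L ⊗[k] Algebra.adjoin k (range w)) x
    exact div_mem (key t) (key s)
  · let π : L ⊗[k] Algebra.adjoin k (range w) →ₐ[L] Ω :=
      Algebra.TensorProduct.lift (Algebra.ofId L Ω) (σ.comp (Algebra.adjoin k (range w)).val)
        (fun _ _ => Commute.all _ _)
    have hπ : ∀ i, π ((1 : L) ⊗ₜ[k] wB i) = σ (w i) := by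
      intro i
      simp [π, wB]
    have hinj : Function.Injective π := by
      refine injective_of_algebraicIndependent (fun l => (1 : L) ⊗ₜ[k] wB (b l)) hgen hdep π ?_
      convert hσ using 1
      ext l
      exact hπ _
    refine ⟨IsFractionRing.liftAlgHom hinj, fun i => ?_⟩
    rw [IsFractionRing.liftAlgHom_apply, IsFractionRing.lift_algebraMap]
    exact hπ i
end QuadricBound

namespace QuadricBound
open MvPolynomial Set

section transfer

/-- The substitution eliminating the variables of index `i₀` by means of the linear relations
between two points with the same generic projections. -/
noncomputable def elimSubst {L E : Type*} [Field L] [Field E] [Algebra L E] {n N : ℕ} (i₀ : Fin N)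
    (w : Fin (N + 1) → L) (W : Fin (N + 1) → E) (p : Fin n × Fin N) :
    MvPolynomial (Fin n × {i // i ≠ i₀}) E :=
  if h : p.2 ≠ i₀ then X (p.1, ⟨p.2, h⟩) else
    ∑ i : {i // i ≠ i₀}, C (-((W i.1.succ - algebraMap L E (w i.1.succ)) /
      (W i₀.succ - algebraMap L E (w i₀.succ)))) * X (p.1, i)

variable {L E Ω : Type*} [Field L] [Field E] [Field Ω] [Algebra L E] [Algebra L Ω] {n N : ℕ}

theorem eval₂_elimSubst {a : Fin n × Fin N → Ω} {w : Fin (N + 1) → L} {W : Fin (N + 1) → E}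
    (α : E →ₐ[L] Ω) (hlin : ∀ j, genLin a (α ∘ W) j = genLin a (algebraMap L Ω ∘ w) j)
    {i₀ : Fin N} (hne : α (W i₀.succ) ≠ algebraMap L Ω (w i₀.succ)) (F : MvPolynomial (Fin n × Fin N) E) :
    eval₂Hom (α : E →+* Ω) (fun p : Fin n × {i // i ≠ i₀} => a (p.1, p.2))
      (eval₂Hom C (elimSubst i₀ w W) F) = eval₂Hom (α : E →+* Ω) a F := by
  rw [← RingHom.comp_apply]
  congr 1
  apply MvPolynomial.ringHom_ext
  · intro e
    simp
  · rintro ⟨j, i⟩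
    simp only [RingHom.comp_apply, coe_eval₂Hom, eval₂_X]
    by_cases hi : i = i₀
    · subst hi
      rw [sum_mul_sub_eq_zero (hlin j) hne]
      simp [elimSubst, eval₂_sum, eval₂_mul]
    · simp [elimSubst, hi]

theorem fieldRange_le_acl {W : Fin (N + 1) → E} (hW : IntermediateField.adjoin L (range W) = ⊤)
    (α : E →ₐ[L] Ω) {s : Set Ω} (h : ∀ i, α (W i) ∈ acl L s) (e : E) : α e ∈ acl L s := by
  have he : e ∈ IntermediateField.adjoin L (range W) := hW ▸ IntermediateField.mem_top
  induction he using IntermediateField.adjoin_induction with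
  | mem x hx => obtain ⟨i, rfl⟩ := hx; exact h i
  | algebraMap c => rw [AlgHom.commutes]; exact IntermediateField.algebraMap_mem _ _
  | add x y _ _ hx hy => rw [map_add]; exact add_mem hx hy
  | inv x _ hx => rw [map_inv₀]; exact inv_mem hx
  | mul x y _ _ hx hy => rw [map_mul]; exact mul_mem hx hy

theorem eq_zero_of_eval₂_eq_zero {κ : Type*} (M : IntermediateField L Ω) (α : E →ₐ[L] Ω)
    (hα : ∀ e, α e ∈ M) {y : κ → Ω} (hy : AlgebraicIndependent M y) {G : MvPolynomial κ E}
    (hG : eval₂Hom (α : E →+* Ω) y G = 0) : G = 0 := by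
  let β : E →+* M := (α : E →+* Ω).codRestrict M hα
  have h1 : aeval y (map β G) = 0 := by
    rw [aeval_def, eval₂_map]
    exact hG
  have h2 : map β G = 0 := hy (h1.trans (map_zero _).symm)
  exact map_injective β β.injective (h2.trans (map_zero _).symm)

end transfer

section embeddings
variable {k L Ω : Type} [Field k] [Field L] [Field Ω] [Algebra k L] [Algebra L Ω]
  [Algebra k Ω] [IsScalarTower k L Ω] {n N : ℕ}

theorem range_subset_acl_comp {w : Fin (N + 1) → L} {b : Fin n → Fin (N + 1)}
    (hw : range w ⊆ acl k (range (w ∘ b))) (σ : L →ₐ[k] Ω) :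
    range (σ ∘ w) ⊆ acl L (range ((σ ∘ w) ∘ b)) := by
  rintro _ ⟨i, rfl⟩
  refine map_mem_acl (F := k) (F' := L) (s := range (w ∘ b)) (σ : L →+* Ω) (fun c => ?_) ?_
    (hw (mem_range_self i))
  · rw [RingHom.coe_coe, AlgHom.commutes, IsScalarTower.algebraMap_apply k L Ω]
    exact IntermediateField.algebraMap_mem _ _
  · rintro _ ⟨j, rfl⟩
    exact IntermediateField.subset_adjoin _ _ ⟨j, rfl⟩

theorem algebraicIndependent_of_ne {w : Fin (N + 1) → L} (h0 : w 0 = 1) {b : Fin n → Fin (N + 1)}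
    (hw : range w ⊆ acl k (range (w ∘ b))) {a : Fin n × Fin N → Ω} (ha : AlgebraicIndependent L a)
    (σ : L →ₐ[k] Ω) (hlin : ∀ j, genLin a (σ ∘ w) j = genLin a (algebraMap L Ω ∘ w) j)
    (hne : ∃ i, σ (w i) ≠ algebraMap L Ω (w i)) : AlgebraicIndependent L (σ ∘ w ∘ b) := by
  obtain ⟨i, hi⟩ := hne
  have hi0 : i ≠ 0 := by
    rintro rfl
    simp [h0] at hi
  obtain ⟨i, rfl⟩ := Fin.exists_succ_eq.2 hi0
  have := algebraicIndependent_sumElim_of_genLin_eq ha w (range_subset_acl_comp hw σ) hlin hi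
  exact this.comp Sum.inr Sum.inr_injective

/-- Nontrivial conjugates of the generic point over the field of its generic projections satisfy
the same polynomial relations. -/
theorem aeval_eq_zero_of_genLin_eq [IsAlgClosed k] (hn : 0 < n) {w : Fin (N + 1) → L} (h0 : w 0 = 1)
    (htr : HasTr k w n) {a : Fin n × Fin N → Ω} (ha : AlgebraicIndependent L a) (σ σ' : L →ₐ[k] Ω)
    (hlin : ∀ j, genLin a (σ ∘ w) j = genLin a (algebraMap L Ω ∘ w) j)
    (hlin' : ∀ j, genLin a (σ' ∘ w) j = genLin a (algebraMap L Ω ∘ w) j)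
    (hne : ∃ i, σ (w i) ≠ algebraMap L Ω (w i)) (hne' : ∃ i, σ' (w i) ≠ algebraMap L Ω (w i))
    {P : MvPolynomial (Fin (N + 1)) Ω} (hP : ∀ m, coeff m P ∈ IntermediateField.adjoin L (range a))
    (h : aeval (σ ∘ w) P = 0) : aeval (σ' ∘ w) P = 0 := by
  obtain ⟨b, hb, hw⟩ := htr
  have hAI := algebraicIndependent_of_ne h0 hw ha σ hlin hne
  have hAI' := algebraicIndependent_of_ne h0 hw ha σ' hlin' hne'
  have hb0 : b ⟨0, hn⟩ ≠ 0 := by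
    intro hb0
    have h1 := hb.transcendental ⟨0, hn⟩
    rw [Function.comp_apply, hb0, h0] at h1
    exact h1 isAlgebraic_one
  obtain ⟨i₀, hi₀⟩ := Fin.exists_succ_eq.2 hb0
  have hne₀ : ∀ τ : L →ₐ[k] Ω, AlgebraicIndependent L (τ ∘ w ∘ b) →
      τ (w i₀.succ) ≠ algebraMap L Ω (w i₀.succ) := by
    intro τ hτ heq
    have h1 := hτ.transcendental ⟨0, hn⟩
    simp only [Function.comp_apply] at h1
    rw [← hi₀, heq] at h1
    exact h1 (isAlgebraic_algebraMap _)
  obtain ⟨E, i1, i2, W, hW, hlift⟩ := exists_lift_generic (Ω := Ω) hw hb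
  obtain ⟨α, hα⟩ := hlift σ hAI
  obtain ⟨α', hα'⟩ := hlift σ' hAI'
  have hαW : α ∘ W = σ ∘ w := funext hα
  have hαW' : α' ∘ W = σ' ∘ w := funext hα'
  obtain ⟨D, g, hD, hg⟩ := exists_common_denom a (fun m : P.support => coeff m P) fun m => hP m
  obtain ⟨F, hF⟩ : ∃ F : MvPolynomial (Fin n × Fin N) E,
      F = ∑ m : P.support, map (algebraMap L E) (g m) * C (∏ i, W i ^ (m : Fin (N + 1) →₀ ℕ) i) :=
    ⟨_, rfl⟩
  have hev : ∀ β : E →ₐ[L] Ω, eval₂Hom (β : E →+* Ω) a F = aeval a D * aeval (β ∘ W) P := by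
    intro β
    have h1 : aeval (β ∘ W) P = ∑ m : P.support,
        coeff m P * ∏ i, β (W i) ^ (m : Fin (N + 1) →₀ ℕ) i := by
      rw [aeval_def, eval₂_eq', ← Finset.sum_coe_sort]
      rfl
    rw [h1, hF, map_sum, Finset.mul_sum]
    refine Finset.sum_congr rfl fun m _ => ?_
    have h2 : eval₂Hom (β : E →+* Ω) a (map (algebraMap L E) (g m)) = aeval a (g m) := by
      rw [coe_eval₂Hom, eval₂_map, aeval_def]
      congr 1
      ext c
      simp
    rw [map_mul, h2, hg, coe_eval₂Hom, eval₂_C, RingHom.coe_coe, map_prod, mul_assoc]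
    simp
  have hG : eval₂Hom C (elimSubst i₀ w W) F = 0 := by
    refine eq_zero_of_eval₂_eq_zero (acl L (range ((σ ∘ w) ∘ b))) α
      (fieldRange_le_acl hW α fun i => ?_) (y := fun p : Fin n × {i // i ≠ i₀} => a (p.1, p.2)) ?_ ?_
    · rw [hα]
      exact range_subset_acl_comp hw σ ⟨i, rfl⟩
    · exact algebraicIndependent_acl (algebraicIndependent_sumElim_of_genLin_eq ha w
        (range_subset_acl_comp hw σ) hlin (hne₀ σ hAI))
    · rw [eval₂_elimSubst α (by rwa [hαW]) (by rw [hα]; exact hne₀ σ hAI), hev, hαW, h, mul_zero]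
  have h3 := eval₂_elimSubst (a := a) (w := w) (i₀ := i₀) α' (by rwa [hαW'])
    (by rw [hα']; exact hne₀ σ' hAI') F
  rw [hG, map_zero, hev, hαW'] at h3
  exact (mul_eq_zero.1 h3.symm).resolve_left hD

end embeddings

section primitive

theorem exists_algHom_ne {F E : Type*} [Field F] [Field E] [Algebra F E] [CharZero F]
    [Algebra.IsAlgebraic F E] {x : E} (hx : x ∉ (algebraMap F E).range) :
    ∃ τ : E →ₐ[F] AlgebraicClosure E, τ x ≠ algebraMap E (AlgebraicClosure E) x := by
  by_contra! h
  have hx_int : IsIntegral F x := (Algebra.IsAlgebraic.isAlgebraic x).isIntegral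
  have h1 := Algebra.IsAlgebraic.range_eval_eq_rootSet_minpoly (F := F) (K := E)
    (AlgebraicClosure E) x
  have h2 : (minpoly F x).rootSet (AlgebraicClosure E) ⊆ {algebraMap E (AlgebraicClosure E) x} := by
    rw [← h1]
    rintro _ ⟨τ, rfl⟩
    exact h τ
  have h3 := Polynomial.card_rootSet_eq_natDegree (K := AlgebraicClosure E)
    (minpoly.irreducible hx_int).separable (IsAlgClosed.splits _)
  have h4 : (minpoly F x).natDegree = 1 := by
    refine le_antisymm ?_ (minpoly.natDegree_pos hx_int)
    rw [← h3, ← Nat.card_eq_fintype_card, Nat.card_coe_set_eq]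
    exact (ncard_le_ncard h2).trans (ncard_singleton _).le
  exact hx (minpoly.natDegree_eq_one_iff.1 h4)

/-- The extension attached to a generic projection of a variety of positive dimension has no
proper intermediate fields. -/
theorem eq_bot_or_eq_top_of_genCoeff {k L L' : Type} [Field k] [IsAlgClosed k] [CharZero k]
    [Field L] [Field L'] [Algebra k L] [Algebra L L'] [Algebra k L'] [IsScalarTower k L L'] {n N : ℕ}
    (hn : 0 < n) {w : Fin (N + 1) → L} (h0 : w 0 = 1) (htr : HasTr k w n)
    {a : Fin n × Fin N → L'} (ha : AlgebraicIndependent L a)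
    (htop : IntermediateField.adjoin L (range a) = ⊤) (K : IntermediateField k L')
    (hK : K = IntermediateField.adjoin k (range (genCoeff a (algebraMap L L' ∘ w))))
    (halg : Algebra.IsAlgebraic K L') (hgen : Algebra.adjoin K (range (algebraMap L L' ∘ w)) = ⊤)
    (M : IntermediateField K L') : M = ⊥ ∨ M = ⊤ := by
  by_contra! hM
  obtain ⟨m, hmM, hmK⟩ : ∃ m ∈ M, m ∉ (⊥ : IntermediateField K L') :=
    SetLike.not_le_iff_exists.1 fun h => hM.1 (le_bot_iff.1 h)
  obtain ⟨x, -, hx⟩ : ∃ x ∈ (⊤ : IntermediateField K L'), x ∉ M :=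
    SetLike.not_le_iff_exists.1 fun h => hM.2 (top_le_iff.1 h)
  have hK0 : CharZero K := charZero_of_injective_algebraMap (algebraMap k K).injective
  have hM0 : CharZero M := charZero_of_injective_algebraMap (algebraMap K M).injective
  obtain ⟨τ₀, hτ₀⟩ := exists_algHom_ne (F := M) (x := x) (by
    rintro ⟨y, rfl⟩
    exact hx y.2)
  obtain ⟨τ', hτ'⟩ := exists_algHom_ne (F := K) (x := m) (by
    rwa [IntermediateField.mem_bot] at hmK)
  obtain ⟨τ, hτ⟩ : ∃ τ : L' →ₐ[K] AlgebraicClosure L', ∀ y, τ y = τ₀ y :=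
    ⟨{ (τ₀ : L' →+* AlgebraicClosure L') with
      commutes' := fun c => τ₀.commutes ⟨algebraMap K L' c, M.algebraMap_mem c⟩ }, fun _ => rfl⟩
  have hτm : τ m = algebraMap L' (AlgebraicClosure L') m := by
    rw [hτ]
    exact τ₀.commutes ⟨m, hmM⟩
  have hne : ∀ (τ : L' →ₐ[K] AlgebraicClosure L') (y : L'),
      τ y ≠ algebraMap L' (AlgebraicClosure L') y →
      ∃ i, τ (algebraMap L L' (w i)) ≠ algebraMap L' _ (algebraMap L L' (w i)) := by
    intro τ y hy
    by_contra! h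
    have h1 : τ = IsScalarTower.toAlgHom K L' (AlgebraicClosure L') :=
      AlgHom.ext_of_adjoin_eq_top hgen (by rintro _ ⟨i, rfl⟩; exact h i)
    exact hy (by rw [h1]; rfl)
  have hfix : ∀ (τ : L' →ₐ[K] AlgebraicClosure L') p, τ (genCoeff a (algebraMap L L' ∘ w) p) =
      algebraMap L' _ (genCoeff a (algebraMap L L' ∘ w) p) := by
    intro τ p
    exact τ.commutes ⟨_, hK ▸ IntermediateField.subset_adjoin k _ ⟨p, rfl⟩⟩
  have hlin : ∀ (τ : L' →ₐ[K] AlgebraicClosure L') j,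
      genLin (algebraMap L' (AlgebraicClosure L') ∘ a) (fun i => τ (algebraMap L L' (w i))) j =
      genLin (algebraMap L' (AlgebraicClosure L') ∘ a)
        (algebraMap L (AlgebraicClosure L') ∘ w) j := by
    intro τ j
    have h1 : τ (genLin a (algebraMap L L' ∘ w) j) =
      algebraMap L' _ (genLin a (algebraMap L L' ∘ w) j) := hfix τ (j, 0)
    have h2 : ∀ i, τ (a (j, i)) = algebraMap L' _ (a (j, i)) := fun i => hfix τ (j, i.succ)
    simp only [genLin, Function.comp_apply, map_neg, map_sum, map_mul, h2] at h1 ⊢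
    exact h1
  have ha' : AlgebraicIndependent L (algebraMap L' (AlgebraicClosure L') ∘ a) :=
    ha.map' (f := IsScalarTower.toAlgHom L L' (AlgebraicClosure L'))
      (algebraMap L' (AlgebraicClosure L')).injective
  obtain ⟨R, hR⟩ : ∃ R : MvPolynomial (Fin (N + 1)) K, aeval (algebraMap L L' ∘ w) R = m := by
    have hm : m ∈ Algebra.adjoin K (range (algebraMap L L' ∘ w)) := hgen ▸ Algebra.mem_top
    rw [Algebra.adjoin_range_eq_range_aeval] at hm
    exact hm
  have hmem : ∀ y : L', algebraMap L' (AlgebraicClosure L') y ∈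
      IntermediateField.adjoin L (range (algebraMap L' (AlgebraicClosure L') ∘ a)) := by
    intro y
    have hy : y ∈ IntermediateField.adjoin L (range a) := htop ▸ IntermediateField.mem_top
    have h1 : algebraMap L' (AlgebraicClosure L') y ∈ (IntermediateField.adjoin L (range a)).map
      (IsScalarTower.toAlgHom L L' (AlgebraicClosure L')) := ⟨y, hy, rfl⟩
    rw [IntermediateField.adjoin_map, ← range_comp] at h1
    exact h1
  have hev : ∀ τ : L' →ₐ[K] AlgebraicClosure L',
      aeval (fun i => τ (algebraMap L L' (w i))) (map (algebraMap L' (AlgebraicClosure L'))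
        (map (algebraMap K L') R - C m)) = τ m - algebraMap L' (AlgebraicClosure L') m := by
    intro τ
    rw [map_sub, map_sub, map_C, aeval_C, map_map, ← hR]
    rw [← IsScalarTower.algebraMap_eq, aeval_map_algebraMap]
    congr 1
    exact (comp_aeval_apply _ τ R).symm
  have htower : IsScalarTower k L (AlgebraicClosure L') := inferInstance
  let res : (L' →ₐ[K] AlgebraicClosure L') → (L →ₐ[k] AlgebraicClosure L') := fun τ =>
    (τ.restrictScalars k).comp (IsScalarTower.toAlgHom k L L')
  have key := aeval_eq_zero_of_genLin_eq hn h0 htr ha' (res τ) (res τ') (hlin τ) (hlin τ')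
    (hne τ x (by rwa [hτ])) (hne τ' m hτ')
    (P := map (algebraMap L' (AlgebraicClosure L')) (map (algebraMap K L') R - C m))
    (fun d => by rw [coeff_map]; exact hmem _)
    ((hev τ).trans (by rw [hτm, sub_self]))
  exact hτ' (sub_eq_zero.1 ((hev τ').symm.trans key))

end primitive
end QuadricBound

namespace QuadricBound
open Module Set
open scoped Pointwise

section reduction
variable {F A : Type*} [CommRing F] [CommRing A] [Algebra F A]

theorem prod_mem_pow_card {ι : Type*} {W : Submodule F A} {f : ι → A} (s : Finset ι)
    (h : ∀ i ∈ s, f i ∈ W) : ∏ i ∈ s, f i ∈ W ^ s.card := by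
  classical
  induction s using Finset.induction with
  | empty => simpa using ⟨1, map_one (algebraMap F A)⟩
  | insert i s hi ih =>
    rw [Finset.prod_insert hi, Finset.card_insert_of_notMem hi, pow_succ']
    exact Submodule.mul_mem_mul (h i (Finset.mem_insert_self _ _))
      (ih fun j hj => h j (Finset.mem_insert_of_mem hj))

theorem pow_succ_le_mul_pow {N D : ℕ} {Z : Submodule F A} {w : Fin (N + 1) → A}
    (h : ∀ i, w i ^ (D + 1) ∈ Z * Submodule.span F (range w) ^ D) {M : ℕ} (hM : (N + 1) * D ≤ M) :
    Submodule.span F (range w) ^ (M + 1) ≤ Z * Submodule.span F (range w) ^ M := by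
  classical
  set W := Submodule.span F (range w) with hW
  conv_lhs => rw [hW, Submodule.span_pow]
  rw [Submodule.span_le]
  intro x hx
  obtain ⟨f, rfl⟩ := Set.mem_pow.1 hx
  have hf : ∀ j, ∃ i, w i = f j := fun j => (f j).2
  choose g hg using hf
  obtain ⟨i, hi⟩ := Fintype.exists_lt_card_fiber_of_mul_lt_card (f := g) (n := D) (by simpa using by omega)
  obtain ⟨T, hT, hTc⟩ := Finset.exists_subset_card_eq (Nat.succ_le_of_lt hi)
  have h1 : ((List.ofFn fun j => (f j : A)).prod) = (∏ j ∈ T, (f j : A)) * ∏ j ∈ Tᶜ, (f j : A) := by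
    rw [List.prod_ofFn, Finset.prod_mul_prod_compl]
  have h2 : ∏ j ∈ T, (f j : A) = w i ^ (D + 1) := by
    have h : ∏ j ∈ T, (f j : A) = ∏ j ∈ T, w i := Finset.prod_congr rfl fun j hj => by
      rw [← hg, (Finset.mem_filter.1 (hT hj)).2]
    rw [h, Finset.prod_const, hTc]
  have h3 : ∏ j ∈ Tᶜ, (f j : A) ∈ W ^ Tᶜ.card :=
    prod_mem_pow_card _ fun j _ => Submodule.subset_span (f j).2
  have h4 : Tᶜ.card + D = M := by
    rw [Finset.card_compl, Fintype.card_fin, hTc]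
    have := Finset.card_le_univ T
    rw [hTc, Fintype.card_fin] at this
    omega
  have h5 := Submodule.mul_mem_mul (h i) h3
  rw [mul_assoc, ← pow_add, add_comm D, h4] at h5
  change (List.ofFn fun j => (f j : A)).prod ∈ _
  rw [h1, h2]
  exact h5

theorem pow_add_le_pow_mul_pow {Z W : Submodule F A} {M : ℕ} (h : ∀ r ≥ M, W ^ (r + 1) ≤ Z * W ^ r)
    (m : ℕ) : W ^ (M + m) ≤ Z ^ m * W ^ M := by
  induction m with
  | zero => simp
  | succ m ih =>
    calc W ^ (M + (m + 1)) ≤ Z * W ^ (M + m) := h (M + m) (by omega)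
      _ ≤ Z * (Z ^ m * W ^ M) := mul_le_mul' le_rfl ih
      _ = Z ^ (m + 1) * W ^ M := by rw [pow_succ', mul_assoc]

theorem finrank_pow_le [Nontrivial F] [StrongRankCondition F] {n : ℕ} (z : Fin (n + 1) → A) (r : ℕ) :
    finrank F ↥(Submodule.span F (range z) ^ r) ≤ (r + n).choose n := by
  classical
  have h1 : (range z) ^ r ⊆ range fun s : Sym (Fin (n + 1)) r => ((s : Multiset _).map z).prod := by
    intro x hx
    obtain ⟨f, rfl⟩ := Set.mem_pow.1 hx
    have hf : ∀ j, ∃ i, z i = f j := fun j => (f j).2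
    choose g hg using hf
    refine ⟨⟨(Finset.univ.val.map g), by simp⟩, ?_⟩
    simp only [Sym.coe_mk, Multiset.map_map, Function.comp_def, hg]
    rw [List.prod_ofFn]
    rfl
  have hsub : ∃ t : Finset A, (range z) ^ r = t ∧ t.card ≤ (r + n).choose n := by
    have hfin := (finite_range fun s : Sym (Fin (n + 1)) r => ((s : Multiset _).map z).prod)
    refine ⟨(hfin.subset h1).toFinset, by simp, ?_⟩
    rw [← ncard_eq_toFinset_card _ (hfin.subset h1)]
    refine (ncard_le_ncard h1 hfin).trans ?_
    rw [← image_univ]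
    refine (ncard_image_le finite_univ).trans ?_
    rw [ncard_univ, Nat.card_eq_fintype_card, Sym.card_sym_eq_multichoose, Fintype.card_fin,
      Nat.multichoose_eq]
    rw [show n + 1 + r - 1 = r + n by omega, ← Nat.choose_symm_add]
  obtain ⟨t, ht, htc⟩ := hsub
  rw [Submodule.span_pow, ht]
  exact (finrank_span_finset_le_card t).trans htc

end reduction

section denominators
variable {F Ω : Type*} [Field F] [Field Ω] [Algebra F Ω]

theorem exists_denominator {Z : Submodule F Ω} {ι : Type*} (x : ι → Ω)
    (hx : ∀ i, ∃ r, ∃ s ∈ Z ^ r, s ≠ 0 ∧ s * x i ∈ Z ^ r) (T : Finset ι) :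
    ∃ r, ∃ h ∈ Z ^ r, h ≠ 0 ∧ ∀ i ∈ T, h * x i ∈ Z ^ r := by
  classical
  induction T using Finset.induction with
  | empty => exact ⟨0, 1, by simp, one_ne_zero, by simp⟩
  | insert i T hi ih =>
    obtain ⟨r, h, hr, h0, hT⟩ := ih
    obtain ⟨r', s, hs, hs0, hsx⟩ := hx i
    refine ⟨r + r', h * s, ?_, mul_ne_zero h0 hs0, fun j hj => ?_⟩
    · rw [pow_add]; exact Submodule.mul_mem_mul hr hs
    · rw [pow_add]
      rcases Finset.mem_insert.1 hj with rfl | hj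
      · rw [mul_assoc]; exact Submodule.mul_mem_mul hr hsx
      · rw [mul_right_comm]; exact Submodule.mul_mem_mul (hT j hj) hs

theorem exists_finrank_pow_mul_le {E : Type*} [Field E] [Algebra E Ω] [FiniteDimensional E Ω]
    {Z : Submodule F Ω} [FiniteDimensional F Z]
    (hE : ∀ x : E, ∃ r, ∃ s ∈ Z ^ r, s ≠ 0 ∧ s * algebraMap E Ω x ∈ Z ^ r) (U : Submodule F Ω)
    [FiniteDimensional F U] :
    ∃ c, ∀ m, finrank F ↥(Z ^ m * U) ≤ finrank E Ω * finrank F ↥(Z ^ (m + c)) := by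
  classical
  let β := finBasis E Ω
  let u := finBasis F U
  obtain ⟨r, h, -, h0, hh⟩ := exists_denominator (Z := Z)
    (fun p : Fin (finrank F U) × Fin (finrank E Ω) => algebraMap E Ω (β.repr (u p.1) p.2))
    (fun p => hE _) Finset.univ
  refine ⟨r, fun m => ?_⟩
  have hfd : ∀ j, FiniteDimensional F ↥(Z ^ j) := fun j => by
    rw [FiniteDimensional, Module.Finite.iff_fg]
    exact (Module.Finite.iff_fg.1 inferInstance).pow j
  let φ : (Fin (finrank E Ω) → ↥(Z ^ (m + r))) →ₗ[F] Ω :=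
    ∑ l, (LinearMap.mulRight F (β l)).comp ((Z ^ (m + r)).subtype.comp (LinearMap.proj l))
  have hφ : ∀ v, φ v = ∑ l, (v l : Ω) * β l := fun v => by
    simp [φ]
  have hle : (Z ^ m * U).map (LinearMap.mulLeft F h) ≤ LinearMap.range φ := by
    rw [Submodule.map_le_iff_le_comap, Submodule.mul_le]
    intro y hy x hx
    have hx' : x ∈ Submodule.span F (range fun i => (u i : Ω)) := by
      have h2 := congrArg (Submodule.map U.subtype) u.span_eq
      rw [Submodule.map_span, Submodule.map_top, Submodule.range_subtype, ← range_comp] at h2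
      rw [← h2] at hx
      exact hx
    induction hx' using Submodule.span_induction with
    | mem x hx' =>
      obtain ⟨i, rfl⟩ := hx'
      refine ⟨fun l => ⟨y * (h * algebraMap E Ω (β.repr (u i) l)), ?_⟩, ?_⟩
      · rw [pow_add]
        exact Submodule.mul_mem_mul hy (hh (i, l) (Finset.mem_univ _))
      · rw [hφ, LinearMap.mulLeft_apply]
        change _ = h * (y * (u i : Ω))
        conv_rhs => rw [← β.sum_repr (u i)]
        rw [Finset.mul_sum, Finset.mul_sum]
        refine Finset.sum_congr rfl fun l _ => ?_
        rw [Algebra.smul_def]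
        ring
    | zero => simp
    | add x z hx₁ hz₁ h₁ h₂ =>
      have hxm : x ∈ U := (Submodule.span_le.2 (by rintro _ ⟨i, rfl⟩; exact (u i).2)) hx₁
      have hzm : z ∈ U := (Submodule.span_le.2 (by rintro _ ⟨i, rfl⟩; exact (u i).2)) hz₁
      rw [mul_add]
      exact add_mem (h₁ hxm) (h₂ hzm)
    | smul c x hx₁ h₁ =>
      have hxm : x ∈ U := (Submodule.span_le.2 (by rintro _ ⟨i, rfl⟩; exact (u i).2)) hx₁
      rw [mul_smul_comm]
      exact Submodule.smul_mem _ c (h₁ hxm)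
  have hinj : Function.Injective (LinearMap.mulLeft F h) := fun x y hxy => mul_left_cancel₀ h0 hxy
  rw [(Submodule.equivMapOfInjective _ hinj (Z ^ m * U)).finrank_eq]
  refine (Submodule.finrank_mono hle).trans ((LinearMap.finrank_range_le φ).trans ?_)
  rw [finrank_pi_fintype]
  simp

end denominators

section main

theorem exists_mem_pow_of_mem_adjoin {F Ω : Type*} [Field F] [Field Ω] [Algebra F Ω]
    {Z : Submodule F Ω} (h1 : (1 : Ω) ∈ Z) {s : Set Ω} (hs : s ⊆ Z) {x : Ω}
    (hx : x ∈ Algebra.adjoin F s) : ∃ r, x ∈ Z ^ r := by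
  have hmono : ∀ {r r'}, r ≤ r' → Z ^ r ≤ Z ^ r' := fun h =>
    pow_le_pow_right' (Submodule.one_le.2 h1) h
  induction hx using Algebra.adjoin_induction with
  | mem x hx => exact ⟨1, by rw [pow_one]; exact hs hx⟩
  | algebraMap c => exact ⟨0, by rw [pow_zero]; exact Submodule.algebraMap_mem c⟩
  | add x y _ _ hx hy =>
    obtain ⟨r, hr⟩ := hx
    obtain ⟨r', hr'⟩ := hy
    exact ⟨r + r', add_mem (hmono (by omega) hr) (hmono (by omega) hr')⟩
  | mul x y _ _ hx hy =>
    obtain ⟨r, hr⟩ := hx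
    obtain ⟨r', hr'⟩ := hy
    exact ⟨r + r', by rw [pow_add]; exact Submodule.mul_mem_mul hr hr'⟩

theorem span_image_span_pow {F k L Ω : Type*} [Field k] [Field L] [Field F] [Field Ω] [Algebra k L]
    [Algebra k F] [Algebra F Ω] [Algebra k Ω] [Algebra L Ω] [IsScalarTower k F Ω]
    [IsScalarTower k L Ω] (s : Set L) (r : ℕ) :
    Submodule.span F (algebraMap L Ω '' (Submodule.span k s ^ r : Submodule k L)) =
      Submodule.span F (algebraMap L Ω '' s) ^ r := by
  rw [Submodule.span_pow, Submodule.span_pow, ← image_pow]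
  refine le_antisymm ?_ (Submodule.span_mono (image_mono Submodule.subset_span))
  rw [Submodule.span_le]
  rintro _ ⟨x, hx, rfl⟩
  have h1 : (IsScalarTower.toAlgHom k L Ω) x ∈
      (Submodule.span k (s ^ r)).map (IsScalarTower.toAlgHom k L Ω).toLinearMap := ⟨x, hx, rfl⟩
  rw [Submodule.map_span] at h1
  exact Submodule.span_le_restrictScalars k F _ h1

/-- The Hilbert function is bounded by the degree of a generic projection times the Hilbert
function of projective space. -/
theorem exists_finrank_pow_le {k L L' : Type*} [Field k] [Field L] [Field L'] [Algebra k L]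
    [Algebra L L'] [Algebra k L'] [IsScalarTower k L L'] {n N : ℕ} {w : Fin (N + 1) → L}
    (h0 : w 0 = 1) (htr : HasTr k w n) {a : Fin n × Fin N → L'} (ha : AlgebraicIndependent L a)
    (K : IntermediateField k L')
    (hK : K = IntermediateField.adjoin k (range (genCoeff a (algebraMap L L' ∘ w))))
    [FiniteDimensional K L'] :
    ∃ M, ∀ m ≥ M, finrank k ↥(Submodule.span k (range w) ^ m) ≤
      finrank K L' * (m + M + n).choose n := by
  classical
  obtain ⟨F, hF⟩ : ∃ F, F = IntermediateField.adjoin k (range a) := ⟨_, rfl⟩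
  have hfin : FiniteDimensional k (Submodule.span k (range w)) :=
    FiniteDimensional.span_of_finite k (finite_range _)
  have hfinpow : ∀ m, FiniteDimensional k ↥(Submodule.span k (range w) ^ m) := fun m => by
    rw [FiniteDimensional, Module.Finite.iff_fg]
    exact (Module.Finite.iff_fg.1 hfin).pow m
  have hrank := fun m => finrank_span_adjoin ha (Submodule.span k (range w) ^ m)
  rw [← hF] at hrank
  obtain ⟨W, hW⟩ : ∃ W, W = Submodule.span F (range (algebraMap L L' ∘ w)) := ⟨_, rfl⟩
  obtain ⟨Z, hZ⟩ : ∃ Z, Z = Submodule.span F (insert 1 (range (genLin a (algebraMap L L' ∘ w)))) :=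
    ⟨_, rfl⟩
  have haF : ∀ p, a p ∈ F := fun p => hF ▸ IntermediateField.subset_adjoin k _ ⟨p, rfl⟩
  have hwW : ∀ i, algebraMap L L' (w i) ∈ W := fun i => hW ▸ Submodule.subset_span ⟨i, rfl⟩
  have h1W : (1 : L') ∈ W := by
    have := hwW 0
    rwa [h0, map_one] at this
  have hZW : Z ≤ W := by
    rw [hZ, Submodule.span_le]
    rintro x (rfl | ⟨j, rfl⟩)
    · exact h1W
    · refine neg_mem (sum_mem fun i _ => ?_)
      exact Submodule.smul_mem W (⟨a (j, i), haF _⟩ : F) (hwW i.succ)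
  have h1Z : (1 : L') ∈ Z := hZ ▸ Submodule.subset_span (mem_insert _ _)
  have hD : ∃ D, ∀ i, (algebraMap L L' (w i)) ^ (D + 1) ∈ Z * W ^ D := by
    have hmono : ∀ {x : L'} {d D : ℕ}, x ∈ W → d ≤ D → x ^ (d + 1) ∈ Z * W ^ d →
        x ^ (D + 1) ∈ Z * W ^ D := by
      intro x d D hx hd h
      obtain ⟨c, rfl⟩ := Nat.exists_eq_add_of_le hd
      have := Submodule.mul_mem_mul h (Submodule.pow_mem_pow W hx c)
      rw [mul_assoc, ← pow_add, ← pow_add] at this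
      rwa [show d + c + 1 = d + 1 + c by ring]
    have hi : ∀ i, ∃ D, (algebraMap L L' (w i)) ^ (D + 1) ∈ Z * W ^ D := by
      intro i
      refine Fin.cases ⟨0, ?_⟩ (fun i => ?_) i
      · simpa [h0] using h1Z
      · obtain ⟨D, hD⟩ := exists_pow_mem_genLin htr ha i
        rw [← hF, ← hZ] at hD
        refine ⟨D, mul_le_mul' le_rfl (pow_le_pow_left' (sup_le hZW ?_) D) hD⟩
        rw [Submodule.span_singleton_le_iff_mem]
        exact hwW _
    choose D hD using hi
    exact ⟨Finset.univ.sup D, fun i =>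
      hmono (hwW i) (Finset.le_sup (f := D) (Finset.mem_univ i)) (hD i)⟩
  obtain ⟨D, hD⟩ := hD
  obtain ⟨M, hM⟩ : ∃ M, M = (N + 1) * D := ⟨_, rfl⟩
  have hpow : ∀ m, W ^ (M + m) ≤ Z ^ m * W ^ M := pow_add_le_pow_mul_pow fun r hr => by
    have := pow_succ_le_mul_pow (w := algebraMap L L' ∘ w) (Z := Z) (D := D) (F := F)
      (by rw [← hW]; exact hD) (M := r) (by omega)
    rwa [← hW] at this
  have hZz : Z = Submodule.span F
      (range (Fin.cons 1 (genLin a (algebraMap L L' ∘ w)) : Fin (n + 1) → L')) := by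
    rw [hZ, Fin.range_cons]
  have hfdZ : FiniteDimensional F Z := hZz ▸ FiniteDimensional.span_of_finite F (finite_range _)
  have hfdW : FiniteDimensional F W := hW ▸ FiniteDimensional.span_of_finite F (finite_range _)
  have hfdWM : ∀ m, FiniteDimensional F ↥(W ^ m) := fun m => by
    rw [FiniteDimensional, Module.Finite.iff_fg]
    exact (Module.Finite.iff_fg.1 hfdW).pow m
  have hfdZW : ∀ m, FiniteDimensional F ↥(Z ^ m * W ^ M) := fun m => by
    rw [FiniteDimensional, Module.Finite.iff_fg]
    exact ((Module.Finite.iff_fg.1 hfdZ).pow m).mul ((Module.Finite.iff_fg.1 hfdW).pow M)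
  have hEK : ∀ x : K, ∃ r, ∃ s ∈ Z ^ r, s ≠ 0 ∧ s * algebraMap K L' x ∈ Z ^ r := by
    rintro ⟨x, hx⟩
    have hx' : x ∈ IntermediateField.adjoin F (range (genLin a (algebraMap L L' ∘ w))) := by
      rw [hK, range_genCoeff, ← IntermediateField.adjoin_adjoin_left, ← hF] at hx
      exact hx
    obtain ⟨p, hp, q, hq, rfl⟩ := IntermediateField.mem_adjoin_iff_div.1 hx'
    have hgZ : range (genLin a (algebraMap L L' ∘ w)) ⊆ Z := fun y hy =>
      hZ ▸ Submodule.subset_span (mem_insert_of_mem _ hy)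
    by_cases hq0 : q = 0
    · exact ⟨0, 1, by simp, one_ne_zero, by
        change 1 * (p / q) ∈ _
        rw [hq0, div_zero, mul_zero]; exact zero_mem _⟩
    obtain ⟨r, hr⟩ := exists_mem_pow_of_mem_adjoin h1Z hgZ hp
    obtain ⟨r', hr'⟩ := exists_mem_pow_of_mem_adjoin h1Z hgZ hq
    have hmono : ∀ {r r'}, r ≤ r' → Z ^ r ≤ Z ^ r' := fun h =>
      pow_le_pow_right' (Submodule.one_le.2 h1Z) h
    refine ⟨r + r', q, hmono (by omega) hr', hq0, ?_⟩
    change q * (p / q) ∈ _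
    rw [mul_div_cancel₀ _ hq0]
    exact hmono (by omega) hr
  obtain ⟨c, hc⟩ := exists_finrank_pow_mul_le (E := K) hEK (W ^ M)
  refine ⟨M + c, fun m hm => ?_⟩
  obtain ⟨m, rfl⟩ := Nat.exists_eq_add_of_le ((Nat.le_add_right M c).trans hm)
  rw [← hrank, span_image_span_pow, ← range_comp, ← hW]
  refine (Submodule.finrank_mono (hpow m)).trans ((hc m).trans (Nat.mul_le_mul_left _ ?_))
  rw [hZz]
  exact (finrank_pow_le _ _).trans (Nat.choose_le_choose _ (by omega))

end main
end QuadricBound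

namespace QuadricBound
open Module Set

/-- Fields of transcendence degree zero over an algebraically closed field are trivial. -/
theorem finrank_eq_one_of_hasTr_zero {k L : Type*} [Field k] [IsAlgClosed k] [Field L] [Algebra k L]
    {ι : Type*} {w : ι → L} (htr : HasTr k w 0) (htop : IntermediateField.adjoin k (range w) = ⊤) :
    finrank k L = 1 := by
  obtain ⟨b, -, hb⟩ := htr
  have h1 : IntermediateField.adjoin k (range w) ≤ acl k (range (w ∘ b)) :=
    IntermediateField.adjoin_le_iff.2 hb
  rw [htop] at h1
  have h2 : Algebra.IsAlgebraic k L := ⟨fun x => by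
    have h3 := mem_acl.1 (h1 (IntermediateField.mem_top (x := x)))
    rw [range_eq_empty, IntermediateField.adjoin_empty] at h3
    exact h3.restrictScalars k⟩
  have h3 := IsAlgClosed.algebraMap_bijective_of_isIntegral (k := k) (K := L)
  rw [finrank_eq_one_iff_of_nonzero' (1 : L) one_ne_zero]
  intro x
  obtain ⟨y, rfl⟩ := h3.2 x
  exact ⟨y, by rw [Algebra.smul_def, mul_one]⟩

theorem add_min_le_finrank_mul_self {K E : Type*} [Field K] [Field E] [Algebra K E] [FiniteDimensional K E]
    (hK : ∀ M : IntermediateField K E, M = ⊥ ∨ M = ⊤) (V : Submodule K E) (hV : (1 : E) ∈ V)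
    {c : ℕ} (hc : c + 1 ≤ finrank K V) :
    c + 1 + min (finrank K E - (c + 1)) c ≤ finrank K ↥(V * V) := by
  have hle := Submodule.finrank_le V
  rcases finrank_mul_of_forall_eq_bot_or_eq_top hK V V hV
    (fun h => one_ne_zero ((Submodule.mem_bot K).1 (h ▸ hV))) with h | h
  · rw [h, finrank_top]
    omega
  · omega

theorem exists_generic_extension (L : Type) [Field L] (κ : Type) :
    ∃ (L' : Type) (_ : Field L') (_ : Algebra L L') (a : κ → L'),
      AlgebraicIndependent L a ∧ IntermediateField.adjoin L (range a) = ⊤ := by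
  refine ⟨FractionRing (MvPolynomial κ L), inferInstance, inferInstance,
    algebraMap (MvPolynomial κ L) (FractionRing (MvPolynomial κ L)) ∘ MvPolynomial.X, ?_, ?_⟩
  · exact (MvPolynomial.algebraicIndependent_X κ L).map'
      (f := IsScalarTower.toAlgHom L (MvPolynomial κ L) (FractionRing (MvPolynomial κ L)))
      (IsFractionRing.injective _ _)
  · rw [eq_top_iff]
    rintro x -
    obtain ⟨p, q, -, rfl⟩ := IsFractionRing.div_surjective (A := MvPolynomial κ L) x
    have h : ∀ p : MvPolynomial κ L,
        algebraMap (MvPolynomial κ L) (FractionRing (MvPolynomial κ L)) p ∈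
          IntermediateField.adjoin L
            (range (algebraMap (MvPolynomial κ L) (FractionRing (MvPolynomial κ L)) ∘
              MvPolynomial.X)) := by
      intro p
      induction p using MvPolynomial.induction_on with
      | C c => exact IntermediateField.algebraMap_mem _ c
      | add p q hp hq => rw [map_add]; exact add_mem hp hq
      | mul_X p i hp =>
        rw [map_mul]
        exact mul_mem hp (IntermediateField.subset_adjoin _ _ ⟨i, rfl⟩)
    exact div_mem (h p) (h q)

/-- A field containing the generators of both steps of a tower is everything. -/
theorem mem_of_adjoin_eq_top {k L L' : Type*} [Field k] [Field L] [Field L'] [Algebra k L]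
    [Algebra L L'] [Algebra k L'] [IsScalarTower k L L'] {s : Set L} {t : Set L'}
    (hs : IntermediateField.adjoin k s = ⊤) (ht : IntermediateField.adjoin L t = ⊤)
    (E : IntermediateField k L') (hsE : ∀ x ∈ s, algebraMap L L' x ∈ E) (htE : t ⊆ E) (x : L') :
    x ∈ E := by
  have h1 : IntermediateField.adjoin k s ≤ E.comap (IsScalarTower.toAlgHom k L L') :=
    IntermediateField.adjoin_le_iff.2 hsE
  have hx : x ∈ IntermediateField.adjoin L t := ht ▸ IntermediateField.mem_top
  induction hx using IntermediateField.adjoin_induction with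
  | mem x hx => exact htE hx
  | algebraMap y => exact h1 (hs ▸ IntermediateField.mem_top (x := y))
  | add x y _ _ hx hy => exact add_mem hx hy
  | inv x _ hx => exact inv_mem hx
  | mul x y _ _ hx hy => exact mul_mem hx hy

/-- The field-theoretic form of the bound: the space of quadratic forms in `w` is large compared to
the degree `e` of a generic projection, and `e` bounds the growth of the Hilbert function. -/
theorem exists_degree_bound {k L : Type} [Field k] [IsAlgClosed k] [CharZero k] [Field L]
    [Algebra k L] {n c : ℕ} {w : Fin (n + c + 1) → L} (h0 : w 0 = 1) (hw : LinearIndependent k w)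
    (htr : HasTr k w n) (htop : IntermediateField.adjoin k (range w) = ⊤) :
    ∃ e M : ℕ, (∀ m ≥ M, finrank k ↥(Submodule.span k (range w) ^ m) ≤ e * (m + M + n).choose n) ∧
      c + 1 + min (e - (c + 1)) c + ∑ j ∈ Finset.range n, (c + 1 + (n - j)) ≤
        finrank k ↥(Submodule.span k (range w) ^ 2) := by
  have hfin : FiniteDimensional k (Submodule.span k (range w)) :=
    FiniteDimensional.span_of_finite k (finite_range _)
  rcases Nat.eq_zero_or_pos n with rfl | hn
  · have h1 := finrank_eq_one_of_hasTr_zero htr htop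
    have hfd : FiniteDimensional k L := FiniteDimensional.of_finrank_pos (by omega)
    have h2 := hw.fintype_card_le_finrank
    rw [h1, Fintype.card_fin] at h2
    obtain rfl : c = 0 := by omega
    refine ⟨1, 0, fun m _ => ?_, ?_⟩
    · simpa [h1] using Submodule.finrank_le (Submodule.span k (range w) ^ m)
    · have h3 : (1 : L) ∈ Submodule.span k (range w) ^ 2 := by
        have := Submodule.pow_mem_pow (Submodule.span k (range w))
          (Submodule.subset_span (mem_range_self (f := w) 0)) 2
        rwa [h0, one_pow] at this
      have h4 : Submodule.span k (range w) ^ 2 ≠ ⊥ := fun h =>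
        one_ne_zero ((Submodule.mem_bot k).1 (h ▸ h3))
      have := Submodule.one_le_finrank_iff.2 h4
      simpa using this
  obtain ⟨L', i1, i2, a, ha, hatop⟩ := exists_generic_extension L (Fin n × Fin (n + c))
  let _ : Algebra k L' := ((algebraMap L L').comp (algebraMap k L)).toAlgebra
  have hst : IsScalarTower k L L' := IsScalarTower.of_algebraMap_eq' rfl
  obtain ⟨K, hK⟩ : ∃ K, K = IntermediateField.adjoin k (range (genCoeff a (algebraMap L L' ∘ w))) :=
    ⟨_, rfl⟩
  have haK : ∀ p, a p ∈ K := fun p => hK ▸ IntermediateField.subset_adjoin k _ (by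
    rw [range_genCoeff]; exact Or.inl ⟨p, rfl⟩)
  have halg : Algebra.IsAlgebraic K L' := ⟨fun x => by
    have hx := mem_of_adjoin_eq_top htop hatop (acl k (range (genCoeff a (algebraMap L L' ∘ w))))
      (by rintro _ ⟨i, rfl⟩; exact mem_acl_genCoeff htr h0 ha i)
      (by
        rintro _ ⟨p, rfl⟩
        refine subset_acl _ ?_
        rw [range_genCoeff]; exact Or.inl ⟨p, rfl⟩) x
    rw [mem_acl] at hx
    rw [hK]
    exact hx⟩
  have hgen : Algebra.adjoin K (range (algebraMap L L' ∘ w)) = ⊤ := by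
    rw [← IntermediateField.adjoin_toSubalgebra_of_isAlgebraic
      (fun x _ => Algebra.IsAlgebraic.isAlgebraic x), eq_top_iff]
    rintro x -
    exact mem_of_adjoin_eq_top htop hatop
      ((IntermediateField.adjoin K (range (algebraMap L L' ∘ w))).restrictScalars k)
      (by rintro _ ⟨i, rfl⟩; exact IntermediateField.subset_adjoin K _ ⟨i, rfl⟩)
      (by
        rintro _ ⟨p, rfl⟩
        exact IntermediateField.algebraMap_mem
          (IntermediateField.adjoin K (range (algebraMap L L' ∘ w))) ⟨a p, haK p⟩) x
  have hft : Algebra.FiniteType K L' := ⟨⟨(finite_range (algebraMap L L' ∘ w)).toFinset, by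
    rw [Set.Finite.coe_toFinset, hgen]⟩⟩
  have hfd : FiniteDimensional K L' := Algebra.IsIntegral.finite
  have hbt := eq_bot_or_eq_top_of_genCoeff hn h0 htr ha hatop K hK halg hgen
  obtain ⟨M, hM⟩ := exists_finrank_pow_le h0 htr ha K hK
  refine ⟨finrank K L', M, hM, ?_⟩
  have h1 := le_finrank_span_adjoin (Nat.le_add_right n c) h0 hw htr ha K hK
  have h2 := finrank_mul_self_adjoin_add_sum_le h0 htr ha K hK
  have h3 : c + 1 ≤ finrank K (Submodule.span K (range (algebraMap L L' ∘ w))) := by omega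
  have h4 := add_min_le_finrank_mul_self hbt _ (Submodule.subset_span (by exact ⟨0, by simp [h0]⟩)) h3
  rw [pow_two]
  refine le_trans (add_le_add h4 (Finset.sum_le_sum fun j _ => ?_)) h2
  exact Nat.add_le_add_right h3 _

end QuadricBound

namespace QuadricBound

theorem ringKrullDim_eq_of_isIntegral (A R : Type*) [CommRing A] [CommRing R] [Algebra A R]
    [FaithfulSMul A R] [Algebra.IsIntegral A R] : ringKrullDim R = ringKrullDim A := by
  apply le_antisymm
  · refine Order.krullDim_le_of_strictMono (PrimeSpectrum.comap (algebraMap A R)) ?_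
    intro p q hpq
    exact Ideal.IsIntegral.comap_lt_comap hpq
  · refine iSup_le fun l => ?_
    obtain ⟨Q, hQ, hQl⟩ := Ideal.exists_ideal_over_prime_of_isIntegral (R := A) (S := R)
      (RelSeries.head l).asIdeal ⊥ (by
        rw [← RingHom.ker_eq_comap_bot,
          (RingHom.injective_iff_ker_eq_bot _).1 (FaithfulSMul.algebraMap_injective A R)]
        exact bot_le)
    have hlo : Q.LiesOver (RelSeries.head l).asIdeal := ⟨hQl.2.symm⟩
    have := hQl.1
    obtain ⟨L, hL, -⟩ := Ideal.exists_ltSeries_of_hasGoingUp l Q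
    exact hL ▸ Order.LTSeries.length_le_krullDim L

theorem trdeg_eq_of_ringKrullDim_eq {k R Q : Type} [Field k] [CommRing R] [IsDomain R] [Algebra k R]
    [Algebra.FiniteType k R] [Field Q] [Algebra R Q] [IsFractionRing R Q] [Algebra k Q]
    [IsScalarTower k R Q] {m : ℕ} (h : ringKrullDim R = (m : ℕ)) : Algebra.trdeg k Q = m := by
  obtain ⟨s, g, hg, hgi⟩ := exists_integral_inj_algHom_of_fg k R
  let _ : Algebra (MvPolynomial (Fin s) k) R := g.toRingHom.toAlgebra
  have h1 : IsScalarTower k (MvPolynomial (Fin s) k) R :=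
    IsScalarTower.of_algebraMap_eq' (g.comp_algebraMap).symm
  have h2 : Algebra.IsIntegral (MvPolynomial (Fin s) k) R := ⟨hgi⟩
  have h3 : FaithfulSMul (MvPolynomial (Fin s) k) R :=
    (faithfulSMul_iff_algebraMap_injective _ _).2 hg
  have h4 := ringKrullDim_eq_of_isIntegral (MvPolynomial (Fin s) k) R
  rw [h, MvPolynomial.ringKrullDim_of_isNoetherianRing, ringKrullDim_eq_zero_of_field, zero_add,
    Nat.card_eq_fintype_card, Fintype.card_fin] at h4
  have h5 : m = s := by exact_mod_cast h4
  have h6 := trdeg_add_eq k (MvPolynomial (Fin s) k) (A := R)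
  have h7 := trdeg_add_eq k R (A := Q)
  have h8 : Algebra.IsAlgebraic R Q := IsLocalization.isAlgebraic _ (nonZeroDivisors R)
  rw [trdeg_eq_zero (R := MvPolynomial (Fin s) k) (A := R), add_zero] at h6
  rw [trdeg_eq_zero (R := R) (A := Q), add_zero] at h7
  rw [← h7, ← h6, MvPolynomial.trdeg_of_isDomain, h5]
  simp

open scoped IntermediateField.algebraAdjoinAdjoin in
theorem isTranscendenceBasis_of_isAlgebraic_adjoin {F E ι : Type*} [Field F] [Field E] [Algebra F E]
    {v : ι → E} (hv : AlgebraicIndependent F v)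
    (h : Algebra.IsAlgebraic (IntermediateField.adjoin F (Set.range v)) E) :
    IsTranscendenceBasis F v := by
  rw [hv.isTranscendenceBasis_iff_isAlgebraic]
  have : IsScalarTower (Algebra.adjoin F (Set.range v))
      (IntermediateField.adjoin F (Set.range v)) E := IsScalarTower.of_algebraMap_eq' rfl
  exact Algebra.IsAlgebraic.trans _ (IntermediateField.adjoin F (Set.range v)) _

/-- Subfields of a field of transcendence degree `n + 1` over which it is generated by a single
transcendental element. -/
theorem hasTr_of_trdeg {k Q : Type} [Field k] [Field Q] [Algebra k Q] {n : ℕ} {ι : Type} [Finite ι]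
    (L : IntermediateField k Q) {w : ι → L} (htop : IntermediateField.adjoin k (Set.range w) = ⊤)
    {x : Q} (hx : Transcendental L x) (hxtop : IntermediateField.adjoin L {x} = ⊤)
    (htr : Algebra.trdeg k Q = (n + 1 : ℕ)) : HasTr k w n := by
  obtain ⟨s, hs, hw⟩ := exists_algebraicIndependent_comp (F := k) w
  have halg : Algebra.IsAlgebraic (IntermediateField.adjoin k (Set.range fun i : s => w i)) L :=
    ⟨fun y => mem_acl.1 ((IntermediateField.adjoin_le_iff.2 hw :
      IntermediateField.adjoin k (Set.range w) ≤ _) (htop ▸ IntermediateField.mem_top))⟩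
  have h1 := isTranscendenceBasis_of_isAlgebraic_adjoin hs halg
  have h2 := h1.cardinalMk_eq_trdeg
  have h3 : IsTranscendenceBasis L (fun _ : Unit => x) := by
    refine isTranscendenceBasis_of_isAlgebraic_adjoin
      (algebraicIndependent_unique_type_iff.2 hx) ?_
    rw [Set.range_const, hxtop]
    exact ⟨fun y => isAlgebraic_algebraMap (⟨y, IntermediateField.mem_top⟩ :
      (⊤ : IntermediateField L Q))⟩
  have h4 := h3.cardinalMk_eq_trdeg
  have h5 := trdeg_add_eq k L (A := Q)
  rw [← h2, ← h4, htr] at h5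
  have h6 : Nat.card s = n := by
    have := congrArg Cardinal.toNat h5
    rw [Cardinal.toNat_add (Cardinal.lt_aleph0_of_finite _) (Cardinal.lt_aleph0_of_finite _),
      Cardinal.toNat_natCast] at this
    simpa [Nat.card] using this
  have e : Fin n ≃ s := (finCongr h6.symm).trans (Finite.equivFin s).symm
  refine ⟨fun i => e i, hs.comp _ e.injective, ?_⟩
  have h7 : (w ∘ fun i => (e i : ι)) = (fun i : s => w i) ∘ e := rfl
  rw [h7, Set.range_comp, e.range_eq_univ, Set.image_univ]
  exact hw
end QuadricBound

namespace QuadricBound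
open MvPolynomial

/-- A numerical function bounded by a polynomial of degree `n` with leading coefficient
`e / n !` has normalized growth at most `e`. -/
theorem le_of_tendsto_of_le_choose {f : ℕ → ℕ} {n d e M : ℕ}
    (hf : ∀ m ≥ M, f m ≤ e * (m + M + n).choose n)
    (ht : Filter.Tendsto (fun m : ℕ => (f m : ℝ) * (n.factorial : ℝ) / (m : ℝ) ^ n)
      Filter.atTop (nhds (d : ℝ))) : d ≤ e := by
  have h1 : Filter.Tendsto (fun m : ℕ => (e : ℝ) * (1 + ((M + n : ℕ) : ℝ) / (m : ℝ)) ^ n)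
      Filter.atTop (nhds ((e : ℝ) * (1 + 0) ^ n)) :=
    ((tendsto_const_nhds.add (tendsto_const_div_atTop_nhds_zero_nat _)).pow n).const_mul _
  rw [add_zero, one_pow, mul_one] at h1
  have h2 : (d : ℝ) ≤ e := by
    refine le_of_tendsto_of_tendsto ht h1 ?_
    filter_upwards [Filter.eventually_ge_atTop (max M 1)] with m hm
    have hm0 : (0 : ℝ) < m := by exact_mod_cast (le_max_right _ _).trans hm
    have h3 : (f m : ℝ) ≤ e * ((m + M + n).choose n : ℕ) := by
      exact_mod_cast hf m ((le_max_left _ _).trans hm)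
    have h4 : (((m + M + n).choose n : ℕ) : ℝ) * n.factorial ≤ ((m + M + n : ℕ) : ℝ) ^ n := by
      rw [← le_div_iff₀ (by positivity)]
      exact Nat.choose_le_pow_div n (m + M + n)
    rw [div_le_iff₀ (by positivity), mul_assoc, ← mul_pow, add_mul, one_mul,
      div_mul_cancel₀ _ hm0.ne', ← Nat.cast_add, ← add_assoc]
    calc (f m : ℝ) * n.factorial ≤ e * ((m + M + n).choose n : ℕ) * n.factorial := by gcongr
      _ ≤ _ := by rw [mul_assoc]; gcongr
  exact_mod_cast h2

theorem sum_add_choose_two (n c : ℕ) :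
    ∑ j ∈ Finset.range n, (c + 1 + (n - j)) + (c + 2).choose 2 = (n + c + 2).choose 2 := by
  induction n with
  | zero => simp
  | succ n ih =>
    rw [Finset.sum_range_succ', add_assoc, add_comm _ ((c + 2).choose 2), ← add_assoc]
    simp only [Nat.add_sub_add_right, ih, Nat.sub_zero]
    rw [show n + 1 + c + 2 = (n + c + 2) + 1 by ring, Nat.choose_succ_succ' (n + c + 2) 1, Nat.choose_one_right]
    ring
end QuadricBound

namespace QuadricBound
open MvPolynomial

theorem aeval_smul_of_isHomogeneous {k Q ι : Type*} [Field k] [Field Q] [Algebra k Q]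
    {f : MvPolynomial ι k} {m : ℕ} (hf : f.IsHomogeneous m) (t : Q) (y : ι → Q) :
    aeval (fun i => t * y i) f = t ^ m * aeval y f := by
  rw [aeval_def, aeval_def, eval₂_eq, eval₂_eq, Finset.mul_sum]
  refine Finset.sum_congr rfl fun s hs => ?_
  simp only [mul_pow]
  rw [Finset.prod_mul_distrib, Finset.prod_pow_eq_pow_sum, mul_left_comm]
  congr 2
  rw [← hf.degree_eq_sum_deg_support hs]

theorem map_homogeneousSubmodule_aeval {k A ι : Type*} [Field k] [CommRing A] [Algebra k A]
    (w : ι → A) (m : ℕ) :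
    (homogeneousSubmodule ι k m).map (aeval w : MvPolynomial ι k →ₐ[k] A).toLinearMap =
      Submodule.span k (Set.range w) ^ m := by
  rw [← homogeneousSubmodule_one_pow, Submodule.map_pow, homogeneousSubmodule_one_eq_span_X,
    Submodule.map_span, ← Set.range_comp]
  congr 3
  ext i
  simp

/-- The part of degree `m` of the polynomial ring is the sum of its image under an evaluation and
of its intersection with the kernel. -/
theorem finrank_homogeneousSubmodule {k A ι : Type*} [Field k] [CommRing A] [Algebra k A]
    [Finite ι] (w : ι → A) (m : ℕ) (K : Submodule k (MvPolynomial ι k))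
    (hK : ∀ f ∈ homogeneousSubmodule ι k m, f ∈ K ↔ aeval w f = 0) :
    Module.finrank k ↥(Submodule.span k (Set.range w) ^ m) +
      Module.finrank k ↥(K ⊓ homogeneousSubmodule ι k m) =
      Module.finrank k ↥(homogeneousSubmodule ι k m) := by
  have hfin : Module.Finite k (homogeneousSubmodule ι k m) :=
    Module.Finite.iff_fg.2 (homogeneousSubmodule_fg ι k m)
  set φ := (aeval w : MvPolynomial ι k →ₐ[k] A).toLinearMap with hφ
  have h := LinearMap.finrank_range_add_finrank_ker (φ.domRestrict (homogeneousSubmodule ι k m))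
  rw [LinearMap.range_domRestrict, hφ, map_homogeneousSubmodule_aeval] at h
  rw [← h]
  congr 1
  rw [← Submodule.finrank_map_subtype_eq]
  suffices h' : K ⊓ homogeneousSubmodule ι k m = Submodule.map (homogeneousSubmodule ι k m).subtype
      (φ.domRestrict (homogeneousSubmodule ι k m)).ker by rw [h']
  ext f
  simp only [Submodule.mem_inf, Submodule.mem_map, LinearMap.mem_ker]
  constructor
  · rintro ⟨h1, h2⟩
    exact ⟨⟨f, h2⟩, (hK f h2).1 h1, rfl⟩
  · rintro ⟨g, h1, rfl⟩
    exact ⟨(hK _ g.2).2 h1, g.2⟩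

theorem finrank_homogeneousSubmodule_le (k : Type*) [Field k] (N m : ℕ) :
    Module.finrank k ↥(homogeneousSubmodule (Fin (N + 1)) k m) ≤ (m + N).choose N := by
  have h := finrank_pow_le (F := k) (X : Fin (N + 1) → MvPolynomial (Fin (N + 1)) k) m
  rwa [← homogeneousSubmodule_one_eq_span_X, homogeneousSubmodule_one_pow] at h

/-- If a field generated by `x` admits all rescalings of `x` as endomorphisms, then a nonzero
coordinate is transcendental over the subfield of functions of degree zero. -/
theorem transcendental_of_rescaling {k Q ι : Type*} [Field k] [Infinite k] [Field Q] [Algebra k Q]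
    {x : ι → Q} {i₀ : ι} (h0 : x i₀ ≠ 0)
    (hs : ∀ t : k, t ≠ 0 → ∃ σ : Q →ₐ[k] Q, ∀ i, σ (x i) = t • x i) :
    Transcendental (IntermediateField.adjoin k (Set.range fun i => (x i₀)⁻¹ * x i)) (x i₀) := by
  rintro ⟨p, hp, hpx⟩
  apply hp
  have hp' : p.map (algebraMap _ Q) = 0 := by
    apply Polynomial.eq_zero_of_infinite_isRoot
    refine Set.Infinite.mono (s := (fun t : k => t • x i₀) '' {0}ᶜ) ?_ ?_
    · rintro _ ⟨t, ht, rfl⟩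
      obtain ⟨σ, hσ⟩ := hs t ht
      have hfix : ∀ z ∈ IntermediateField.adjoin k (Set.range fun i => (x i₀)⁻¹ * x i),
          σ z = z := by
        intro z hz
        induction hz using IntermediateField.adjoin_induction with
        | mem z hz =>
          obtain ⟨i, rfl⟩ := hz
          have ht' : algebraMap k Q t ≠ 0 := by simpa using ht
          simp only [map_mul, map_inv₀, hσ, Algebra.smul_def]
          field_simp
        | algebraMap z => exact σ.commutes z
        | add z z' _ _ h h' => rw [map_add, h, h']
        | inv z _ h => rw [map_inv₀, h]
        | mul z z' _ _ h h' => rw [map_mul, h, h']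
      change Polynomial.eval (t • x i₀) _ = 0
      rw [← hσ, Polynomial.eval_map_algebraMap,
        Polynomial.aeval_eq_sum_range, ← map_zero σ, ← hpx, Polynomial.aeval_eq_sum_range, map_sum]
      refine Finset.sum_congr rfl fun j _ => ?_
      rw [Algebra.smul_def, Algebra.smul_def, map_mul, map_pow]
      exact congrArg (· * _) (hfix _ (p.coeff j).2).symm
    · refine Set.Infinite.image ?_ (Set.Finite.infinite_compl (Set.finite_singleton 0))
      intro a _ b _ hab
      exact smul_left_injective k h0 hab
  exact (Polynomial.map_eq_zero _).1 hp'

theorem adjoin_adjoin_eq_top {k Q ι : Type*} [Field k] [Field Q] [Algebra k Q]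
    {x : ι → Q} {i₀ : ι} (h0 : x i₀ ≠ 0) (htop : IntermediateField.adjoin k (Set.range x) = ⊤) :
    IntermediateField.adjoin (IntermediateField.adjoin k (Set.range fun i => (x i₀)⁻¹ * x i))
      {x i₀} = ⊤ := by
  apply IntermediateField.restrictScalars_injective k
  rw [IntermediateField.restrictScalars_top, eq_top_iff, ← htop, IntermediateField.adjoin_le_iff]
  rintro _ ⟨i, rfl⟩
  rw [SetLike.mem_coe, IntermediateField.mem_restrictScalars, ← mul_inv_cancel_left₀ h0 (x i)]
  exact mul_mem (IntermediateField.mem_adjoin_simple_self _ _)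
    (IntermediateField.algebraMap_mem _ (⟨_, IntermediateField.subset_adjoin _ _ ⟨i, rfl⟩⟩ :
      IntermediateField.adjoin k (Set.range fun i => (x i₀)⁻¹ * x i)))

theorem exists_rescaling {k ι : Type*} [Field k] {I : Ideal (MvPolynomial ι k)} [I.IsPrime]
    {Q : Type*} [Field Q] [Algebra (MvPolynomial ι k ⧸ I) Q]
    [IsFractionRing (MvPolynomial ι k ⧸ I) Q] [Algebra k Q]
    [IsScalarTower k (MvPolynomial ι k ⧸ I) Q] {x : ι → Q}
    (hx : ∀ f, aeval x f = algebraMap (MvPolynomial ι k ⧸ I) Q (Ideal.Quotient.mk I f)) {t : k}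
    (ht : ∀ f, aeval (fun i => (C t * X i : MvPolynomial ι k)) f ∈ I ↔ f ∈ I) :
    ∃ σ : Q →ₐ[k] Q, ∀ i, σ (x i) = t • x i := by
  have hxI : ∀ f, aeval x f = 0 ↔ f ∈ I := fun f => by
    rw [hx, map_eq_zero_iff _ (IsFractionRing.injective (MvPolynomial ι k ⧸ I) Q),
      Ideal.Quotient.eq_zero_iff_mem]
  have hcomp : ∀ f : MvPolynomial ι k, aeval (fun i => t • x i) f =
      aeval x (aeval (fun i => (C t * X i : MvPolynomial ι k)) f) := by
    intro f
    rw [← AlgHom.comp_apply, comp_aeval]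
    simp [Algebra.smul_def]
  let τ : MvPolynomial ι k ⧸ I →ₐ[k] Q := Ideal.Quotient.liftₐ I (aeval (fun i => t • x i))
    fun f hf => by
      rw [hcomp, hxI]
      exact (ht f).2 hf
  have hτ : ∀ f, τ (Ideal.Quotient.mk I f) = aeval (fun i => t • x i) f := fun f => rfl
  have hinj : Function.Injective τ := by
    rw [injective_iff_map_eq_zero]
    intro a ha
    obtain ⟨f, rfl⟩ := Ideal.Quotient.mk_surjective a
    rw [hτ, hcomp, hxI, ht] at ha
    exact Ideal.Quotient.eq_zero_iff_mem.2 ha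
  refine ⟨IsFractionRing.liftAlgHom hinj, fun i => ?_⟩
  have h1 := hx (X i)
  rw [aeval_X] at h1
  rw [h1, IsFractionRing.liftAlgHom_apply, IsFractionRing.lift_algebraMap, ← h1]
  exact (hτ _).trans (aeval_X _ _)

end QuadricBound

namespace QuadricBound
open MvPolynomial

theorem exists_degree_bound_of_cone {k : Type} [Field k] [IsAlgClosed k] [CharZero k] {n c : ℕ}
    {I : Ideal (MvPolynomial (Fin (n + c + 1)) k)} [I.IsPrime]
    (hcone : ∀ t : k, t ≠ 0 → ∀ f : MvPolynomial (Fin (n + c + 1)) k,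
      aeval (fun i => (C t * X i : MvPolynomial (Fin (n + c + 1)) k)) f ∈ I ↔ f ∈ I)
    (hlin : ∀ f ∈ homogeneousSubmodule (Fin (n + c + 1)) k 1, f ∈ I → f = 0)
    (hdim : ringKrullDim (MvPolynomial (Fin (n + c + 1)) k ⧸ I) = (n + 1 : ℕ)) :
    ∃ e M : ℕ,
      (∀ m ≥ M, Module.finrank k ↥(homogeneousSubmodule (Fin (n + c + 1)) k m) -
        Module.finrank k ↥(I.restrictScalars k ⊓ homogeneousSubmodule (Fin (n + c + 1)) k m) ≤
          e * (m + M + n).choose n) ∧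
      c + 1 + min (e - (c + 1)) c + ∑ j ∈ Finset.range n, (c + 1 + (n - j)) +
        Module.finrank k ↥(I.restrictScalars k ⊓ homogeneousSubmodule (Fin (n + c + 1)) k 2) ≤
          Module.finrank k ↥(homogeneousSubmodule (Fin (n + c + 1)) k 2) := by
  let Q := FractionRing (MvPolynomial (Fin (n + c + 1)) k ⧸ I)
  obtain ⟨x, hxdef⟩ : ∃ x : Fin (n + c + 1) → Q, ∀ i,
    x i = algebraMap (MvPolynomial (Fin (n + c + 1)) k ⧸ I) Q (Ideal.Quotient.mk I (X i)) := ⟨_, fun _ => rfl⟩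
  have hx : ∀ f, aeval x f = algebraMap (MvPolynomial (Fin (n + c + 1)) k ⧸ I) Q (Ideal.Quotient.mk I f) := by
    intro f
    have h := aeval_unique
      ((IsScalarTower.toAlgHom k (MvPolynomial (Fin (n + c + 1)) k ⧸ I) Q).comp (Ideal.Quotient.mkₐ k I))
    have h' : x = ⇑((IsScalarTower.toAlgHom k (MvPolynomial (Fin (n + c + 1)) k ⧸ I) Q).comp
      (Ideal.Quotient.mkₐ k I)) ∘ X := funext hxdef
    rw [h', ← h]
    rfl
  have hxI : ∀ f, aeval x f = 0 ↔ f ∈ I := fun f => by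
    rw [hx, map_eq_zero_iff _ (IsFractionRing.injective (MvPolynomial (Fin (n + c + 1)) k ⧸ I) Q),
      Ideal.Quotient.eq_zero_iff_mem]
  have h0 : x 0 ≠ 0 := fun h => by
    have h' := hlin (X 0) (isHomogeneous_X k 0) ((hxI _).1 (by rw [aeval_X, h]))
    exact X_ne_zero _ h'
  have hxtop : IntermediateField.adjoin k (Set.range x) = ⊤ := by
    rw [eq_top_iff]
    rintro q -
    have hmem : ∀ f : MvPolynomial (Fin (n + c + 1)) k, aeval x f ∈ IntermediateField.adjoin k (Set.range x) := by
      intro f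
      refine IntermediateField.algebra_adjoin_le_adjoin k (Set.range x) ?_
      rw [Algebra.adjoin_range_eq_range_aeval]
      exact ⟨f, rfl⟩
    obtain ⟨a, b, -, rfl⟩ := IsFractionRing.div_surjective (A := MvPolynomial (Fin (n + c + 1)) k ⧸ I) q
    obtain ⟨f, rfl⟩ := Ideal.Quotient.mk_surjective a
    obtain ⟨g, rfl⟩ := Ideal.Quotient.mk_surjective b
    rw [← hx, ← hx]
    exact div_mem (hmem f) (hmem g)
  set L := IntermediateField.adjoin k (Set.range fun i => (x 0)⁻¹ * x i) with hL
  let w : Fin (n + c + 1) → L := fun i => ⟨(x 0)⁻¹ * x i, IntermediateField.subset_adjoin _ _ ⟨i, rfl⟩⟩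
  have hwx : ∀ (m : ℕ), ∀ f ∈ homogeneousSubmodule (Fin (n + c + 1)) k m, f ∈ I ↔ aeval w f = 0 := by
    intro m f hf
    have h1 : x = fun i => x 0 * ((x 0)⁻¹ * x i) := funext fun i => (mul_inv_cancel_left₀ h0 _).symm
    have h2 : (aeval (fun i => (x 0)⁻¹ * x i) f : Q) = L.val (aeval w f) := by
      rw [← AlgHom.comp_apply, comp_aeval]
      rfl
    rw [← hxI, h1, aeval_smul_of_isHomogeneous hf, h2, mul_eq_zero, or_iff_right (pow_ne_zero _ h0)]
    exact map_eq_zero_iff _ L.val.injective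
  have hw0 : w 0 = 1 := Subtype.ext (inv_mul_cancel₀ h0)
  have hwli : LinearIndependent k w := by
    rw [Fintype.linearIndependent_iff]
    intro a ha i
    have hmem : (∑ i, C (a i) * X i : MvPolynomial (Fin (n + c + 1)) k) ∈ homogeneousSubmodule (Fin (n + c + 1)) k 1 :=
      sum_mem fun i _ => isHomogeneous_C_mul_X _ _
    have h1 := hlin _ hmem ((hwx 1 _ hmem).2 (by
      rw [← ha]
      simp [Algebra.smul_def]))
    have h2 := congrArg (coeff (Finsupp.single i 1)) h1
    simpa [coeff_sum, coeff_C_mul, coeff_X, Finsupp.single_left_inj] using h2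
  have hwtop : IntermediateField.adjoin k (Set.range w) = ⊤ := by
    apply IntermediateField.lift_injective L
    rw [IntermediateField.lift_adjoin, IntermediateField.lift_top, ← Set.range_comp]
    rfl
  have htr : HasTr k w n := hasTr_of_trdeg L hwtop
    (transcendental_of_rescaling h0 fun t ht => exists_rescaling hx (hcone t ht))
    (adjoin_adjoin_eq_top h0 hxtop) (trdeg_eq_of_ringKrullDim_eq hdim)
  obtain ⟨e, M, h1, h2⟩ := exists_degree_bound hw0 hwli htr hwtop
  have hfin := fun m => finrank_homogeneousSubmodule w m (I.restrictScalars k) (hwx m)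
  refine ⟨e, M, fun m hm => ?_, ?_⟩
  · rw [← hfin m, Nat.add_sub_cancel]
    exact h1 m hm
  · rw [← hfin 2]
    exact Nat.add_le_add_right h2 _
end QuadricBound

namespace QuadricBound

theorem mem_vanIdeal {k : Type} [Field k] {ι : Type} {C : Set (ι → k)} {f : MvPolynomial ι k} :
    f ∈ vanIdeal k ι C ↔ ∀ x ∈ C, eval x f = 0 := by
  simp [vanIdeal, Submodule.mem_iInf, RingHom.mem_ker]

theorem rescale_mem_vanIdeal {k : Type} [Field k] {ι : Type} {V : Set (ι → k)}
    (hV : ∀ x ∈ V, ∀ t : k, t • x ∈ V) {t : k} (ht : t ≠ 0) (f : MvPolynomial ι k) :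
    aeval (fun i => (C t * X i : MvPolynomial ι k)) f ∈ vanIdeal k ι V ↔ f ∈ vanIdeal k ι V := by
  have h : ∀ x : ι → k, eval x (aeval (fun i => (C t * X i : MvPolynomial ι k)) f) =
      eval (t • x) f := by
    intro x
    rw [← coe_aeval_eq_eval, ← coe_aeval_eq_eval]
    change ((aeval x).comp (aeval fun i => (C t * X i : MvPolynomial ι k))) f = aeval (t • x) f
    rw [comp_aeval]
    congr 2
    ext i
    simp
  simp only [mem_vanIdeal, h]
  refine ⟨fun H x hx => ?_, fun H x hx => H _ (hV x hx t)⟩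
  simpa [smul_smul, ht] using H _ (hV x hx t⁻¹)

end QuadricBound

/-- fundamental inequality, cf. (1.2) in the paper.
For a nondegenerate irreducible projective variety `X ⊆ ℙ^{n+c}` of dimension `n`,
codimension `c` and degree `d` over an algebraically closed field of characteristic `0`,
`a₂(X) ≤ C(c+1, 2) - min (d - c - 1) c`. -/
theorem stmt_0 {k : Type} [Field k] [IsAlgClosed k] [CharZero k]
    (n c d : ℕ) (C : Set (Fin (n + c + 1) → k))
    (hV : IsProjVariety k (Fin (n + c + 1)) C)
    (hnd : Nondeg k (Fin (n + c + 1)) C)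
    (hdim : HasDim k (Fin (n + c + 1)) C n)
    (hdeg : HasDegree k (Fin (n + c + 1)) C n d) :
    a2 k (Fin (n + c + 1)) C ≤ Nat.choose (c + 1) 2 - min (d - c - 1) c := by
  have hprime := hV.prime
  obtain ⟨e, M, h1, h2⟩ := QuadricBound.exists_degree_bound_of_cone
    (fun t ht f => QuadricBound.rescale_mem_vanIdeal hV.smul_mem ht f)
    (fun f hf hfI => hnd f hf (QuadricBound.mem_vanIdeal.1 hfI)) hdim
  have hde : d ≤ e := QuadricBound.le_of_tendsto_of_le_choose h1 hdeg
  have h3 := QuadricBound.finrank_homogeneousSubmodule_le k (n + c) 2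
  have h4 := QuadricBound.sum_add_choose_two n c
  have h5 : (c + 2).choose 2 = (c + 1) + (c + 1).choose 2 := by
    rw [Nat.choose_succ_succ' (c + 1) 1, Nat.choose_one_right]
  have h6 : (2 + (n + c)).choose (n + c) = (n + c + 2).choose 2 := by
    rw [Nat.choose_symm_add.symm, add_comm]
  have h7 : min (d - c - 1) c ≤ min (e - (c + 1)) c := by omega
  unfold a2 quadrics idealPiece
  omega
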